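/- Let (S,R) be an Artin-Tits presentation such that every connected full subgraph of its Coxeter graph containing no ∞-labelled edge is either of spherical type or of large type. Then (S,R) satisfies Property H# with respect to some S-sequence of transversals, and hence satisfies Property H; in particular for every word w over S ∪ S⁻¹, w →_{0,1,2} ε if and only if w̄ = 1. -/

import Mathlib

namespace ArtinTits

open Classical List

variable {S : Type*}

/-- A word over `S ∪ S⁻¹`: a list of letters, each a generator together with a sign
(`true` = the generator itself, `false` = its formal inverse). -/
abbrev Word (S : Type*) := List (S × Bool)

/-- The formal inverse of a word. -/
def wordInv (w : Word S) : Word S := w.reverse.map fun l => (l.1, !l.2)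

/-- `[x,y,j⟩`: the alternating positive word `xyxy⋯` with `j` letters, beginning with `x`. -/
def altWord (x y : S) : ℕ → Word S
  | 0 => []
  | j + 1 => (x, true) :: altWord y x j

/-- `⟨x,y,j]`: the alternating positive word `⋯xy` with `j` letters, ending with `y`. -/
def altWordR (x y : S) (j : ℕ) : Word S := (altWord y x j).reverse

/-- The data of a labelled finite complete simplicial graph `Γ₀`: a symmetric label map
with values in `{2,3,…} ∪ {∞}` on pairs of distinct vertices. -/
structure ArtinData (S : Type*) where
  m : S → S → ℕ∞
  symm : ∀ s t, m s t = m t s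
  two_le : ∀ s t : S, s ≠ t → 2 ≤ m s t

/-- `u = v` is a defining (braid) relation of the Artin–Tits presentation. -/
def IsRel (A : ArtinData S) (u v : Word S) : Prop :=
  ∃ (s t : S) (k : ℕ), s ≠ t ∧ A.m s t = (k : ℕ∞) ∧
    u = altWord s t k ∧ v = altWord t s k

/-- The relator set of the Artin–Tits presentation, inside the free group. -/
def rels (A : ArtinData S) : Set (FreeGroup S) :=
  {x | ∃ u v : Word S, IsRel A u v ∧ x = FreeGroup.mk u * (FreeGroup.mk v)⁻¹}

/-- The Artin–Tits group `A(Γ₀)` of the presentation. -/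
abbrev ArtinGroup (A : ArtinData S) := PresentedGroup (rels A)

/-- `w̄`: the element of the Artin–Tits group represented by the word `w`. -/
def wbar (A : ArtinData S) (w : Word S) : ArtinGroup A :=
  PresentedGroup.mk (rels A) (FreeGroup.mk w)

/-! ### Special transformations -/

/-- Type 0: delete a factor `s s⁻¹` or `s⁻¹ s`. -/
def Step0 (w w' : Word S) : Prop :=
  ∃ (w₁ w₂ : Word S) (s : S) (b : Bool),
    w = w₁ ++ [(s, b), (s, !b)] ++ w₂ ∧ w' = w₁ ++ w₂

/-- Type ∞: insert a factor `s s⁻¹` or `s⁻¹ s` (the inverse of type 0). -/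
def StepInfty (w w' : Word S) : Prop := Step0 w' w

/-- Type 1: replace a factor `v` by `u`, or `v⁻¹` by `u⁻¹`, where `u = v` is a defining
relation. -/
def Step1 (A : ArtinData S) (w w' : Word S) : Prop :=
  ∃ (w₁ w₂ u v : Word S), IsRel A u v ∧
    ((w = w₁ ++ v ++ w₂ ∧ w' = w₁ ++ u ++ w₂) ∨
     (w = w₁ ++ wordInv v ++ w₂ ∧ w' = w₁ ++ wordInv u ++ w₂))

/-- Type 2r: for a defining relation `u₁u₂ = v₁v₂` with `u₁, v₁` non-empty, replace a factor
`v₁⁻¹ u₁` by `v₂ u₂⁻¹`. -/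
def Step2r (A : ArtinData S) (w w' : Word S) : Prop :=
  ∃ (w₁ w₂ u₁ u₂ v₁ v₂ : Word S), IsRel A (u₁ ++ u₂) (v₁ ++ v₂) ∧
    u₁ ≠ [] ∧ v₁ ≠ [] ∧
    w = w₁ ++ wordInv v₁ ++ u₁ ++ w₂ ∧ w' = w₁ ++ v₂ ++ wordInv u₂ ++ w₂

/-- Type 2l: for a defining relation `u₁u₂ = v₁v₂` with `u₂, v₂` non-empty, replace a factor
`v₂ u₂⁻¹` by `v₁⁻¹ u₁`. -/
def Step2l (A : ArtinData S) (w w' : Word S) : Prop :=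
  ∃ (w₁ w₂ u₁ u₂ v₁ v₂ : Word S), IsRel A (u₁ ++ u₂) (v₁ ++ v₂) ∧
    u₂ ≠ [] ∧ v₂ ≠ [] ∧
    w = w₁ ++ v₂ ++ wordInv u₂ ++ w₂ ∧ w' = w₁ ++ wordInv v₁ ++ u₁ ++ w₂

/-- Type 2: a type 2r or type 2l transformation. -/
def Step2 (A : ArtinData S) (w w' : Word S) : Prop := Step2r A w w' ∨ Step2l A w w'

/-- `p` is the greatest (longest) common left factor of `x` and `y`. -/
def IsLCPrefix (p x y : Word S) : Prop :=
  p <+: x ∧ p <+: y ∧ ∀ q : Word S, q <+: x → q <+: y → q.length ≤ p.length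

/-- `p` is the greatest (longest) common right factor of `x` and `y`. -/
def IsLCSuffix (p x y : Word S) : Prop :=
  p <:+ x ∧ p <:+ y ∧ ∀ q : Word S, q <:+ x → q <:+ y → q.length ≤ p.length

/-- Type 2r⋆ : a type 2r transformation `w₁ v⁻¹ v' w₂ → w₁ u (u')⁻¹ w₂` (with `vu = v'u'` a
defining relation) such that `v` is the greatest common left factor of `vu` and `v w₁⁻¹`, and
`v'` is the greatest common left factor of `v'u'` and `v' w₂`. -/
def Step2rStar (A : ArtinData S) (w w' : Word S) : Prop :=
  ∃ (w₁ w₂ v u v' u' : Word S), IsRel A (v ++ u) (v' ++ u') ∧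
    v ≠ [] ∧ v' ≠ [] ∧
    w = w₁ ++ wordInv v ++ v' ++ w₂ ∧
    w' = w₁ ++ u ++ wordInv u' ++ w₂ ∧
    IsLCPrefix v (v ++ u) (v ++ wordInv w₁) ∧
    IsLCPrefix v' (v' ++ u') (v' ++ w₂)

/-- Type 2l⋆ : a type 2l transformation `w₁ v (v')⁻¹ w₂ → w₁ u⁻¹ u' w₂` (with `uv = u'v'` a
defining relation) such that `v` is the greatest common right factor of `uv` and `w₁ v`, and
`v'` is the greatest common right factor of `u'v'` and `w₂⁻¹ v'`. -/
def Step2lStar (A : ArtinData S) (w w' : Word S) : Prop :=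
  ∃ (w₁ w₂ v u v' u' : Word S), IsRel A (u ++ v) (u' ++ v') ∧
    v ≠ [] ∧ v' ≠ [] ∧
    w = w₁ ++ v ++ wordInv v' ++ w₂ ∧
    w' = w₁ ++ wordInv u ++ u' ++ w₂ ∧
    IsLCSuffix v (u ++ v) (w₁ ++ v) ∧
    IsLCSuffix v' (u' ++ v') (wordInv w₂ ++ v')

/-- Type 2⋆ : a type 2r⋆ or type 2l⋆ transformation. -/
def Step2Star (A : ArtinData S) (w w' : Word S) : Prop :=
  Step2rStar A w w' ∨ Step2lStar A w w'

/-- `w →_{0,1,2} w'`. -/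
def Steps012 (A : ArtinData S) : Word S → Word S → Prop :=
  Relation.ReflTransGen fun x y => Step0 x y ∨ Step1 A x y ∨ Step2 A x y

/-- `w →_{0,1,2⋆} w'`. -/
def Steps012Star (A : ArtinData S) : Word S → Word S → Prop :=
  Relation.ReflTransGen fun x y => Step0 x y ∨ Step1 A x y ∨ Step2Star A x y

/-- `w →_{2⋆} w'`. -/
def Steps2Star (A : ArtinData S) : Word S → Word S → Prop :=
  Relation.ReflTransGen (Step2Star A)

/-- `w →_{1,2⋆} w'`. -/
def Steps12Star (A : ArtinData S) : Word S → Word S → Prop :=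
  Relation.ReflTransGen fun x y => Step1 A x y ∨ Step2Star A x y

/-- `w →_{1,2} w'`. -/
def Steps12 (A : ArtinData S) : Word S → Word S → Prop :=
  Relation.ReflTransGen fun x y => Step1 A x y ∨ Step2 A x y

/-! ### Classes of words -/

/-- A positive word: written over `S`. -/
def Positive (w : Word S) : Prop := ∀ l ∈ w, l.2 = true

/-- A negative word: written over `S⁻¹`. -/
def Negative (w : Word S) : Prop := ∀ l ∈ w, l.2 = false

/-- A signed word: positive or negative. -/
def Signed (w : Word S) : Prop := Positive w ∨ Negative w

/-- An unsigned word: neither positive nor negative. -/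
def Unsigned (w : Word S) : Prop := ¬ Positive w ∧ ¬ Negative w

/-- A freely reduced word: no factor `s s⁻¹` or `s⁻¹ s`. -/
def FreelyReduced (w : Word S) : Prop :=
  ∀ (w₁ w₂ : Word S) (s : S) (b : Bool), w ≠ w₁ ++ [(s, b), (s, !b)] ++ w₂

/-- A square-free word: no factor `aa`. -/
def SquareFree (w : Word S) : Prop := ∀ a : S × Bool, ¬ [a, a] <:+: w

/-- `p̃(w)`: the length of the longest square-free positive factor of `w`. -/
noncomputable def ptilde (w : Word S) : ℕ :=
  sSup {n | ∃ v : Word S, v <:+: w ∧ Positive v ∧ SquareFree v ∧ v.length = n}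

/-- `ñ(w)`: the length of the longest negative factor of `w` whose formal inverse is
square-free. -/
noncomputable def ntilde (w : Word S) : ℕ :=
  sSup {n | ∃ v : Word S, v <:+: w ∧ Negative v ∧ SquareFree (wordInv v) ∧ v.length = n}

/-- `p(w) = min(p̃(w), m)`. -/
noncomputable def pfun (M : ℕ) (w : Word S) : ℕ := min (ptilde w) M

/-- `n(w) = min(ñ(w), m)`. -/
noncomputable def nfun (M : ℕ) (w : Word S) : ℕ := min (ntilde w) M

/-- `Ω(Γ₀)` (for a dihedral presentation with label `M`): the freely reduced words with
`max(p(w), n(w)) < M`. -/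
def Omega (M : ℕ) (w : Word S) : Prop :=
  FreelyReduced w ∧ max (pfun M w) (nfun M w) < M

/-- A signed square-free word (square-free positive, or negative with square-free inverse). -/
def SignedSF (w : Word S) : Prop :=
  (Positive w ∧ SquareFree w) ∨ (Negative w ∧ SquareFree (wordInv w))

/-- `v` is the maximal square-free signed left factor of `w`. -/
def MaxSignedSFPrefix (v w : Word S) : Prop :=
  v <+: w ∧ SignedSF v ∧ ∀ v' : Word S, v' <+: w → SignedSF v' → v'.length ≤ v.length

/-- `(v₁, …, v_k)` is the `⋆`-decomposition of `w`: the `v_i` are non-empty, `w = v₁⋯v_k`,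
and each `v_i` is the maximal square-free signed left factor of `v_i⋯v_k`. -/
def StarDecomp (w : Word S) (L : List (Word S)) : Prop :=
  w = L.flatten ∧ (∀ v ∈ L, v ≠ ([] : Word S)) ∧
    ∀ i (h : i < L.length), MaxSignedSFPrefix (L.get ⟨i, h⟩) ((L.drop i).flatten)

/-! ### Groups, parabolic subgroups, geodesics -/

/-- A word written over `T ∪ T⁻¹` for a subset `T` of the generators. -/
def WordOver (T : Set S) (w : Word S) : Prop := ∀ l ∈ w, l.1 ∈ T

/-- The standard parabolic subgroup `A_T` generated by the image of `T ⊆ S`. -/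
def parab (A : ArtinData S) (T : Set S) : Subgroup (ArtinGroup A) :=
  Subgroup.closure {x | ∃ s ∈ T, x = wbar A [(s, true)]}

/-- A geodesic word: of minimal length among all words representing the same element. -/
def Geodesic (A : ArtinData S) (w : Word S) : Prop :=
  ∀ w' : Word S, wbar A w' = wbar A w → w.length ≤ w'.length

/-- A word over `T ∪ T⁻¹` that is geodesic among the words over `T ∪ T⁻¹` representing the
same element. -/
def GeodesicOver (A : ArtinData S) (T : Set S) (w : Word S) : Prop :=
  WordOver T w ∧
    ∀ w' : Word S, WordOver T w' → wbar A w' = wbar A w → w.length ≤ w'.length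

/-- The length of a group element: the length of any geodesic representative word. -/
noncomputable def elLength (A : ArtinData S) (g : ArtinGroup A) : ℕ :=
  sInf {n | ∃ w : Word S, wbar A w = g ∧ w.length = n}

/-- A positive element: one represented by a positive word. -/
def IsPosElt (A : ArtinData S) (g : ArtinGroup A) : Prop :=
  ∃ w : Word S, Positive w ∧ wbar A w = g

/-- An `H`-transversal: a subset containing `1` and exactly one element of each left
`H`-coset. -/
def IsLeftTransversal {G : Type*} [Group G] (H : Subgroup G) (T : Set G) : Prop :=
  (1 : G) ∈ T ∧ ∀ g : G, ∃! x, x ∈ T ∧ g⁻¹ * x ∈ H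

/-! ### Properties H, H⁺, H# -/

/-- Property `H`: `w →_{0,1,2} ε ↔ w̄ = 1`. -/
def PropertyH (A : ArtinData S) : Prop :=
  ∀ w : Word S, Steps012 A w [] ↔ wbar A w = 1

/-- Property `H⁺`: every word representing an element of a standard parabolic subgroup
`A_{S₀}` can be transformed by `→_{0,1,2⋆}` into a word over `S₀ ∪ S₀⁻¹`. -/
def PropertyHPlus (A : ArtinData S) : Prop :=
  ∀ (S₀ : Set S) (w : Word S), wbar A w ∈ parab A S₀ →
    ∃ w₀ : Word S, WordOver S₀ w₀ ∧ Steps012Star A w w₀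

/-- Property `H#` with respect to an `S`-sequence of transversals `T`. -/
def PropertyHSharpWrt (A : ArtinData S) (T : Set S → Set (ArtinGroup A)) : Prop :=
  (∀ S₀ : Set S, IsLeftTransversal (parab A S₀) (T S₀)) ∧
    ∀ (S' S₀ : Set S) (w : Word S), wbar A w ∈ parab A S' →
      ∃ v u : Word S, WordOver S' v ∧ WordOver (S' ∩ S₀) u ∧
        Steps012 A w (v ++ u) ∧ wbar A v ∈ T S₀

/-- Property `H#`: property `H#` with respect to some `S`-sequence of transversals. -/
def PropertyHSharp (A : ArtinData S) : Prop :=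
  ∃ T : Set S → Set (ArtinGroup A), PropertyHSharpWrt A T

/-! ### Critical words and the involution τ (relative to a dihedral pair) -/

/-- The permutation `δ` induced by conjugation by `Δ`, extended letterwise to words:
the identity if `M` is even, and the swap of `s` and `t` if `M` is odd. -/
noncomputable def deltaMap (s t : S) (M : ℕ) (w : Word S) : Word S :=
  if Even M then w
  else w.map fun l => (if l.1 = s then t else if l.1 = t then s else l.1, l.2)

/-- `w` is an unsigned critical word (of the dihedral pair `{s,t}` with label `M`) and
`w' = τ(w)`. -/
def UCritTauPair (A : ArtinData S) (s t : S) (M : ℕ) (w w' : Word S) : Prop :=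
  WordOver {s, t} w ∧ FreelyReduced w ∧ Unsigned w ∧ GeodesicOver A {s, t} w ∧
  pfun M w + nfun M w = M ∧
  ∃ (x y z z' : S) (wm : Word S),
    ({x, y} : Set S) = {s, t} ∧ ({z, z'} : Set S) = {s, t} ∧
    ((w = altWord x y (pfun M w) ++ wm ++ wordInv (altWord z z' (nfun M w)) ∧
      w' = wordInv (altWordR x y (nfun M w)) ++ deltaMap s t M wm ++
        altWordR z z' (pfun M w)) ∨
     (w = wordInv (altWordR x y (nfun M w)) ++ wm ++ altWordR z z' (pfun M w) ∧
      w' = altWord x y (pfun M w) ++ deltaMap s t M wm ++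
        wordInv (altWord z z' (nfun M w))))

/-- `w` is a positive critical word (of the dihedral pair `{s,t}` with label `M`) and
`w' = τ(w)`. -/
def PosCritTauPair (A : ArtinData S) (s t : S) (M : ℕ) (w w' : Word S) : Prop :=
  WordOver {s, t} w ∧ Positive w ∧ pfun M w = M ∧
  ∃ (x y : S) (wm : Word S), ({x, y} : Set S) = {s, t} ∧ pfun M wm < M ∧
    ((w = altWord x y M ++ wm ∧
      (w' = deltaMap s t M wm ++ altWordR x y M ∨
       w' = deltaMap s t M wm ++ altWordR y x M) ∧
      w'.getLast? ≠ w.getLast?) ∨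
     (w = wm ++ altWordR x y M ∧
      (w' = altWord x y M ++ deltaMap s t M wm ∨
       w' = altWord y x M ++ deltaMap s t M wm) ∧
      w'.head? ≠ w.head?))

/-- `w` is a negative critical word and `w' = τ(w)` (defined via formal inverses). -/
def NegCritTauPair (A : ArtinData S) (s t : S) (M : ℕ) (w w' : Word S) : Prop :=
  PosCritTauPair A s t M (wordInv w) (wordInv w')

/-- `w` is a critical word (unsigned, positive or negative) and `w' = τ(w)`. -/
def CritTauPair (A : ArtinData S) (s t : S) (M : ℕ) (w w' : Word S) : Prop :=
  UCritTauPair A s t M w w' ∨ PosCritTauPair A s t M w w' ∨ NegCritTauPair A s t M w w'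

/-- A type β transformation relative to the dihedral pair `{s,t}` with label `M`:
replace a critical factor `v` by `τ(v)`. -/
def StepBetaPair (A : ArtinData S) (s t : S) (M : ℕ) (w w' : Word S) : Prop :=
  ∃ (w₁ w₂ v v' : Word S), w = w₁ ++ v ++ w₂ ∧ w' = w₁ ++ v' ++ w₂ ∧
    CritTauPair A s t M v v'

/-- A type β transformation (in an Artin–Tits group): a type β transformation relative to some
dihedral standard parabolic subgroup (a pair of generators with finite label). -/
def StepBeta (A : ArtinData S) (w w' : Word S) : Prop :=
  ∃ (s t : S) (M : ℕ), s ≠ t ∧ A.m s t = (M : ℕ∞) ∧ StepBetaPair A s t M w w'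

/-! ### Restriction, direct products, Coxeter graph notions -/

/-- The Artin–Tits presentation induced on a subset `T` of the generators (the presentation of
the standard parabolic subgroup `A_T`). -/
def ArtinData.restrict (A : ArtinData S) (T : Set S) : ArtinData T where
  m a b := A.m a b
  symm a b := A.symm a b
  two_le a b h := A.two_le a b fun h' => h (Subtype.ext h')

/-- The Artin–Tits presentation on the disjoint union `S₁ ⊕ S₂` obtained from presentations on
`S₁` and `S₂` by adding the commuting relations `s₁s₂ = s₂s₁` (label `2`) for `s₁ ∈ S₁`,
`s₂ ∈ S₂`. -/
def prodData {S₁ S₂ : Type*} (A₁ : ArtinData S₁) (A₂ : ArtinData S₂) :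
    ArtinData (S₁ ⊕ S₂) where
  m x y :=
    match x, y with
    | Sum.inl a, Sum.inl b => A₁.m a b
    | Sum.inr a, Sum.inr b => A₂.m a b
    | _, _ => 2
  symm x y := by
    cases x <;> cases y
    · exact A₁.symm _ _
    · rfl
    · rfl
    · exact A₂.symm _ _
  two_le x y h := by
    cases x <;> cases y
    · exact A₁.two_le _ _ fun h' => h (congrArg Sum.inl h')
    · exact le_rfl
    · exact le_rfl
    · exact A₂.two_le _ _ fun h' => h (congrArg Sum.inr h')

/-- Adjacency in the Coxeter graph `Γ` restricted to `T`: distinct vertices of `T` joined by an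
edge (i.e. with label `≠ 2`, edges labelled `2` being removed in `Γ`). -/
def coxAdj (A : ArtinData S) (T : Set S) (x y : S) : Prop :=
  x ∈ T ∧ y ∈ T ∧ x ≠ y ∧ A.m x y ≠ 2

/-- The full subgraph of the Coxeter graph on the vertex subset `T` is connected. -/
def CoxConnected (A : ArtinData S) (T : Set S) : Prop :=
  ∀ x ∈ T, ∀ y ∈ T, Relation.ReflTransGen (coxAdj A T) x y

/-- The relator set of the Coxeter presentation on `T`: the Artin relations together with the
squares of the generators. -/
def coxRels (A : ArtinData S) (T : Set S) : Set (FreeGroup T) :=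
  rels (A.restrict T) ∪ {g | ∃ x : T, g = FreeGroup.of x * FreeGroup.of x}

/-- The induced presentation on `T` is of spherical type: its Coxeter group is finite. -/
def SphericalType (A : ArtinData S) (T : Set S) : Prop :=
  Finite (PresentedGroup (coxRels A T))

/-- The induced presentation on `T` is of large type: all labels are `≥ 3` (possibly `∞`). -/
def LargeTypeOn (A : ArtinData S) (T : Set S) : Prop :=
  ∀ x ∈ T, ∀ y ∈ T, x ≠ y → 3 ≤ A.m x y

section

/-! ### Elementary properties of words and of the special transformations -/

@[simp] theorem wordInv_nil : wordInv ([] : Word S) = [] := rfl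

@[simp] theorem wordInv_append (u v : Word S) : wordInv (u ++ v) = wordInv v ++ wordInv u := by
  simp [wordInv]

@[simp] theorem wordInv_singleton (s : S) (b : Bool) : wordInv [(s, b)] = [(s, !b)] := rfl

@[simp] theorem wordInv_wordInv (u : Word S) : wordInv (wordInv u) = u := by
  simp [wordInv, Function.comp_def]

theorem wordInv_cons (l : S × Bool) (u : Word S) :
    wordInv (l :: u) = wordInv u ++ [(l.1, !l.2)] := by
  simp [wordInv]

@[simp] theorem wordInv_eq_nil {u : Word S} : wordInv u = [] ↔ u = [] := by
  simp [wordInv]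

theorem mem_wordInv {u : Word S} {l : S × Bool} : l ∈ wordInv u ↔ (l.1, !l.2) ∈ u := by
  rcases l with ⟨s, b⟩
  simp only [wordInv, mem_map, mem_reverse, Prod.exists, Prod.mk.injEq]
  constructor
  · rintro ⟨a, c, h, rfl, rfl⟩; simpa using h
  · intro h; exact ⟨s, !b, h, rfl, by simp⟩

theorem IsRel.symm {A : ArtinData S} {u v : Word S} (h : IsRel A u v) : IsRel A v u := by
  obtain ⟨s, t, k, hst, hk, rfl, rfl⟩ := h
  exact ⟨t, s, k, hst.symm, by rw [A.symm, hk], rfl, rfl⟩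

@[simp] theorem length_altWord (s t : S) (k : ℕ) : (altWord s t k).length = k := by
  induction k generalizing s t with
  | zero => rfl
  | succ k ih => simp [altWord, ih]

theorem altWord_succ (a c : S) (k : ℕ) : altWord a c (k + 1) =
    altWord a c k ++ [(if Even k then a else c, true)] := by
  induction k generalizing a c with
  | zero => simp [altWord]
  | succ k ih =>
    rw [altWord, ih]
    simp only [altWord, cons_append, Nat.even_add_one]
    split_ifs <;> rfl

theorem mem_altWord {s t : S} {k : ℕ} {l : S × Bool} (h : l ∈ altWord s t k) :
    l.2 = true ∧ (l.1 = s ∨ l.1 = t) := by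
  induction k generalizing s t with
  | zero => simp [altWord] at h
  | succ k ih =>
    simp only [altWord, mem_cons] at h
    rcases h with rfl | h
    · simp
    · have := ih h; tauto

theorem IsRel.length_eq {A : ArtinData S} {u v : Word S} (h : IsRel A u v) :
    u.length = v.length := by
  obtain ⟨s, t, k, hst, hk, rfl, rfl⟩ := h
  simp

theorem IsRel.two_le {A : ArtinData S} {u v : Word S} (h : IsRel A u v) : 2 ≤ u.length := by
  obtain ⟨s, t, k, hst, hk, rfl, rfl⟩ := h
  have := A.two_le s t hst
  rw [hk] at this
  simpa using (by exact_mod_cast this : 2 ≤ k)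

theorem IsRel.mem_iff {A : ArtinData S} {u v : Word S} (h : IsRel A u v) (s : S) :
    (s, true) ∈ u ↔ (s, true) ∈ v := by
  have h2 := h.two_le
  obtain ⟨a, b, k, hst, hk, rfl, rfl⟩ := h
  rw [length_altWord] at h2
  have key : ∀ a b : S, (s, true) ∈ altWord a b k ↔ s = a ∨ s = b := by
    intro a b
    constructor
    · intro h; exact (mem_altWord h).2
    · obtain ⟨k, rfl⟩ := Nat.exists_eq_add_of_le' h2
      rintro (rfl | rfl) <;> simp [altWord]
  rw [key, key, or_comm]

/-- One special transformation. -/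
def OneStep (A : ArtinData S) (w w' : Word S) : Prop := Step0 w w' ∨ Step1 A w w' ∨ Step2 A w w'

theorem OneStep.context {A : ArtinData S} {w w' : Word S} (h : OneStep A w w') (x y : Word S) :
    OneStep A (x ++ w ++ y) (x ++ w' ++ y) := by
  rcases h with ⟨w₁, w₂, s, b, rfl, rfl⟩ | ⟨w₁, w₂, u, v, h, h'⟩ | h | h
  · exact Or.inl ⟨x ++ w₁, w₂ ++ y, s, b, by simp, by simp⟩
  · refine Or.inr (Or.inl ⟨x ++ w₁, w₂ ++ y, u, v, h, ?_⟩)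
    rcases h' with ⟨rfl, rfl⟩ | ⟨rfl, rfl⟩
    · left; simp
    · right; simp
  · obtain ⟨w₁, w₂, u₁, u₂, v₁, v₂, h, h1, h2, rfl, rfl⟩ := h
    exact Or.inr (Or.inr (Or.inl ⟨x ++ w₁, w₂ ++ y, u₁, u₂, v₁, v₂, h, h1, h2, by simp, by simp⟩))
  · obtain ⟨w₁, w₂, u₁, u₂, v₁, v₂, h, h1, h2, rfl, rfl⟩ := h
    exact Or.inr (Or.inr (Or.inr ⟨x ++ w₁, w₂ ++ y, u₁, u₂, v₁, v₂, h, h1, h2, by simp, by simp⟩))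

theorem OneStep.inv {A : ArtinData S} {w w' : Word S} (h : OneStep A w w') :
    OneStep A (wordInv w) (wordInv w') := by
  rcases h with ⟨w₁, w₂, s, b, rfl, rfl⟩ | ⟨w₁, w₂, u, v, h, h'⟩ | h | h
  · exact Or.inl ⟨wordInv w₂, wordInv w₁, s, b, by simp [wordInv], by simp⟩
  · refine Or.inr (Or.inl ⟨wordInv w₂, wordInv w₁, u, v, h, ?_⟩)
    rcases h' with ⟨rfl, rfl⟩ | ⟨rfl, rfl⟩
    · right; simp
    · left; simp
  · obtain ⟨w₁, w₂, u₁, u₂, v₁, v₂, h, h1, h2, rfl, rfl⟩ := h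
    exact Or.inr (Or.inr (Or.inl ⟨wordInv w₂, wordInv w₁, v₁, v₂, u₁, u₂, h.symm, h2, h1,
      by simp, by simp⟩))
  · obtain ⟨w₁, w₂, u₁, u₂, v₁, v₂, h, h1, h2, rfl, rfl⟩ := h
    exact Or.inr (Or.inr (Or.inr ⟨wordInv w₂, wordInv w₁, v₁, v₂, u₁, u₂, h.symm, h2, h1,
      by simp, by simp⟩))

@[simp] theorem wbar_nil (A : ArtinData S) : wbar A [] = 1 := rfl

@[simp] theorem wbar_append (A : ArtinData S) (u v : Word S) :
    wbar A (u ++ v) = wbar A u * wbar A v := by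
  rw [wbar, ← FreeGroup.mul_mk, map_mul]; rfl

@[simp] theorem wbar_wordInv (A : ArtinData S) (u : Word S) :
    wbar A (wordInv u) = (wbar A u)⁻¹ := by
  rw [wbar, wbar, ← map_inv, FreeGroup.inv_mk]
  simp [wordInv, FreeGroup.invRev]

theorem IsRel.wbar_eq {A : ArtinData S} {u v : Word S} (h : IsRel A u v) :
    wbar A u = wbar A v := by
  have : PresentedGroup.mk (rels A) (FreeGroup.mk u * (FreeGroup.mk v)⁻¹) = 1 :=
    PresentedGroup.one_of_mem ⟨u, v, h, rfl⟩
  rw [map_mul, map_inv] at this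
  exact mul_inv_eq_one.1 this

theorem OneStep.wbar_eq {A : ArtinData S} {w w' : Word S} (h : OneStep A w w') :
    wbar A w = wbar A w' := by
  rcases h with ⟨w₁, w₂, s, b, rfl, rfl⟩ | ⟨w₁, w₂, u, v, h, h'⟩ | h | h
  · have : wbar A [(s, b), (s, !b)] = 1 := by
      have := wbar_append A [(s, b)] (wordInv [(s, b)])
      rw [wbar_wordInv, mul_inv_cancel] at this
      exact this
    rw [wbar_append, wbar_append, this, mul_one, wbar_append]
  · rcases h' with ⟨rfl, rfl⟩ | ⟨rfl, rfl⟩ <;> simp [h.wbar_eq]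
  · obtain ⟨w₁, w₂, u₁, u₂, v₁, v₂, h, h1, h2, rfl, rfl⟩ := h
    have := h.wbar_eq
    simp only [wbar_append] at this
    simp only [wbar_append, wbar_wordInv, mul_assoc]
    congr 1
    rw [inv_mul_eq_iff_eq_mul, ← mul_assoc, ← mul_assoc, ← this]
    simp
  · obtain ⟨w₁, w₂, u₁, u₂, v₁, v₂, h, h1, h2, rfl, rfl⟩ := h
    have := h.wbar_eq
    simp only [wbar_append] at this
    simp only [wbar_append, wbar_wordInv, mul_assoc]
    congr 1
    rw [eq_comm, inv_mul_eq_iff_eq_mul, ← mul_assoc, ← mul_assoc, ← this]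
    simp

/-- Letters of the result of a special transformation already occur in the source. -/
theorem OneStep.wordOver {A : ArtinData S} {w w' : Word S} (h : OneStep A w w') {T : Set S}
    (hw : WordOver T w) : WordOver T w' := by
  have key : ∀ u v : Word S, IsRel A u v → (∀ s b, (s, b) ∈ u → s ∈ T) →
      ∀ s b, (s, b) ∈ v → s ∈ T := by
    intro u v h hu s b hs
    have hb : b = true := by
      obtain ⟨a, c, k, _, _, rfl, rfl⟩ := h
      exact (mem_altWord hs).1
    subst hb
    exact hu s true ((h.mem_iff s).2 hs)
  have sub : ∀ x y z w : Word S, IsRel A (x ++ y) (z ++ w) → x ≠ [] → z ≠ [] →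
      (∀ s b, (s, b) ∈ x → s ∈ T) → (∀ s b, (s, b) ∈ z → s ∈ T) →
      ∀ s b, (s, b) ∈ x ++ y → s ∈ T := by
    rintro x y z w ⟨a, c, k, _, _, h, h'⟩ hx hz hxT hzT s b hs
    rw [h] at hs
    have := (mem_altWord hs).2
    obtain ⟨l, x, rfl⟩ := List.exists_cons_of_ne_nil hx
    obtain ⟨l', z, rfl⟩ := List.exists_cons_of_ne_nil hz
    cases k with
    | zero => simp [altWord] at h
    | succ k =>
      simp only [altWord, cons_append, cons.injEq] at h h'
      rcases this with h0 | h0 <;> simp only at h0 <;> subst h0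
      · exact hxT _ true (by simp [h.1])
      · exact hzT _ true (by simp [h'.1])
  have sub' : ∀ x y z w : Word S, IsRel A (y ++ x) (w ++ z) → x ≠ [] → z ≠ [] →
      (∀ s b, (s, b) ∈ x → s ∈ T) → (∀ s b, (s, b) ∈ z → s ∈ T) →
      ∀ s b, (s, b) ∈ y ++ x → s ∈ T := by
    rintro x y z w ⟨a, c, k, hac, _, h, h'⟩ hx hz hxT hzT s b hs
    rw [h] at hs
    have := (mem_altWord hs).2
    obtain ⟨x, l, rfl⟩ := List.eq_nil_or_concat' x |>.resolve_left hx
    obtain ⟨z, l', rfl⟩ := List.eq_nil_or_concat' z |>.resolve_left hz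
    cases k with
    | zero => simp [altWord] at h
    | succ k =>
      rw [altWord_succ, ← append_assoc] at h h'
      have h1 := (List.append_inj' h rfl).2
      have h2 := (List.append_inj' h' rfl).2
      simp only [cons.injEq, and_true] at h1 h2
      have h3 := hxT (if Even k then a else c) true (by simp [h1])
      have h4 := hzT (if Even k then c else a) true (by simp [h2])
      simp only at this
      rcases this with rfl | rfl <;> split_ifs at h3 h4 <;> assumption
  simp only [WordOver, Prod.forall] at hw ⊢
  rcases h with ⟨w₁, w₂, s, b, rfl, rfl⟩ | ⟨w₁, w₂, u, v, h, h'⟩ | h | h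
  · intro s b hs
    refine hw s b ?_
    simp only [mem_append] at hs ⊢
    tauto
  · rcases h' with ⟨rfl, rfl⟩ | ⟨rfl, rfl⟩
    · have := key _ _ h.symm (fun s b hs => hw s b (by simp [hs]))
      intro s b hs
      simp only [mem_append] at hs hw
      rcases hs with (hs | hs) | hs
      exacts [hw s b (by tauto), this s b hs, hw s b (by tauto)]
    · have := key _ _ h.symm (fun s b hs => hw s (!b) (by simp [mem_wordInv, hs]))
      intro s b hs
      simp only [mem_append, mem_wordInv] at hs hw
      rcases hs with (hs | hs) | hs
      exacts [hw s b (by tauto), this s _ hs, hw s b (by tauto)]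
  · obtain ⟨w₁, w₂, u₁, u₂, v₁, v₂, h, h1, h2, rfl, rfl⟩ := h
    have hu : ∀ s b, (s, b) ∈ u₁ → s ∈ T := fun s b hs => hw s b (by simp [hs])
    have hv : ∀ s b, (s, b) ∈ v₁ → s ∈ T := fun s b hs => hw s (!b) (by simp [hs, mem_wordInv])
    have hu' := sub _ _ _ _ h h1 h2 hu hv
    have hv' := sub _ _ _ _ h.symm h2 h1 hv hu
    intro s b hs
    simp only [mem_append, mem_wordInv] at hs hw hu' hv'
    rcases hs with ((hs | hs) | hs) | hs
    exacts [hw s b (by tauto), hv' s b (by tauto), hu' s (!b) (by tauto), hw s b (by tauto)]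
  · obtain ⟨w₁, w₂, u₁, u₂, v₁, v₂, h, h1, h2, rfl, rfl⟩ := h
    have hu : ∀ s b, (s, b) ∈ u₂ → s ∈ T := fun s b hs => hw s (!b) (by simp [hs, mem_wordInv])
    have hv : ∀ s b, (s, b) ∈ v₂ → s ∈ T := fun s b hs => hw s b (by simp [hs])
    have hu' := sub' _ _ _ _ h h1 h2 hu hv
    have hv' := sub' _ _ _ _ h.symm h2 h1 hv hu
    intro s b hs
    simp only [mem_append, mem_wordInv] at hs hw hu' hv'
    rcases hs with ((hs | hs) | hs) | hs
    exacts [hw s b (by tauto), hv' s (!b) (by tauto), hu' s b (by tauto), hw s b (by tauto)]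

theorem OneStep.ne_nil {A : ArtinData S} {w w' : Word S} (h : OneStep A w w') : w ≠ [] := by
  rcases h with ⟨w₁, w₂, s, b, rfl, rfl⟩ | ⟨w₁, w₂, u, v, h, h'⟩ | h | h
  · simp
  · have := h.two_le
    have h3 := h.length_eq
    rcases h' with ⟨rfl, rfl⟩ | ⟨rfl, rfl⟩ <;> intro h <;> simp at h <;> grind
  · obtain ⟨w₁, w₂, u₁, u₂, v₁, v₂, h, h1, h2, rfl, rfl⟩ := h
    simp [h1]
  · obtain ⟨w₁, w₂, u₁, u₂, v₁, v₂, h, h1, h2, rfl, rfl⟩ := h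
    simp [h2]

theorem Steps012.refl (A : ArtinData S) (w : Word S) : Steps012 A w w := Relation.ReflTransGen.refl

theorem Steps012.trans {A : ArtinData S} {u v w : Word S} (h : Steps012 A u v)
    (h' : Steps012 A v w) : Steps012 A u w := Relation.ReflTransGen.trans h h'

theorem OneStep.steps {A : ArtinData S} {u v : Word S} (h : OneStep A u v) : Steps012 A u v :=
  Relation.ReflTransGen.single h

theorem Steps012.induct {A : ArtinData S} {p : Word S → Word S → Prop}
    (hr : ∀ w, p w w) (ht : ∀ u v w, p u v → p v w → p u w) (h1 : ∀ u v, OneStep A u v → p u v)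
    {u v : Word S} (h : Steps012 A u v) : p u v := by
  induction h with
  | refl => exact hr _
  | tail _ h ih => exact ht _ _ _ ih (h1 _ _ h)

theorem Steps012.context {A : ArtinData S} {w w' : Word S} (h : Steps012 A w w') (x y : Word S) :
    Steps012 A (x ++ w ++ y) (x ++ w' ++ y) :=
  h.induct (p := fun w w' => Steps012 A (x ++ w ++ y) (x ++ w' ++ y))
    (fun _ => .refl _ _) (fun _ _ _ h h' => h.trans h') fun _ _ h => (h.context x y).steps

theorem Steps012.append {A : ArtinData S} {w w' v v' : Word S} (h : Steps012 A w w')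
    (h' : Steps012 A v v') : Steps012 A (w ++ v) (w' ++ v') := by
  have h1 := h.context [] v
  have h2 := h'.context w' []
  simp only [nil_append, append_nil] at h1 h2
  exact h1.trans h2

theorem Steps012.inv {A : ArtinData S} {w w' : Word S} (h : Steps012 A w w') :
    Steps012 A (wordInv w) (wordInv w') :=
  h.induct (p := fun w w' => Steps012 A (wordInv w) (wordInv w'))
    (fun _ => .refl _ _) (fun _ _ _ h h' => h.trans h') fun _ _ h => h.inv.steps

theorem Steps012.wbar_eq {A : ArtinData S} {w w' : Word S} (h : Steps012 A w w') :
    wbar A w = wbar A w' :=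
  h.induct (p := fun w w' => wbar A w = wbar A w')
    (fun _ => rfl) (fun _ _ _ h h' => h.trans h') fun _ _ h => h.wbar_eq

theorem Steps012.wordOver {A : ArtinData S} {w w' : Word S} (h : Steps012 A w w') {T : Set S}
    (hw : WordOver T w) : WordOver T w' :=
  h.induct (p := fun w w' => WordOver T w → WordOver T w')
    (fun _ => id) (fun _ _ _ h h' => h' ∘ h) (fun _ _ h => h.wordOver) hw

theorem Steps012.eq_nil {A : ArtinData S} {w : Word S} (h : Steps012 A [] w) : w = [] :=
  h.induct (p := fun w w' => w = [] → w' = [])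
    (fun _ => id) (fun _ _ _ h h' => h' ∘ h) (fun _ _ h h' => (h.ne_nil h').elim) rfl

theorem steps_mul_wordInv (A : ArtinData S) (w : Word S) : Steps012 A (w ++ wordInv w) [] := by
  induction w with
  | nil => exact .refl _ _
  | cons l w ih =>
    rw [wordInv_cons, cons_append, ← append_assoc]
    have h1 := ih.context [l] [(l.1, !l.2)]
    refine Steps012.trans (by simpa using h1) (OneStep.steps (Or.inl ⟨[], [], l.1, l.2, ?_, ?_⟩)) <;>
    simp

theorem steps_wordInv_mul (A : ArtinData S) (w : Word S) : Steps012 A (wordInv w ++ w) [] := by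
  simpa using steps_mul_wordInv A (wordInv w)

theorem IsRel.steps {A : ArtinData S} {u v : Word S} (h : IsRel A u v) : Steps012 A u v :=
  OneStep.steps (Or.inr (Or.inl ⟨[], [], v, u, h.symm, by simp⟩))

theorem WordOver.append {T : Set S} {u v : Word S} (hu : WordOver T u) (hv : WordOver T v) :
    WordOver T (u ++ v) := by
  intro l hl
  rcases mem_append.1 hl with h | h
  exacts [hu l h, hv l h]

theorem WordOver.inv {T : Set S} {u : Word S} (hu : WordOver T u) : WordOver T (wordInv u) := by
  intro l hl
  exact hu (l.1, !l.2) (mem_wordInv.1 hl)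

theorem wordOver_append {T : Set S} {u v : Word S} :
    WordOver T (u ++ v) ↔ WordOver T u ∧ WordOver T v :=
  ⟨fun h => ⟨fun l hl => h l (by simp [hl]), fun l hl => h l (by simp [hl])⟩,
    fun h => h.1.append h.2⟩

theorem WordOver.mono {T T' : Set S} (h : T ⊆ T') {u : Word S} (hu : WordOver T u) :
    WordOver T' u := fun l hl => h (hu l hl)

theorem wordOver_univ (u : Word S) : WordOver Set.univ u := fun _ _ => trivial

theorem mem_parab_iff {A : ArtinData S} {T : Set S} {g : ArtinGroup A} :
    g ∈ parab A T ↔ ∃ w, WordOver T w ∧ wbar A w = g := by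
  constructor
  · intro h
    induction h using Subgroup.closure_induction with
    | mem x hx =>
      obtain ⟨s, hs, rfl⟩ := hx
      exact ⟨[(s, true)], by simpa [WordOver] using hs, rfl⟩
    | one => exact ⟨[], by simp [WordOver], rfl⟩
    | mul x y _ _ hx hy =>
      obtain ⟨u, hu, rfl⟩ := hx
      obtain ⟨v, hv, rfl⟩ := hy
      exact ⟨u ++ v, hu.append hv, by simp⟩
    | inv x _ hx =>
      obtain ⟨u, hu, rfl⟩ := hx
      exact ⟨wordInv u, hu.inv, by simp⟩
  · rintro ⟨w, hw, rfl⟩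
    induction w with
    | nil => exact one_mem _
    | cons l w ih =>
      have : wbar A (l :: w) = wbar A [l] * wbar A w := wbar_append A [l] w
      rw [this]
      refine mul_mem ?_ (ih fun l hl => hw l (by simp [hl]))
      have hpos : wbar A [(l.1, true)] ∈ parab A T :=
        Subgroup.subset_closure ⟨l.1, hw l (by simp), rfl⟩
      obtain ⟨s, b⟩ := l
      cases b with
      | true => exact hpos
      | false =>
        have := wbar_wordInv A [(s, true)]
        rw [wordInv_singleton] at this
        rw [show (!true) = false from rfl] at this
        rw [this]
        exact inv_mem hpos

theorem wbar_mem_parab {A : ArtinData S} {T : Set S} {w : Word S} (h : WordOver T w) :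
    wbar A w ∈ parab A T := mem_parab_iff.2 ⟨w, h, rfl⟩

theorem wbar_surjective (A : ArtinData S) : Function.Surjective (wbar A) := by
  intro g
  obtain ⟨x, rfl⟩ := PresentedGroup.mk_surjective _ g
  exact ⟨x.toWord, by rw [wbar, FreeGroup.mk_toWord]⟩

/-- A choice-free strengthening of Property `H#`: normal forms and transversals reachable by
special transformations. -/
structure Reducible (A : ArtinData S) : Prop where
  nf : ∃ nf : ArtinGroup A → Word S, ∀ w, Steps012 A w (nf (wbar A w))
  tr : ∀ S₀ : Set S, ∃ T : Set (ArtinGroup A),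
    (∀ x ∈ T, ∀ y ∈ T, x⁻¹ * y ∈ parab A S₀ → x = y) ∧
    ∀ w : Word S, ∃ v u : Word S, WordOver S₀ u ∧ Steps012 A w (v ++ u) ∧ wbar A v ∈ T

theorem Reducible.steps_nil {A : ArtinData S} (h : Reducible A) {w : Word S}
    (hw : wbar A w = 1) : Steps012 A w [] := by
  obtain ⟨nf, hnf⟩ := h.nf
  have h1 := (hnf []).eq_nil
  have h2 := hnf w
  rwa [hw, ← wbar_nil, h1] at h2

theorem Reducible.exists_wordOver {A : ArtinData S} (h : Reducible A) {T : Set S} {w : Word S}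
    (hw : wbar A w ∈ parab A T) : ∃ w', WordOver T w' ∧ Steps012 A w w' := by
  obtain ⟨nf, hnf⟩ := h.nf
  obtain ⟨u, hu, hu'⟩ := mem_parab_iff.1 hw
  exact ⟨_, (hnf u).wordOver hu, by simpa [hu'] using hnf w⟩

theorem Reducible.propertyH {A : ArtinData S} (h : Reducible A) : PropertyH A :=
  fun _ => ⟨fun hw => by simpa using hw.wbar_eq, h.steps_nil⟩

theorem Reducible.propertyHSharp {A : ArtinData S} (h : Reducible A) : PropertyHSharp A := by
  choose T hT hT' using h.tr
  refine ⟨T, fun S₀ => ⟨?_, fun g => ?_⟩, fun S' S₀ w hw => ?_⟩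
  · obtain ⟨v, u, -, hvu, hv⟩ := hT' S₀ []
    have := hvu.eq_nil
    simp only [append_eq_nil_iff] at this
    simpa [this.1] using hv
  · obtain ⟨w, rfl⟩ := wbar_surjective A g
    obtain ⟨v, u, hu, hvu, hv⟩ := hT' S₀ w
    have hwv : wbar A w = wbar A v * wbar A u := by simpa using hvu.wbar_eq
    have hm : (wbar A w)⁻¹ * wbar A v ∈ parab A S₀ := by
      rw [hwv]; simpa using inv_mem (wbar_mem_parab hu)
    refine ⟨wbar A v, ⟨hv, hm⟩, fun y hy => hT S₀ _ hy.1 _ hv ?_⟩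
    have := mul_mem (inv_mem hy.2) hm
    simpa [mul_assoc] using this
  · obtain ⟨w', hw', hs⟩ := h.exists_wordOver hw
    obtain ⟨v, u, hu, hvu, hv⟩ := hT' S₀ w'
    have := wordOver_append.1 (hvu.wordOver hw')
    exact ⟨v, u, this.1, fun l hl => ⟨this.2 l hl, hu l hl⟩, hs.trans hvu, hv⟩

end

section

/-! ### The order of a product of two simple reflections -/

section GeometricRepresentation

variable {B : Type*} (M : CoxeterMatrix B)

/-- The Gram matrix (doubled) of the geometric representation of a Coxeter group. -/
noncomputable def gram (i j : B) : ℝ := -2 * Real.cos (Real.pi / M i j)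

/-- The action of a simple reflection in the contragredient geometric representation. -/
noncomputable def geomRefl (i : B) : Module.End ℝ (B → ℝ) where
  toFun f := fun j => f j - f i * gram M i j
  map_add' f g := by ext j; simp; ring
  map_smul' c f := by ext j; simp; ring

theorem geomRefl_apply (i : B) (f : B → ℝ) (j : B) :
    geomRefl M i f j = f j - f i * gram M i j := rfl

theorem gram_self (i : B) : gram M i i = 2 := by simp [gram]

theorem gram_symm (i j : B) : gram M i j = gram M j i := by simp [gram, M.symmetric i j]

theorem sin_gram_angle {i j : B} (hij : i ≠ j) (hm : M i j ≠ 0) :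
    0 < Real.sin (Real.pi / M i j) := by
  have h1 : M i j ≠ 1 := M.off_diagonal i j hij
  have h2 : (2 : ℝ) ≤ M i j := by exact_mod_cast (by omega : 2 ≤ M i j)
  apply Real.sin_pos_of_pos_of_lt_pi
  · positivity
  · rw [div_lt_iff₀ (by linarith)]; nlinarith [Real.pi_pos]

theorem geomRefl_pow {i j : B} (hij : i ≠ j) (hm : M i j ≠ 0) (n : ℕ) (f : B → ℝ) (k : B) :
    2 * Real.sin (Real.pi / M i j) ^ 2 * (((geomRefl M i * geomRefl M j) ^ n) f k - f k) =
      - ((f j * (Real.cos (Real.pi / M i j) - Real.cos ((2 * n + 1) * (Real.pi / M i j))) +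
          f i * (1 - Real.cos (2 * n * (Real.pi / M i j)))) * gram M i k +
        (f j * (1 - Real.cos (2 * n * (Real.pi / M i j))) +
          f i * (Real.cos (Real.pi / M i j) - Real.cos ((2 * n - 1) * (Real.pi / M i j)))) *
          gram M j k) := by
  have hs := sin_gram_angle M hij hm
  have hg : gram M i j = -2 * Real.cos (Real.pi / M i j) := rfl
  set θ := Real.pi / M i j with hθ
  induction n generalizing k with
  | zero => simp
  | succ n ih =>
    rw [pow_succ' (geomRefl M i * geomRefl M j), Module.End.mul_apply, Module.End.mul_apply]
    set g := ((geomRefl M i * geomRefl M j) ^ n) f with hgdef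
    simp only [geomRefl_apply, gram_symm M j i]
    have hi := ih i
    have hj := ih j
    have hk := ih k
    rw [gram_self, gram_symm M j i, hg] at hi
    rw [gram_self, hg] at hj
    rw [hg]
    have e1 : Real.cos (2 * n * θ) = Real.cos (2 * n * θ) := rfl
    have e2 : Real.cos ((2 * n + 1) * θ) =
      Real.cos (2 * n * θ) * Real.cos θ - Real.sin (2 * n * θ) * Real.sin θ := by
      rw [← Real.cos_add]; ring_nf
    have e3 : Real.cos ((2 * n - 1) * θ) =
      Real.cos (2 * n * θ) * Real.cos θ + Real.sin (2 * n * θ) * Real.sin θ := by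
      rw [← Real.cos_sub]; ring_nf
    have e4 : Real.cos (2 * ((n + 1 : ℕ) : ℝ) * θ) = Real.cos (2 * n * θ) * (2 * Real.cos θ ^ 2 - 1)
        - Real.sin (2 * n * θ) * (2 * Real.sin θ * Real.cos θ) := by
      rw [← Real.cos_two_mul, ← Real.sin_two_mul, ← Real.cos_add]; push_cast; ring_nf
    have e4' : Real.sin (2 * ((n + 1 : ℕ) : ℝ) * θ) = Real.sin (2 * n * θ) * (2 * Real.cos θ ^ 2 - 1)
        + Real.cos (2 * n * θ) * (2 * Real.sin θ * Real.cos θ) := by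
      rw [← Real.cos_two_mul, ← Real.sin_two_mul, ← Real.sin_add]; push_cast; ring_nf
    have e5 : Real.cos ((2 * ((n + 1 : ℕ) : ℝ) + 1) * θ) =
      Real.cos (2 * ((n + 1 : ℕ) : ℝ) * θ) * Real.cos θ -
        Real.sin (2 * ((n + 1 : ℕ) : ℝ) * θ) * Real.sin θ := by
      rw [← Real.cos_add]; ring_nf
    have e6 : Real.cos ((2 * ((n + 1 : ℕ) : ℝ) - 1) * θ) =
      Real.cos (2 * ((n + 1 : ℕ) : ℝ) * θ) * Real.cos θ +
        Real.sin (2 * ((n + 1 : ℕ) : ℝ) * θ) * Real.sin θ := by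
      rw [← Real.cos_sub]; ring_nf
    rw [e5, e6, e4', e4]
    rw [e2, e3] at hi hj hk
    have hsc := Real.sin_sq_add_cos_sq θ
    generalize Real.sin (2 * n * θ) = sn at *
    generalize Real.cos (2 * n * θ) = cn at *
    generalize Real.sin θ = s at *
    generalize Real.cos θ = c at *
    have hs2 : s ^ 2 = 1 - c ^ 2 := by linarith
    generalize g i = gi at *
    generalize g j = gj at *
    generalize g k = gk at *
    generalize f i = fi at *
    generalize f j = fj at *
    generalize f k = fk at *
    generalize gram M i k = bi at *
    generalize gram M j k = bj at *
    have hgi : 2 * s ^ 2 * gi = 2 * s ^ 2 * fi + (2 * s ^ 2 * (gi - fi)) := by ring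
    have hgj : 2 * s ^ 2 * gj = 2 * s ^ 2 * fj + (2 * s ^ 2 * (gj - fj)) := by ring
    rw [hi] at hgi
    rw [hj] at hgj
    have : 2 * s ^ 2 * (gk - gj * bj - (gi - gj * (-2 * c)) * bi - fk) =
      2 * s ^ 2 * (gk - fk) - (2 * s ^ 2 * gj) * bj -
        (2 * s ^ 2 * gi - (2 * s ^ 2 * gj) * (-2 * c)) * bi := by ring
    rw [this, hk, hgi, hgj]
    have hs3 : s ^ 3 = s * (1 - c ^ 2) := by rw [← hs2]; ring
    ring_nf
    simp only [hs2]
    ring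

theorem geomRefl_liftable : M.IsLiftable (geomRefl M) := by
  intro i j
  by_cases hij : i = j
  · subst hij
    rw [M.diagonal, pow_one]
    ext f k
    simp [geomRefl_apply, gram_self]
    ring
  · by_cases hm : M i j = 0
    · rw [hm, pow_zero]
    · refine LinearMap.ext fun f => funext fun k => ?_
      have h := geomRefl_pow M hij hm (M i j) f k
      have hs := sin_gram_angle M hij hm
      have e : 2 * (M i j : ℝ) * (Real.pi / M i j) = 2 * Real.pi := by
        field_simp
      have e1 : (2 * (M i j : ℝ) + 1) * (Real.pi / M i j) = Real.pi / M i j + 2 * Real.pi := by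
        rw [add_mul, e]; ring
      have e2 : (2 * (M i j : ℝ) - 1) * (Real.pi / M i j) = 2 * Real.pi - Real.pi / M i j := by
        rw [sub_mul, e]; ring
      rw [e, e1, e2, Real.cos_two_pi, Real.cos_add_two_pi, Real.cos_two_pi_sub] at h
      have : (2 * Real.sin (Real.pi / M i j) ^ 2) ≠ 0 := by positivity
      have h2 : ((geomRefl M i * geomRefl M j) ^ M i j) f k - f k = 0 := by
        refine (mul_eq_zero.1 ?_).resolve_left this
        rw [h]; ring
      simpa using sub_eq_zero.1 h2

theorem geomRefl_pow_infty {i j : B} (hm : M i j = 0) (n : ℕ) (f : B → ℝ) (hi : f i = 1)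
    (hj : f j = 0) : ((geomRefl M i * geomRefl M j) ^ n) f i = 1 - 2 * n ∧
      ((geomRefl M i * geomRefl M j) ^ n) f j = 2 * n := by
  have hg : gram M i j = -2 := by simp [gram, hm]
  induction n with
  | zero => simp [hi, hj]
  | succ n ih =>
    rw [pow_succ', Module.End.mul_apply, Module.End.mul_apply]
    simp only [geomRefl_apply, gram_symm M j i, hg, gram_self, ih.1, ih.2]
    push_cast
    constructor <;> ring

theorem simple_mul_simple_pow_ne_one {W : Type*} [Group W] (cs : CoxeterSystem M W) {i j : B}
    (hij : i ≠ j) {n : ℕ} (hn : 0 < n) (hn' : M i j = 0 ∨ n < M i j) :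
    (cs.simple i * cs.simple j) ^ n ≠ 1 := by
  intro h
  have h1 := congrArg (cs.lift ⟨geomRefl M, geomRefl_liftable M⟩) h
  rw [map_pow, map_mul, map_one, cs.lift_apply_simple (geomRefl_liftable M),
    cs.lift_apply_simple (geomRefl_liftable M)] at h1
  let f : B → ℝ := fun k => if k = i then 1 else 0
  have hi : f i = 1 := by simp [f]
  have hj : f j = 0 := by simp [f, hij.symm]
  by_cases hm : M i j = 0
  · have h2 := (geomRefl_pow_infty M hm n f hi hj).2
    rw [h1] at h2
    simp [hj] at h2
    omega
  · have hn2 := hn'.resolve_left hm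
    have hs := sin_gram_angle M hij hm
    have h2 := geomRefl_pow M hij hm n f i
    have h3 := geomRefl_pow M hij hm n f j
    rw [h1] at h2 h3
    simp only [hi, hj, gram_self, gram_symm M j i, Module.End.one_apply] at h2 h3
    have hg : gram M i j = -2 * Real.cos (Real.pi / M i j) := rfl
    rw [hg] at h2 h3
    set θ := Real.pi / M i j with hθ
    have hlt : Real.cos (2 * n * θ) < 1 := by
      have hm0 : (0 : ℝ) < M i j := by exact_mod_cast Nat.pos_of_ne_zero hm
      have hn0 : (0 : ℝ) < n := by exact_mod_cast hn
      have hnm : (n : ℝ) < M i j := by exact_mod_cast hn2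
      have h5 : (n : ℝ) * θ < Real.pi := by
        rw [hθ, mul_div_assoc', div_lt_iff₀ hm0, mul_comm]
        exact mul_lt_mul_of_pos_left hnm Real.pi_pos
      have h6 : 0 < Real.sin (n * θ) :=
        Real.sin_pos_of_pos_of_lt_pi (by rw [hθ]; positivity) h5
      have := Real.cos_two_mul (n * θ)
      rw [← mul_assoc] at this
      nlinarith [Real.sin_sq_add_cos_sq (n * θ), pow_pos h6 2]
    have hsc := Real.sin_sq_add_cos_sq θ
    have h7 : (1 - Real.cos (2 * n * θ)) * (2 * Real.sin θ ^ 2) = 0 := by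
      rw [show Real.sin θ ^ 2 = 1 - Real.cos θ ^ 2 by linarith]
      linear_combination h2 + Real.cos θ * h3
    have : (2 * Real.sin θ ^ 2) ≠ 0 := by positivity
    rcases mul_eq_zero.1 h7 with h | h
    · linarith
    · exact this h

end GeometricRepresentation

end

section

/-! ### The exchange condition -/

section Exchange

variable {B W : Type*} [Group W] {M : CoxeterMatrix B} (cs : CoxeterSystem M W)

/-- The action of a simple reflection on signed elements, used to count inversions. -/
noncomputable def invAct (i : B) : Function.End (W × ZMod 2) :=
  fun p => (cs.simple i * p.1 * cs.simple i, p.2 + if p.1 = cs.simple i then 1 else 0)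

theorem simple_mul_pow (i j : B) (k : ℕ) : cs.simple j * (cs.simple i * cs.simple j) ^ k =
    ((cs.simple i * cs.simple j) ^ k)⁻¹ * cs.simple j := by
  have : SemiconjBy (cs.simple j) (cs.simple i * cs.simple j) (cs.simple i * cs.simple j)⁻¹ := by
    simp [SemiconjBy, mul_assoc]
  simpa only [inv_pow] using (this.pow_right k).eq

theorem invAct_pow (i j : B) (n : ℕ) (p : W × ZMod 2) :
    ((invAct cs i * invAct cs j) ^ n) p =
      ((cs.simple i * cs.simple j) ^ n * p.1 * ((cs.simple i * cs.simple j) ^ n)⁻¹,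
        p.2 + ∑ k ∈ Finset.range (2 * n),
          if p.1 = cs.simple j * (cs.simple i * cs.simple j) ^ k then 1 else 0) := by
  induction n with
  | zero => simp; rfl
  | succ n ih =>
    have : ((invAct cs i * invAct cs j) ^ (n + 1)) p =
        invAct cs i (invAct cs j (((invAct cs i * invAct cs j) ^ n) p)) := by
      rw [pow_succ']; rfl
    rw [this, ih, show 2 * (n + 1) = 2 * n + 1 + 1 by ring, Finset.sum_range_succ,
      Finset.sum_range_succ]
    simp only [invAct, ← add_assoc]
    set r := cs.simple i * cs.simple j with hr
    have e1 : (r ^ n * p.1 * (r ^ n)⁻¹ = cs.simple j) ↔ p.1 = cs.simple j * r ^ (2 * n) := by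
      rw [two_mul, pow_add, ← mul_assoc, simple_mul_pow, ← hr, mul_inv_eq_iff_eq_mul,
        ← eq_inv_mul_iff_mul_eq, mul_assoc]
    have e2 : (cs.simple j * (r ^ n * p.1 * (r ^ n)⁻¹) * cs.simple j = cs.simple i) ↔
        p.1 = cs.simple j * r ^ (2 * n + 1) := by
      have h0 : cs.simple j * r ^ (2 * n + 1) =
          (r ^ n)⁻¹ * (cs.simple j * cs.simple i * cs.simple j) * r ^ n := by
        rw [show 2 * n + 1 = n + (n + 1) by ring, pow_add, ← mul_assoc, simple_mul_pow, ← hr,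
          pow_succ', hr]
        simp only [mul_assoc]
      rw [h0]
      constructor
      · intro h
        rw [← h]; simp [mul_assoc]
      · intro h
        rw [h]; simp [mul_assoc]
    simp only [e1, e2]
    refine Prod.ext ?_ rfl
    simp only [pow_succ', mul_inv_rev, hr, cs.inv_simple, mul_assoc]

theorem invAct_liftable : M.IsLiftable (invAct cs) := by
  intro i j
  funext p
  rw [invAct_pow, cs.simple_mul_simple_pow, two_mul, Finset.sum_range_add]
  simp only [pow_add, cs.simple_mul_simple_pow, one_mul, inv_one, mul_one]
  rw [CharTwo.add_self_eq_zero, add_zero]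
  rfl

theorem lift_invAct_wordProd (ω : List B) (p : W × ZMod 2) :
    (cs.lift ⟨invAct cs, invAct_liftable cs⟩ (cs.wordProd ω)) p =
      (cs.wordProd ω * p.1 * (cs.wordProd ω)⁻¹, p.2 + (cs.rightInvSeq ω).count p.1) := by
  induction ω with
  | nil => simp; rfl
  | cons i ω ih =>
    rw [cs.wordProd_cons, map_mul, cs.lift_apply_simple (invAct_liftable cs)]
    change invAct cs i _ = _
    rw [ih]
    simp only [invAct, CoxeterSystem.rightInvSeq, count_cons, mul_inv_rev, cs.inv_simple, mul_assoc,
      beq_iff_eq]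
    refine Prod.ext rfl ?_
    have : (cs.wordProd ω * (p.1 * (cs.wordProd ω)⁻¹) = cs.simple i) ↔
        ((cs.wordProd ω)⁻¹ * (cs.simple i * cs.wordProd ω) = p.1) := by
      rw [← mul_assoc, mul_inv_eq_iff_eq_mul, ← eq_inv_mul_iff_mul_eq, eq_comm]
    simp only [this]
    push_cast
    ring

theorem simple_mem_rightInvSeq {ω : List B} {i : B}
    (h : cs.IsRightDescent (cs.wordProd ω) i) : cs.simple i ∈ cs.rightInvSeq ω := by
  obtain ⟨ω', h1, h2⟩ := cs.exists_isReduced (cs.wordProd ω * cs.simple i)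
  have h3 : cs.wordProd (ω'.concat i) = cs.wordProd ω := by
    rw [cs.wordProd_concat, ← h2]; simp
  have h4 : cs.IsReduced (ω'.concat i) := by
    rw [CoxeterSystem.IsReduced, h3]
    have h5 : cs.length (cs.wordProd ω * cs.simple i) = ω'.length := by rw [h2]; exact h1
    rw [← cs.isRightDescent_iff.1 h, h5]; simp
  have e := lift_invAct_wordProd cs (ω'.concat i) (cs.simple i, 0)
  rw [h3, lift_invAct_wordProd] at e
  have e2 := congrArg Prod.snd e
  simp only [zero_add] at e2
  have h6 : cs.simple i ∈ cs.rightInvSeq (ω'.concat i) := by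
    rw [cs.rightInvSeq_concat]; simp
  rw [(count_eq_one_of_mem (h4.nodup_rightInvSeq) h6)] at e2
  by_contra hn
  rw [count_eq_zero_of_not_mem hn] at e2
  simp at e2

theorem exchange {ω : List B} {i : B}
    (h : cs.IsRightDescent (cs.wordProd ω) i) : ∃ j < ω.length,
      cs.wordProd ω * cs.simple i = cs.wordProd (ω.eraseIdx j) ∧
      cs.simple i = (cs.rightInvSeq ω).getD j 1 := by
  obtain ⟨j, hj, hj'⟩ := List.getElem_of_mem (simple_mem_rightInvSeq cs h)
  rw [cs.length_rightInvSeq] at hj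
  have : (cs.rightInvSeq ω).getD j 1 = cs.simple i := by
    rw [List.getD_eq_getElem _ _ (by simpa using hj), hj']
  exact ⟨j, hj, by rw [← this, cs.wordProd_mul_getD_rightInvSeq], this.symm⟩

/-- `x` is a prefix of `y` in the weak order. -/
def WeakLE (x y : W) : Prop := cs.length y = cs.length x + cs.length (x⁻¹ * y)

/-- The lengths of `x` and `y` add up in the product `x * y`. -/
def LenAdd (x y : W) : Prop := cs.length (x * y) = cs.length x + cs.length y

theorem alternatingWord_prod_succ (i j : B) (k : ℕ) :
    cs.wordProd (CoxeterSystem.alternatingWord i j (k + 1)) =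
      cs.wordProd (CoxeterSystem.alternatingWord j i k) * cs.simple j := by
  rw [CoxeterSystem.alternatingWord_succ, cs.wordProd_concat]

theorem mem_rightInvSeq_alternatingWord {i j : B} {k : ℕ} {x : W}
    (hx : x ∈ cs.rightInvSeq (CoxeterSystem.alternatingWord i j k)) :
    ∃ n < k, x = cs.simple j * (cs.simple i * cs.simple j) ^ n := by
  induction k generalizing i j x with
  | zero => simp [CoxeterSystem.alternatingWord] at hx
  | succ k ih =>
    rw [CoxeterSystem.alternatingWord_succ, cs.rightInvSeq_concat, concat_eq_append, mem_append,
      mem_singleton, mem_map] at hx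
    rcases hx with ⟨y, hy, rfl⟩ | rfl
    · obtain ⟨n, hn, rfl⟩ := ih hy
      refine ⟨n + 1, by omega, ?_⟩
      simp only [MulAut.conj_apply, cs.inv_simple]
      rw [mul_assoc, mul_assoc, mul_pow_mul, pow_succ', mul_assoc]
    · exact ⟨0, by omega, by simp⟩

theorem exists_alternating_suffix {w : W} {i j : B} (hij : i ≠ j) (hi : cs.IsRightDescent w i)
    (hj : cs.IsRightDescent w j) (k : ℕ) (hk : M i j = 0 ∨ k ≤ M i j) :
    ∃ x, w = x * cs.wordProd (CoxeterSystem.alternatingWord i j k) ∧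
      cs.length w = cs.length x + k := by
  induction k generalizing i j with
  | zero => exact ⟨w, by simp [CoxeterSystem.alternatingWord], by simp⟩
  | succ k ih =>
    obtain ⟨x, hx, hl⟩ := ih hij.symm hj hi (by rw [M.symmetric]; omega)
    obtain ⟨ω, hω, rfl⟩ := cs.exists_isReduced x
    rw [← cs.wordProd_append] at hx
    rw [hω.eq] at hl
    have hr : cs.IsReduced (ω ++ CoxeterSystem.alternatingWord j i k) := by
      rw [CoxeterSystem.IsReduced, ← hx, hl]; simp
    subst hx
    obtain ⟨l, hl1, hl2, hl3⟩ := exchange cs hj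
    by_cases h : l < ω.length
    · refine ⟨cs.wordProd (ω.eraseIdx l), ?_, ?_⟩
      · rw [List.eraseIdx_append_of_lt_length h, cs.wordProd_append (ω.eraseIdx l)] at hl2
        rw [alternatingWord_prod_succ, ← mul_assoc, ← hl2]
        simp
      · have h1 := cs.length_mul_le (cs.wordProd (ω.eraseIdx l))
          (cs.wordProd (CoxeterSystem.alternatingWord i j (k + 1)))
        have h2 := cs.length_wordProd_le (ω.eraseIdx l)
        have h3 := cs.length_wordProd_le (CoxeterSystem.alternatingWord i j (k + 1))
        rw [List.length_eraseIdx_of_lt h] at h2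
        rw [CoxeterSystem.length_alternatingWord] at h3
        have h4 : cs.wordProd (ω ++ CoxeterSystem.alternatingWord j i k) =
            cs.wordProd (ω.eraseIdx l) * cs.wordProd (CoxeterSystem.alternatingWord i j (k + 1)) := by
          rw [List.eraseIdx_append_of_lt_length h, cs.wordProd_append (ω.eraseIdx l)] at hl2
          rw [alternatingWord_prod_succ, ← mul_assoc, ← hl2]
          simp
        rw [← h4] at h1
        omega
    · have h1 : cs.simple j ∈ cs.rightInvSeq (CoxeterSystem.alternatingWord j i k) := by
        have h2 := cs.rightInvSeq_drop (ω ++ CoxeterSystem.alternatingWord j i k) ω.length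
        rw [List.drop_left] at h2
        rw [h2, hl3, List.getD_eq_getElem _ _ (by simpa using hl1), List.mem_drop_iff_getElem]
        exact ⟨l - ω.length, by simp at hl1 ⊢; omega, by congr 1; omega⟩
      obtain ⟨n, hn, h2⟩ := mem_rightInvSeq_alternatingWord cs h1
      refine absurd ?_ (simple_mul_simple_pow_ne_one M cs hij.symm (Nat.succ_pos n)
        (by rw [M.symmetric]; omega))
      rw [pow_succ', mul_assoc, ← h2]
      exact cs.simple_mul_simple_self j

end Exchange

end

section

/-! ### The weak order -/

section WeakOrder

open CoxeterSystem (alternatingWord)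

variable {B W : Type*} [Group W] {M : CoxeterMatrix B} (cs : CoxeterSystem M W)

variable {cs} in
theorem LenAdd.assoc_left {x y z : W} (h : LenAdd cs x y) (h' : LenAdd cs (x * y) z) :
    LenAdd cs y z ∧ LenAdd cs x (y * z) := by
  simp only [LenAdd, mul_assoc] at *
  have h1 := cs.length_mul_le y z
  have h2 := cs.length_mul_le x (y * z)
  omega

variable {cs} in
theorem LenAdd.assoc_right {x y z : W} (h : LenAdd cs y z) (h' : LenAdd cs x (y * z)) :
    LenAdd cs x y ∧ LenAdd cs (x * y) z := by
  simp only [LenAdd, mul_assoc] at *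
  have h1 := cs.length_mul_le x y
  have h2 := cs.length_mul_le (x * y) z
  rw [mul_assoc] at h2
  omega

theorem lenAdd_one (x : W) : LenAdd cs x 1 := by simp [LenAdd]

variable {cs} in
theorem WeakLE.lenAdd {x y : W} (h : WeakLE cs x y) : LenAdd cs x (x⁻¹ * y) := by
  unfold LenAdd
  rw [mul_inv_cancel_left]
  exact h

variable {cs} in
theorem LenAdd.weakLE {x y : W} (h : LenAdd cs x y) : WeakLE cs x (x * y) := by
  unfold WeakLE
  rw [inv_mul_cancel_left]
  exact h

theorem weakLE_refl (x : W) : WeakLE cs x x := by simp [WeakLE]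

theorem one_weakLE (x : W) : WeakLE cs 1 x := by simp [WeakLE]

variable {cs} in
theorem WeakLE.trans {x y z : W} (h : WeakLE cs x y) (h' : WeakLE cs y z) : WeakLE cs x z := by
  have := LenAdd.assoc_left h.lenAdd (z := y⁻¹ * z) (by simpa using h'.lenAdd)
  simpa using this.2.weakLE

variable {cs} in
theorem WeakLE.antisymm {x y : W} (h : WeakLE cs x y) (h' : WeakLE cs y x) : x = y := by
  simp only [WeakLE] at h h'
  have : cs.length (x⁻¹ * y) = 0 := by omega
  rw [cs.length_eq_zero_iff] at this
  exact (inv_mul_eq_one.1 this)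

variable {cs} in
theorem WeakLE.length_le {x y : W} (h : WeakLE cs x y) : cs.length x ≤ cs.length y := by
  simp only [WeakLE] at h; omega

/-- Left translation by `x` preserves the weak order on elements reduced with respect to `x`. -/
theorem WeakLE.mul_left {x y z : W} (h : WeakLE cs y z) (h' : LenAdd cs x z) :
    WeakLE cs (x * y) (x * z) := by
  have := LenAdd.assoc_right h.lenAdd (x := x) (by simpa using h')
  simpa [mul_assoc] using this.2.weakLE

theorem WeakLE.of_mul_left {x y z : W} (h : WeakLE cs (x * y) (x * z)) (h' : LenAdd cs x y) :
    WeakLE cs y z := by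
  have h1 := h.lenAdd
  have := LenAdd.assoc_left h' h1
  simpa [mul_assoc] using this.1.weakLE

theorem lenAdd_simple_iff {x : W} {i : B} :
    LenAdd cs x (cs.simple i) ↔ ¬ cs.IsRightDescent x i := by
  rw [cs.not_isRightDescent_iff, LenAdd, cs.length_simple]

theorem reverse_alternatingWord (i j : B) (k : ℕ) : (alternatingWord i j k).reverse =
    if Even k then alternatingWord j i k else alternatingWord i j k := by
  induction k generalizing i j with
  | zero => simp [alternatingWord]
  | succ k ih =>
    have h1 : (alternatingWord i j (k + 1)).reverse = j :: (alternatingWord j i k).reverse := by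
      rw [CoxeterSystem.alternatingWord_succ]; simp
    rw [h1, ih, CoxeterSystem.alternatingWord_succ' i j, CoxeterSystem.alternatingWord_succ' j i]
    by_cases h : Even k <;> simp [h, Nat.even_add_one]

theorem matrix_ne_zero_of_descents {w : W} {i j : B} (hij : i ≠ j) (hi : cs.IsRightDescent w i)
    (hj : cs.IsRightDescent w j) : M i j ≠ 0 := by
  intro h
  obtain ⟨x, -, h⟩ := exists_alternating_suffix cs hij hi hj (cs.length w + 1) (Or.inl h)
  omega

theorem length_mul_alternating {u : W} {i j : B} (hij : i ≠ j) (hi : ¬ cs.IsRightDescent u i)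
    (hj : ¬ cs.IsRightDescent u j) (k : ℕ) (hk : M i j = 0 ∨ k ≤ M i j) :
    cs.length (u * cs.wordProd (alternatingWord i j k)) = cs.length u + k := by
  induction k generalizing i j with
  | zero => simp [alternatingWord]
  | succ k ih =>
    have ih := ih hij.symm hj hi (by rw [M.symmetric]; omega)
    rw [alternatingWord_prod_succ, ← mul_assoc]
    by_contra hne
    have hd : cs.IsRightDescent (u * cs.wordProd (alternatingWord j i k)) j := by
      by_contra hd
      rw [cs.not_isRightDescent_iff] at hd
      omega
    rcases k with _ | k
    · simp [alternatingWord, hj] at hd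
    have hd' : cs.IsRightDescent (u * cs.wordProd (alternatingWord j i (k + 1))) i := by
      have h1 := cs.length_mul_le u (cs.wordProd (alternatingWord i j k))
      have h2 := cs.length_wordProd_le (alternatingWord i j k)
      rw [CoxeterSystem.length_alternatingWord] at h2
      rw [CoxeterSystem.IsRightDescent, ih, alternatingWord_prod_succ, mul_assoc, mul_assoc,
        cs.simple_mul_simple_self, mul_one]
      omega
    obtain ⟨x, hx, hl⟩ := exists_alternating_suffix cs hij.symm hd hd' (k + 1 + 1)
      (by rw [M.symmetric]; omega)
    rw [CoxeterSystem.alternatingWord_succ' j i (k + 1), cs.wordProd_cons, ← mul_assoc,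
      mul_left_inj] at hx
    have h3 : cs.IsRightDescent u (if Even (k + 1) then i else j) := by
      rw [cs.isRightDescent_iff, hx, mul_assoc, cs.simple_mul_simple_self, mul_one, ← hx]
      omega
    split_ifs at h3
    · exact hi h3
    · exact hj h3

theorem isReduced_alternatingWord {i j : B} (hij : i ≠ j) (k : ℕ) (hk : M i j = 0 ∨ k ≤ M i j) :
    cs.IsReduced (alternatingWord i j k) := by
  have := length_mul_alternating cs (u := 1) hij (cs.not_isRightDescent_one i)
    (cs.not_isRightDescent_one j) k hk
  rw [CoxeterSystem.IsReduced]
  simpa using this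

theorem exists_braidWord_eq_cons (M : CoxeterMatrix B) {i j : B} (h : M i j ≠ 0) :
    ∃ τ, CoxeterSystem.braidWord M i j = i :: τ ∨ CoxeterSystem.braidWord M j i = i :: τ := by
  simp only [CoxeterSystem.braidWord, M.symmetric j i]
  obtain ⟨k, hk⟩ := Nat.exists_eq_succ_of_ne_zero h
  rw [hk, Nat.succ_eq_add_one, CoxeterSystem.alternatingWord_succ',
    CoxeterSystem.alternatingWord_succ']
  by_cases h : Even k
  · exact ⟨_, Or.inr (by rw [if_pos h])⟩
  · exact ⟨_, Or.inl (by rw [if_neg h])⟩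

theorem length_mul_braidWord {u : W} {i j : B} (hij : i ≠ j) (hi : ¬ cs.IsRightDescent u i)
    (hj : ¬ cs.IsRightDescent u j) : LenAdd cs u (cs.wordProd (CoxeterSystem.braidWord M i j)) := by
  have h := length_mul_alternating cs hij hi hj (M i j) (Or.inr le_rfl)
  have h2 := (isReduced_alternatingWord cs hij (M i j) (Or.inr le_rfl)).eq
  rw [LenAdd, CoxeterSystem.braidWord, h, h2, CoxeterSystem.length_alternatingWord]

theorem simple_weakLE_braidWord {i j : B} (hij : i ≠ j) (h : M i j ≠ 0) :
    WeakLE cs (cs.simple i) (cs.wordProd (CoxeterSystem.braidWord M i j)) := by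
  obtain ⟨τ, hτ⟩ := exists_braidWord_eq_cons M h
  have h1 := (isReduced_alternatingWord cs hij (M i j) (Or.inr le_rfl)).eq
  have h2 := cs.wordProd_braidWord_eq i j
  have h3 : cs.wordProd (CoxeterSystem.braidWord M i j) = cs.simple i * cs.wordProd τ := by
    rcases hτ with h | h
    · rw [h, cs.wordProd_cons]
    · rw [h2, h, cs.wordProd_cons]
  have h4 : τ.length + 1 = M i j := by
    rcases hτ with h | h
    · have := congrArg List.length h; simp [CoxeterSystem.braidWord] at this; omega
    · have := congrArg List.length h
      simp [CoxeterSystem.braidWord] at this; rw [M.symmetric] at this; omega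
  have h5 := cs.length_wordProd_le τ
  have h6 := cs.length_mul_le (cs.simple i) (cs.wordProd τ)
  rw [CoxeterSystem.length_alternatingWord] at h1
  change cs.length (cs.wordProd (CoxeterSystem.braidWord M i j)) = _ at h1
  rw [h3] at h1 ⊢
  refine LenAdd.weakLE ?_
  rw [LenAdd]
  rw [cs.length_simple] at *
  omega

/-- Two left descents of `w`: the braid element of the two generators is a prefix of `w`. -/
theorem braidWord_weakLE {w : W} {i j : B} (hij : i ≠ j) (hi : WeakLE cs (cs.simple i) w)
    (hj : WeakLE cs (cs.simple j) w) :
    M i j ≠ 0 ∧ WeakLE cs (cs.wordProd (CoxeterSystem.braidWord M i j)) w := by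
  have key : ∀ i, WeakLE cs (cs.simple i) w → cs.IsRightDescent w⁻¹ i := by
    intro i hi
    rw [cs.isRightDescent_inv_iff, cs.isLeftDescent_iff]
    rw [WeakLE, cs.length_simple, cs.inv_simple] at hi
    omega
  refine ⟨matrix_ne_zero_of_descents cs hij (key i hi) (key j hj), ?_⟩
  obtain ⟨x, hx, hl⟩ := exists_alternating_suffix cs hij (key i hi) (key j hj) (M i j) (by simp)
  have h1 := (isReduced_alternatingWord cs hij (M i j) (Or.inr le_rfl)).eq
  rw [CoxeterSystem.length_alternatingWord] at h1
  have hw : w = (cs.wordProd (alternatingWord i j (M i j)))⁻¹ * x⁻¹ := by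
    rw [← mul_inv_rev, ← hx, inv_inv]
  have h2 : (cs.wordProd (alternatingWord i j (M i j)))⁻¹ =
      cs.wordProd (CoxeterSystem.braidWord M i j) := by
    have e := cs.wordProd_braidWord_eq i j
    rw [← cs.wordProd_reverse, reverse_alternatingWord]
    split_ifs
    · rw [e, CoxeterSystem.braidWord, M.symmetric]
    · rfl
  rw [hw, h2]
  refine LenAdd.weakLE ?_
  rw [LenAdd, ← h2, ← hw, cs.length_inv, cs.length_inv, h1]
  rw [cs.length_inv] at hl
  omega

/-- A Newman-type lemma: a bounded prefix-closed set that is locally confluent has a maximum. -/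
theorem exists_weakLE_max (E : Set W) (N : ℕ) (hN : ∀ z ∈ E, cs.length z ≤ N) (h1 : 1 ∈ E)
    (hp : ∀ y ∈ E, ∀ z, WeakLE cs z y → z ∈ E)
    (hc : ∀ z ∈ E, ∀ a b, a ≠ b → LenAdd cs z (cs.simple a) → LenAdd cs z (cs.simple b) →
      z * cs.simple a ∈ E → z * cs.simple b ∈ E →
      M a b ≠ 0 ∧ z * cs.wordProd (CoxeterSystem.braidWord M a b) ∈ E) :
    ∃ e ∈ E, ∀ z ∈ E, WeakLE cs z e := by
  have main : ∀ n, ∀ z ∈ E, N < cs.length z + n →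
      ∃ e ∈ E, WeakLE cs z e ∧ ∀ y ∈ E, WeakLE cs z y → WeakLE cs y e := by
    intro n
    induction n with
    | zero => intro z hz h; have := hN z hz; omega
    | succ n ih =>
      intro z hz hn
      have atom : ∀ y ∈ E, WeakLE cs z y → y = z ∨ ∃ a, LenAdd cs z (cs.simple a) ∧
          WeakLE cs (z * cs.simple a) y ∧ z * cs.simple a ∈ E := by
        intro y hy hzy
        by_cases h : z⁻¹ * y = 1
        · exact Or.inl (inv_mul_eq_one.1 h).symm
        · right
          obtain ⟨a, ha⟩ := cs.exists_leftDescent_of_ne_one h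
          have h2 : LenAdd cs (cs.simple a) (cs.simple a * (z⁻¹ * y)) := by
            rw [cs.isLeftDescent_iff] at ha
            rw [LenAdd, cs.simple_mul_simple_cancel_left, cs.length_simple]
            omega
          have h3 := LenAdd.assoc_right h2 (x := z) (by simpa using hzy.lenAdd)
          have h4 := h3.2.weakLE
          simp only [mul_assoc, cs.simple_mul_simple_cancel_left, mul_inv_cancel_left] at h4
          exact ⟨a, h3.1, h4, hp y hy _ h4⟩
      by_cases hex : ∃ a, LenAdd cs z (cs.simple a) ∧ z * cs.simple a ∈ E
      · obtain ⟨a, ha, haE⟩ := hex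
        have hlen : ∀ b, LenAdd cs z (cs.simple b) → N < cs.length (z * cs.simple b) + n := by
          intro b hb
          rw [LenAdd, cs.length_simple] at hb
          omega
        obtain ⟨e, heE, hze, he⟩ := ih _ haE (hlen a ha)
        refine ⟨e, heE, ha.weakLE.trans hze, fun y hy hzy => ?_⟩
        rcases atom y hy hzy with rfl | ⟨b, hb, hby, hbE⟩
        · exact ha.weakLE.trans hze
        by_cases hab : a = b
        · subst hab; exact he y hy hby
        obtain ⟨e', heE', hze', he'⟩ := ih _ hbE (hlen b hb)
        obtain ⟨hM, hq⟩ := hc z hz a b hab ha hb haE hbE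
        have hL := length_mul_braidWord cs hab ((lenAdd_simple_iff cs).1 ha)
          ((lenAdd_simple_iff cs).1 hb)
        have hqa := WeakLE.mul_left cs (simple_weakLE_braidWord cs hab hM) hL
        rw [cs.wordProd_braidWord_eq] at hL
        have hqb := WeakLE.mul_left cs
          (simple_weakLE_braidWord cs (Ne.symm hab) (by rwa [M.symmetric])) hL
        rw [← cs.wordProd_braidWord_eq] at hqb
        exact (he' y hy hby).trans (he e' heE' (hqa.trans (he' _ hq hqb)))
      · refine ⟨z, hz, weakLE_refl cs z, fun y hy hzy => ?_⟩
        rcases atom y hy hzy with rfl | ⟨a, ha, -, haE⟩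
        · exact weakLE_refl cs _
        · exact (hex ⟨a, ha, haE⟩).elim
  obtain ⟨e, he, -, h⟩ := main (N + 1) 1 h1 (by omega)
  exact ⟨e, he, fun z hz => h z hz (one_weakLE cs z)⟩

end WeakOrder

end

section

/-! ### The Artin monoid -/

section BraidMonoid

open CoxeterSystem (alternatingWord braidWord)

variable {B : Type*} (M : CoxeterMatrix B)

/-- The braid relations (trivial for pairs labelled `0`, that is `∞`). -/
def braidRel (x y : FreeMonoid B) : Prop :=
  ∃ i j, x = FreeMonoid.ofList (braidWord M i j) ∧ y = FreeMonoid.ofList (braidWord M j i)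

/-- The Artin monoid of a Coxeter matrix. -/
abbrev BraidMonoid := PresentedMonoid (braidRel M)

/-- The element of the Artin monoid represented by a word. -/
def pos (ω : List B) : BraidMonoid M := PresentedMonoid.mk (braidRel M) (FreeMonoid.ofList ω)

@[simp] theorem pos_nil : pos M [] = 1 := rfl

@[simp] theorem pos_append (u v : List B) : pos M (u ++ v) = pos M u * pos M v := by
  rw [pos, FreeMonoid.ofList_append, map_mul]; rfl

theorem pos_cons (i : B) (u : List B) : pos M (i :: u) = pos M [i] * pos M u :=
  pos_append M [i] u

theorem pos_braidWord (i j : B) : pos M (braidWord M i j) = pos M (braidWord M j i) :=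
  PresentedMonoid.mk_eq_mk_of_rel ⟨i, j, rfl, rfl⟩

theorem pos_surjective (b : BraidMonoid M) : ∃ ω, b = pos M ω := by
  obtain ⟨x, rfl⟩ := PresentedMonoid.surjective_mk b
  exact ⟨x.toList, rfl⟩

theorem pos_induction {p : BraidMonoid M → Prop} (one : p 1)
    (cons : ∀ i b, p b → p (pos M [i] * b)) (b : BraidMonoid M) : p b := by
  obtain ⟨ω, rfl⟩ := pos_surjective M b
  induction ω with
  | nil => exact one
  | cons i ω ih => rw [pos_cons]; exact cons i _ ih

theorem pos_eq_induction {p : List B → List B → Prop} (refl : ∀ u, p u u)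
    (symm : ∀ u v, p u v → p v u) (trans : ∀ u v w, p u v → p v w → p u w)
    (append : ∀ u v u' v', p u v → p u' v' → p (u ++ u') (v ++ v'))
    (braid : ∀ i j, p (braidWord M i j) (braidWord M j i)) {u v : List B}
    (h : pos M u = pos M v) : p u v := by
  have h := PresentedMonoid.mk_eq_mk_iff.1 h
  change ConGen.Rel _ _ _ at h
  change p (FreeMonoid.ofList u).toList (FreeMonoid.ofList v).toList
  generalize FreeMonoid.ofList u = x at h ⊢
  generalize FreeMonoid.ofList v = y at h ⊢
  induction h with
  | of x y h => obtain ⟨i, j, rfl, rfl⟩ := h; exact braid i j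
  | refl x => exact refl _
  | symm _ ih => exact symm _ _ ih
  | trans _ _ ih ih' => exact trans _ _ _ ih ih'
  | mul _ _ ih ih' => exact append _ _ _ _ ih ih'

theorem freeMonoid_lift_ofList {N : Type*} [Monoid N] (f : B → N) (ω : List B) :
    FreeMonoid.lift f (FreeMonoid.ofList ω) = (ω.map f).prod := by
  rw [FreeMonoid.lift_apply]; rfl

/-- A map to a monoid compatible with the braid relations extends to the Artin monoid. -/
theorem exists_posLift {N : Type*} [Monoid N] (f : B → N)
    (h : ∀ i j, ((braidWord M i j).map f).prod = ((braidWord M j i).map f).prod) :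
    ∃ F : BraidMonoid M →* N, ∀ ω, F (pos M ω) = (ω.map f).prod := by
  refine ⟨PresentedMonoid.lift f ?_, fun ω => freeMonoid_lift_ofList f ω⟩
  rintro a b ⟨i, j, rfl, rfl⟩
  simp only [freeMonoid_lift_ofList]
  exact h i j

theorem exists_posRev : ∃ F : BraidMonoid M →* (BraidMonoid M)ᵐᵒᵖ,
    ∀ ω, F (pos M ω) = MulOpposite.op (pos M ω.reverse) := by
  have key : ∀ ω : List B, (ω.map fun i => MulOpposite.op (pos M [i])).prod =
      MulOpposite.op (pos M ω.reverse) := by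
    intro ω
    induction ω with
    | nil => rfl
    | cons i ω ih => rw [map_cons, prod_cons, ih, ← MulOpposite.op_mul, reverse_cons, pos_append]
  obtain ⟨F, hF⟩ := exists_posLift M (fun i => MulOpposite.op (pos M [i])) (by
    intro i j
    rw [key, key]
    congr 1
    simp only [braidWord, reverse_alternatingWord, M.symmetric j i]
    have := pos_braidWord M i j
    simp only [braidWord, M.symmetric j i] at this
    split_ifs
    exacts [this.symm, this])
  exact ⟨F, fun ω => by rw [hF, key]⟩

/-- The length homomorphism of the Artin monoid. -/
theorem exists_posLen : ∃ F : BraidMonoid M →* Multiplicative ℕ,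
    ∀ ω, F (pos M ω) = Multiplicative.ofAdd ω.length := by
  have key : ∀ ω : List B, (ω.map fun _ => Multiplicative.ofAdd 1).prod =
      Multiplicative.ofAdd ω.length := by
    intro ω
    induction ω with
    | nil => rfl
    | cons i ω ih =>
      rw [map_cons, prod_cons, ih, length_cons, add_comm, ofAdd_add]
  obtain ⟨F, hF⟩ := exists_posLift M (fun _ => Multiplicative.ofAdd 1) (by
    intro i j
    rw [key, key]
    simp [braidWord, M.symmetric j i])
  exact ⟨F, fun ω => by rw [hF, key]⟩

/-- The length of an element of the Artin monoid. -/
noncomputable def posLen (b : BraidMonoid M) : ℕ := ((exists_posLen M).choose b).toAdd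

@[simp] theorem posLen_pos (ω : List B) : posLen M (pos M ω) = ω.length := by
  rw [posLen, (exists_posLen M).choose_spec]; rfl

@[simp] theorem posLen_mul (a b : BraidMonoid M) :
    posLen M (a * b) = posLen M a + posLen M b := by
  simp [posLen]

theorem posLen_eq_zero {b : BraidMonoid M} : posLen M b = 0 ↔ b = 1 := by
  obtain ⟨ω, rfl⟩ := pos_surjective M b
  rw [posLen_pos, List.length_eq_zero_iff]
  constructor
  · rintro rfl; rfl
  · intro h
    have := congrArg (posLen M) h
    rw [← pos_nil, posLen_pos, posLen_pos, length_nil] at this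
    exact List.length_eq_zero_iff.1 this

theorem exists_atom_dvd {b : BraidMonoid M} (h : b ≠ 1) : ∃ i, pos M [i] ∣ b := by
  obtain ⟨ω, rfl⟩ := pos_surjective M b
  cases ω with
  | nil => simp at h
  | cons i ω => exact ⟨i, pos M ω, pos_cons M i ω⟩

end BraidMonoid

section Lift

open CoxeterSystem (alternatingWord braidWord)

variable {B W : Type*} [Group W] {M : CoxeterMatrix B} (cs : CoxeterSystem M W)

theorem matsumoto (n : ℕ) (ω ω' : List B) (h : cs.IsReduced ω) (h' : cs.IsReduced ω')
    (e : cs.wordProd ω = cs.wordProd ω') (hn : ω.length = n) : pos M ω = pos M ω' := by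
  induction n generalizing ω ω' with
  | zero =>
    have : ω'.length = 0 := by rw [← h'.eq, ← e, h.eq, hn]
    rw [List.length_eq_zero_iff] at hn this
    rw [hn, this]
  | succ n ih =>
    have hn' : ω'.length = n + 1 := by rw [← h'.eq, ← e, h.eq, hn]
    have same : ∀ (u u' : List B) (i : B), cs.IsReduced (u ++ [i]) → cs.IsReduced (u' ++ [i]) →
        cs.wordProd (u ++ [i]) = cs.wordProd (u' ++ [i]) → (u ++ [i]).length = n + 1 →
        pos M (u ++ [i]) = pos M (u' ++ [i]) := by
      intro u u' i h h' e hn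
      rw [pos_append, pos_append, ih u u' (by simpa using h.take u.length)
        (by simpa using h'.take u'.length) (by simpa [cs.wordProd_append] using e)
        (by simpa using hn)]
    obtain ⟨u, i, rfl⟩ := (List.eq_nil_or_concat' ω).resolve_left (by rintro rfl; simp at hn)
    obtain ⟨u', j, rfl⟩ := (List.eq_nil_or_concat' ω').resolve_left (by rintro rfl; simp at hn')
    by_cases hij : i = j
    · subst hij; exact same u u' i h h' e hn
    have desc : ∀ (u : List B) i, cs.IsReduced (u ++ [i]) →
        cs.IsRightDescent (cs.wordProd (u ++ [i])) i := by
      intro u i h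
      have h0 : cs.IsReduced u := by simpa using h.take u.length
      rw [CoxeterSystem.IsRightDescent, h.eq, cs.wordProd_append, cs.wordProd_singleton, mul_assoc,
        cs.simple_mul_simple_self, mul_one, h0.eq]
      simp
    have hi := desc u i h
    have hj := desc u' j h'
    rw [← e] at hj
    have hM := matrix_ne_zero_of_descents cs hij hi hj
    obtain ⟨x, hx, hl⟩ := exists_alternating_suffix cs hij hi hj (M i j) (by simp)
    obtain ⟨χ, hχ, rfl⟩ := cs.exists_isReduced x
    rw [h.eq, hχ.eq] at hl
    have hb : cs.wordProd (u ++ [i]) = cs.wordProd (χ ++ braidWord M i j) := by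
      rw [hx, cs.wordProd_append]
    have hb' : cs.wordProd (u ++ [i]) = cs.wordProd (χ ++ braidWord M j i) := by
      rw [hb, cs.wordProd_append, cs.wordProd_append, cs.wordProd_braidWord_eq]
    have hr : cs.IsReduced (χ ++ braidWord M i j) := by
      rw [CoxeterSystem.IsReduced, ← hb, h.eq, hl]; simp [braidWord]
    have hr' : cs.IsReduced (χ ++ braidWord M j i) := by
      rw [CoxeterSystem.IsReduced, ← hb', h.eq, hl]; simp [braidWord, M.symmetric]
    have ends : ∀ i j, M i j ≠ 0 → ∃ τ, braidWord M i j = τ ++ [j] := by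
      intro i j h
      obtain ⟨k, hk⟩ := Nat.exists_eq_succ_of_ne_zero h
      exact ⟨_, by rw [braidWord, hk, Nat.succ_eq_add_one, CoxeterSystem.alternatingWord_succ,
        concat_eq_append]⟩
    obtain ⟨τ, hτ⟩ := ends i j hM
    obtain ⟨τ', hτ'⟩ := ends j i (by rwa [M.symmetric])
    have e1 : pos M (u ++ [i]) = pos M (χ ++ braidWord M j i) := by
      rw [hτ', ← append_assoc] at hb' hr' ⊢
      exact same _ _ _ h hr' hb' hn
    have e2 : pos M (u' ++ [j]) = pos M (χ ++ braidWord M i j) := by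
      rw [e, hτ, ← append_assoc] at hb
      rw [hτ, ← append_assoc] at hr ⊢
      exact same _ _ _ h' hr hb hn'
    rw [e1, e2, pos_append, pos_append, pos_braidWord]

/-- The canonical section from the Coxeter group to the Artin monoid. -/
noncomputable def posSection (w : W) : BraidMonoid M := pos M (cs.exists_isReduced w).choose

variable {cs} in
theorem posSection_eq {ω : List B} (h : cs.IsReduced ω) :
    posSection cs (cs.wordProd ω) = pos M ω :=
  matsumoto cs _ _ _ (cs.exists_isReduced (cs.wordProd ω)).choose_spec.1 h
    (cs.exists_isReduced (cs.wordProd ω)).choose_spec.2.symm rfl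

variable {cs} in
theorem posSection_mul {x y : W} (h : LenAdd cs x y) :
    posSection cs (x * y) = posSection cs x * posSection cs y := by
  obtain ⟨u, hu, rfl⟩ := cs.exists_isReduced x
  obtain ⟨v, hv, rfl⟩ := cs.exists_isReduced y
  have : cs.IsReduced (u ++ v) := by
    rw [CoxeterSystem.IsReduced, cs.wordProd_append, h, hu.eq, hv.eq, length_append]
  rw [← cs.wordProd_append, posSection_eq this, posSection_eq hu, posSection_eq hv, pos_append]

@[simp] theorem posSection_one : posSection cs 1 = 1 := by
  have : cs.IsReduced [] := by simp [CoxeterSystem.IsReduced]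
  simpa using posSection_eq this

theorem isReduced_singleton (i : B) : cs.IsReduced [i] := by
  simp [CoxeterSystem.IsReduced]

@[simp] theorem posSection_simple (i : B) : posSection cs (cs.simple i) = pos M [i] := by
  simpa using posSection_eq (isReduced_singleton cs i)

theorem exists_nu (x y : W) : ∃ e, WeakLE cs e y ∧ LenAdd cs x e ∧
    ∀ z, WeakLE cs z y → LenAdd cs x z → WeakLE cs z e := by
  obtain ⟨e, he, h⟩ := exists_weakLE_max cs {z | WeakLE cs z y ∧ LenAdd cs x z} (cs.length y)
    (fun z hz => hz.1.length_le) ⟨one_weakLE cs y, lenAdd_one cs x⟩ (by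
      rintro y' ⟨h1, h2⟩ z hz
      exact ⟨hz.trans h1, (LenAdd.assoc_right hz.lenAdd (by simpa using h2)).1⟩) (by
      rintro z ⟨hz, hz'⟩ a b hab ha hb ⟨haE, haE'⟩ ⟨hbE, hbE'⟩
      have pre : ∀ a, LenAdd cs z (cs.simple a) → WeakLE cs (z * cs.simple a) y →
          WeakLE cs (cs.simple a) (z⁻¹ * y) := fun a h h' =>
        WeakLE.of_mul_left cs (by simpa using h') h
      obtain ⟨hM, hq⟩ := braidWord_weakLE cs hab (pre a ha haE) (pre b hb hbE)
      refine ⟨hM, ?_, ?_⟩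
      · simpa using WeakLE.mul_left cs hq hz.lenAdd
      · have h1 := LenAdd.assoc_right ha haE'
        have h2 := LenAdd.assoc_right hb hbE'
        have h3 := length_mul_braidWord cs hab ((lenAdd_simple_iff cs).1 h1.2)
          ((lenAdd_simple_iff cs).1 h2.2)
        exact (LenAdd.assoc_left hz' h3).2)
  exact ⟨e, he.1, he.2, fun z h1 h2 => h z ⟨h1, h2⟩⟩

/-- The longest prefix of `y` that is reduced with respect to left multiplication by `x`. -/
noncomputable def nu (x y : W) : W := (exists_nu cs x y).choose

theorem nu_weakLE (x y : W) : WeakLE cs (nu cs x y) y := (exists_nu cs x y).choose_spec.1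

theorem lenAdd_nu (x y : W) : LenAdd cs x (nu cs x y) := (exists_nu cs x y).choose_spec.2.1

variable {cs} in
theorem weakLE_nu {x y z : W} (h : WeakLE cs z y) (h' : LenAdd cs x z) :
    WeakLE cs z (nu cs x y) := (exists_nu cs x y).choose_spec.2.2 z h h'

variable {cs} in
theorem nu_mul {x x' y : W} (h : LenAdd cs x x') :
    nu cs x (x' * nu cs x' y) = x' * nu cs (x * x') y := by
  have h1 := LenAdd.assoc_left h (lenAdd_nu cs (x * x') y)
  have hz := weakLE_nu (nu_weakLE cs (x * x') y) h1.1
  refine WeakLE.antisymm ?_ (weakLE_nu (WeakLE.mul_left cs hz (lenAdd_nu cs x' y)) h1.2)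
  have h2 := weakLE_nu (LenAdd.weakLE (lenAdd_nu cs x' y)) h
  obtain ⟨v, hv⟩ : ∃ v, nu cs x (x' * nu cs x' y) = x' * v := ⟨_, by rw [mul_inv_cancel_left]⟩
  have h3 : LenAdd cs x' v := by rw [hv] at h2; simpa using h2.lenAdd
  have h4 := lenAdd_nu cs x (x' * nu cs x' y)
  have h5 := nu_weakLE cs x (x' * nu cs x' y)
  rw [hv] at h4 h5 ⊢
  have h6 := LenAdd.assoc_right h3 h4
  exact WeakLE.mul_left cs (weakLE_nu ((WeakLE.of_mul_left cs h5 h3).trans (nu_weakLE cs _ _)) h6.2)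
    h1.1

/-- Left multiplication by (the lift of) `x` on pairs (Coxeter element, remainder). -/
noncomputable def nuAct (x : W) : Function.End (W × BraidMonoid M) := fun p =>
  (x * nu cs x p.1, posSection cs ((nu cs x p.1)⁻¹ * p.1) * p.2)

variable {cs} in
theorem nuAct_mul {x x' : W} (h : LenAdd cs x x') :
    nuAct cs (x * x') = nuAct cs x * nuAct cs x' := by
  funext ⟨y, c⟩
  change nuAct cs (x * x') (y, c) = nuAct cs x (nuAct cs x' (y, c))
  simp only [nuAct, nu_mul h, mul_assoc]
  congr 1
  rw [← mul_assoc, ← posSection_mul]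
  · congr 2; group
  have h1 := LenAdd.assoc_left h (lenAdd_nu cs (x * x') y)
  have hz := weakLE_nu (nu_weakLE cs (x * x') y) h1.1
  have := LenAdd.assoc_left hz.lenAdd (z := (nu cs x' y)⁻¹ * y)
    (by simpa using (nu_weakLE cs x' y).lenAdd)
  simpa [mul_assoc] using this.1

theorem nuAct_one : nuAct cs 1 = 1 := by
  funext ⟨y, c⟩
  have : nu cs 1 y = y :=
    WeakLE.antisymm (nu_weakLE cs 1 y) (weakLE_nu (weakLE_refl cs y) (by simp [LenAdd]))
  simp [nuAct, this]
  rfl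

theorem nuAct_wordProd {ω : List B} (h : cs.IsReduced ω) :
    nuAct cs (cs.wordProd ω) = (ω.map fun i => nuAct cs (cs.simple i)).prod := by
  induction ω with
  | nil => simp [nuAct_one]
  | cons i ω ih =>
    have h1 : cs.IsReduced ω := by simpa using h.drop 1
    rw [cs.wordProd_cons, nuAct_mul, ih h1, map_cons, prod_cons]
    rw [LenAdd, ← cs.wordProd_cons, h.eq, h1.eq, cs.length_simple, length_cons, add_comm]

theorem exists_posAct : ∃ F : BraidMonoid M →* Function.End (W × BraidMonoid M),
    ∀ i, F (pos M [i]) = nuAct cs (cs.simple i) := by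
  obtain ⟨F, hF⟩ := exists_posLift M (fun i => nuAct cs (cs.simple i)) (by
    intro i j
    by_cases hij : i = j
    · rw [hij]
    rw [← nuAct_wordProd, ← nuAct_wordProd, cs.wordProd_braidWord_eq]
    exacts [isReduced_alternatingWord cs (Ne.symm hij) _ (by simp),
      isReduced_alternatingWord cs hij _ (by simp)])
  exact ⟨F, fun i => by rw [hF]; simp⟩

/-- The greatest left divisor of `b` lying in the image of the Coxeter group, with quotient. -/
theorem exists_head : ∃ α : BraidMonoid M → W × BraidMonoid M,
    (∀ b, b = posSection cs (α b).1 * (α b).2) ∧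
    ∀ i b, α (pos M [i] * b) = nuAct cs (cs.simple i) (α b) := by
  obtain ⟨F, hF⟩ := exists_posAct cs
  have h2 : ∀ i b, F (pos M [i] * b) (1, 1) = nuAct cs (cs.simple i) (F b (1, 1)) := by
    intro i b; rw [map_mul, hF]; rfl
  refine ⟨fun b => F b (1, 1), fun b => ?_, h2⟩
  induction b using pos_induction with
  | one =>
    have h0 : F 1 (1, 1) = (1, 1) := by rw [map_one]; rfl
    simp only [h0]
    simp
  | cons i b ih =>
    simp only [h2, nuAct, posSection_mul (lenAdd_nu cs _ _), mul_assoc, posSection_simple]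
    rw [← mul_assoc (posSection cs _) (posSection cs _), ← posSection_mul (nu_weakLE cs _ _).lenAdd,
      mul_inv_cancel_left, ← ih]

include cs in
theorem atom_mul_left_cancel {i : B} {b b' : BraidMonoid M}
    (h : pos M [i] * b = pos M [i] * b') : b = b' := by
  obtain ⟨α, h1, h2⟩ := exists_head cs
  have key : ∀ b, b = posSection cs ((cs.simple i)⁻¹ * (α (pos M [i] * b)).1) *
      (α (pos M [i] * b)).2 := by
    intro b
    simp only [h2, nuAct, inv_mul_cancel_left]
    rw [← mul_assoc, ← posSection_mul (nu_weakLE cs _ _).lenAdd, mul_inv_cancel_left, ← h1]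
  rw [key b, h, ← key b']

include cs in
theorem braidWord_dvd {i j : B} (hij : i ≠ j) {b : BraidMonoid M} (hi : pos M [i] ∣ b)
    (hj : pos M [j] ∣ b) : M i j ≠ 0 ∧ pos M (braidWord M i j) ∣ b := by
  obtain ⟨α, h1, h2⟩ := exists_head cs
  have key : ∀ i, pos M [i] ∣ b → WeakLE cs (cs.simple i) (α b).1 := by
    rintro i ⟨b', rfl⟩
    rw [h2]
    exact (lenAdd_nu cs _ _).weakLE
  obtain ⟨hM, h⟩ := braidWord_weakLE cs hij (key i hi) (key j hj)
  refine ⟨hM, ?_⟩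
  have h3 := posSection_mul h.lenAdd
  rw [mul_inv_cancel_left, posSection_eq (isReduced_alternatingWord cs hij _ (by simp))] at h3
  exact ⟨_, by rw [h1 b, h3, mul_assoc]⟩

theorem exists_common_multiple (N : ℕ) (hN : ∀ w, cs.length w ≤ N) (b c : BraidMonoid M) :
    ∃ b' c', b * c' = c * b' := by
  obtain ⟨w₀, -, hw⟩ := exists_weakLE_max cs Set.univ N (fun z _ => hN z) trivial
    (fun _ _ _ _ => trivial) (by
      intro z _ a b hab ha hb _ _
      refine ⟨fun hM => ?_, trivial⟩
      have := length_mul_alternating cs (u := 1) hab (cs.not_isRightDescent_one a)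
        (cs.not_isRightDescent_one b) (N + 1) (Or.inl hM)
      have h2 := hN (1 * cs.wordProd (alternatingWord a b (N + 1)))
      rw [this] at h2
      omega)
  have fac : ∀ w, posSection cs w₀ = posSection cs w * posSection cs (w⁻¹ * w₀) := by
    intro w
    rw [← posSection_mul (hw w trivial).lenAdd, mul_inv_cancel_left]
  have P : ∀ b : BraidMonoid M, ∀ w, ∃ w' b', b * posSection cs w' = posSection cs w * b' := by
    intro b
    induction b using pos_induction with
    | one => intro w; exact ⟨w, 1, by simp⟩
    | cons i b ih =>
      intro w
      obtain ⟨w', b', h⟩ := ih ((cs.simple i)⁻¹ * w₀)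
      refine ⟨w', posSection cs (w⁻¹ * w₀) * b', ?_⟩
      rw [mul_assoc, h, ← posSection_simple cs i, ← mul_assoc, ← mul_assoc, ← fac, ← fac]
  induction c using pos_induction generalizing b with
  | one => exact ⟨b, 1, by simp⟩
  | cons i c ih =>
    obtain ⟨w', b', h⟩ := P b (cs.simple i)
    obtain ⟨b'', c', h'⟩ := ih b'
    refine ⟨b'', posSection cs w' * c', ?_⟩
    rw [← mul_assoc, h, mul_assoc, h', posSection_simple, mul_assoc]

end Lift

section Cancellation

variable {B : Type*} (M : CoxeterMatrix B)

theorem pos_mul_left_cancel {a b c : BraidMonoid M} (h : a * b = a * c) : b = c := by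
  induction a using pos_induction with
  | one => simpa using h
  | cons i a ih => exact ih (atom_mul_left_cancel M.toCoxeterSystem (by simpa [mul_assoc] using h))

/-- The anti-automorphism of the Artin monoid reversing words. -/
noncomputable def posRev (b : BraidMonoid M) : BraidMonoid M :=
  ((exists_posRev M).choose b).unop

@[simp] theorem posRev_pos (ω : List B) : posRev M (pos M ω) = pos M ω.reverse := by
  rw [posRev, (exists_posRev M).choose_spec]; rfl

@[simp] theorem posRev_mul (a b : BraidMonoid M) :
    posRev M (a * b) = posRev M b * posRev M a := by
  simp [posRev]

@[simp] theorem posRev_posRev (b : BraidMonoid M) : posRev M (posRev M b) = b := by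
  obtain ⟨ω, rfl⟩ := pos_surjective M b
  simp

theorem pos_mul_right_cancel {a b c : BraidMonoid M} (h : b * a = c * a) : b = c := by
  have := congrArg (posRev M) h
  rw [posRev_mul, posRev_mul] at this
  simpa using congrArg (posRev M) (pos_mul_left_cancel M this)

instance : IsCancelMul (BraidMonoid M) where
  mul_left_cancel _ _ _ h := pos_mul_left_cancel M h
  mul_right_cancel _ _ _ h := pos_mul_right_cancel M h

end Cancellation

end

section

/-! ### Symmetry under word reversal -/

theorem reverse_altWord (s t : S) (k : ℕ) : (altWord s t k).reverse =
    if Even k then altWord t s k else altWord s t k := by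
  induction k generalizing s t with
  | zero => simp [altWord]
  | succ k ih =>
    have h1 : (altWord s t (k + 1)).reverse = (altWord t s k).reverse ++ [(s, true)] := by
      simp [altWord]
    rw [h1, ih, altWord_succ t s, altWord_succ s t]
    by_cases h : Even k <;> simp [h, Nat.even_add_one]

theorem IsRel.reverse {A : ArtinData S} {u v : Word S} (h : IsRel A u v) :
    IsRel A u.reverse v.reverse := by
  obtain ⟨s, t, k, hst, hk, rfl, rfl⟩ := h
  rw [reverse_altWord, reverse_altWord]
  split_ifs
  exacts [⟨t, s, k, hst.symm, by rw [A.symm, hk], rfl, rfl⟩, ⟨s, t, k, hst, hk, rfl, rfl⟩]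

theorem wordInv_reverse (u : Word S) : wordInv u.reverse = (wordInv u).reverse := by
  simp [wordInv]

theorem OneStep.reverse {A : ArtinData S} {w w' : Word S} (h : OneStep A w w') :
    OneStep A w.reverse w'.reverse := by
  rcases h with ⟨w₁, w₂, s, b, rfl, rfl⟩ | ⟨w₁, w₂, u, v, h, h'⟩ | h | h
  · exact Or.inl ⟨w₂.reverse, w₁.reverse, s, !b, by simp, by simp⟩
  · refine Or.inr (Or.inl ⟨w₂.reverse, w₁.reverse, u.reverse, v.reverse, h.reverse, ?_⟩)
    rcases h' with ⟨rfl, rfl⟩ | ⟨rfl, rfl⟩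
    · left; simp
    · right; simp [wordInv_reverse]
  · obtain ⟨w₁, w₂, u₁, u₂, v₁, v₂, h, h1, h2, rfl, rfl⟩ := h
    exact Or.inr (Or.inr (Or.inr ⟨w₂.reverse, w₁.reverse, v₂.reverse, v₁.reverse, u₂.reverse,
      u₁.reverse, by simpa using h.symm.reverse, by simpa, by simpa, by simp [wordInv_reverse],
      by simp [wordInv_reverse]⟩))
  · obtain ⟨w₁, w₂, u₁, u₂, v₁, v₂, h, h1, h2, rfl, rfl⟩ := h
    exact Or.inr (Or.inr (Or.inl ⟨w₂.reverse, w₁.reverse, v₂.reverse, v₁.reverse, u₂.reverse,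
      u₁.reverse, by simpa using h.symm.reverse, by simpa, by simpa, by simp [wordInv_reverse],
      by simp [wordInv_reverse]⟩))

theorem Steps012.reverse {A : ArtinData S} {w w' : Word S} (h : Steps012 A w w') :
    Steps012 A w.reverse w'.reverse :=
  h.induct (p := fun w w' => Steps012 A w.reverse w'.reverse)
    (fun _ => .refl _ _) (fun _ _ _ h h' => h.trans h') fun _ _ h => h.reverse.steps

/-! ### Positive words -/

open CoxeterSystem (alternatingWord braidWord)

/-- The Coxeter matrix of an Artin-Tits presentation, with `0` encoding the label `∞`. -/
noncomputable def ArtinData.cox (A : ArtinData S) : CoxeterMatrix S where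
  M := Matrix.of fun i j => if i = j then 1 else (A.m i j).toNat
  isSymm := by
    ext i j
    simp only [Matrix.transpose_apply, Matrix.of_apply, A.symm j i, eq_comm]
  diagonal i := by simp
  off_diagonal i j h := by
    simp only [Matrix.of_apply, if_neg h]
    intro h1
    have h2 := A.two_le i j h
    cases h3 : A.m i j with
    | top => simp [h3] at h1
    | coe n =>
      rw [h3] at h1 h2
      simp only [ENat.toNat_natCast] at h1
      subst h1
      exact absurd h2 (by decide)

theorem ArtinData.cox_apply (A : ArtinData S) {i j : S} (h : i ≠ j) :
    A.cox i j = (A.m i j).toNat := by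
  change (if i = j then 1 else (A.m i j).toNat) = _
  rw [if_neg h]

theorem ArtinData.m_eq_of_cox_ne_zero (A : ArtinData S) {i j : S} (h : i ≠ j)
    (h' : A.cox i j ≠ 0) : A.m i j = (A.cox i j : ℕ∞) := by
  rw [A.cox_apply h] at h' ⊢
  exact (ENat.natCast_toNat (fun h => by simp [h] at h')).symm

/-- The positive word with given underlying sequence of generators. -/
def up (ω : List S) : Word S := ω.map fun s => (s, true)

@[simp] theorem up_nil : up ([] : List S) = [] := rfl

@[simp] theorem up_append (u v : List S) : up (u ++ v) = up u ++ up v := by simp [up]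

@[simp] theorem up_cons (s : S) (v : List S) : up (s :: v) = (s, true) :: up v := rfl

@[simp] theorem up_reverse (u : List S) : up u.reverse = (up u).reverse := by simp [up]

theorem up_alternatingWord (s t : S) (k : ℕ) : up (alternatingWord s t k) =
    if Even k then altWord s t k else altWord t s k := by
  induction k generalizing s t with
  | zero => simp [alternatingWord, altWord]
  | succ k ih =>
    rw [CoxeterSystem.alternatingWord_succ', up_cons, ih]
    by_cases h : Even k <;> simp [h, Nat.even_add_one, altWord]

theorem isRel_braidWord {A : ArtinData S} {i j : S} (h : i ≠ j) (h' : A.cox i j ≠ 0) :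
    IsRel A (up (braidWord A.cox i j)) (up (braidWord A.cox j i)) := by
  have hm := A.m_eq_of_cox_ne_zero h h'
  simp only [braidWord, up_alternatingWord, A.cox.symmetric j i]
  split_ifs
  exacts [⟨i, j, _, h, hm, rfl, rfl⟩, ⟨j, i, _, h.symm, by rw [A.symm, hm], rfl, rfl⟩]

theorem braidWord_steps (A : ArtinData S) (i j : S) :
    Steps012 A (up (braidWord A.cox i j)) (up (braidWord A.cox j i)) := by
  by_cases h : i = j
  · subst h; exact .refl _ _
  by_cases h' : A.cox i j = 0
  · rw [braidWord, braidWord, A.cox.symmetric j i, h']; exact .refl _ _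
  · exact (isRel_braidWord h h').steps

theorem steps_of_pos_eq {A : ArtinData S} {u v : List S} (h : pos A.cox u = pos A.cox v) :
    Steps012 A (up u) (up v) := by
  refine (pos_eq_induction A.cox (p := fun u v => Steps012 A (up u) (up v) ∧
    Steps012 A (up v) (up u)) ?_ ?_ ?_ ?_ ?_ h).1
  · exact fun u => ⟨.refl _ _, .refl _ _⟩
  · exact fun u v h => h.symm
  · exact fun u v w h h' => ⟨h.1.trans h'.1, h'.2.trans h.2⟩
  · intro u v u' v' h h'
    simp only [up_append]
    exact ⟨h.1.append h'.1, h.2.append h'.2⟩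
  · exact fun i j => ⟨braidWord_steps A i j, braidWord_steps A j i⟩

variable (A : ArtinData S)

/-- A positive word representing an element of the Artin monoid. -/
noncomputable def pw (b : BraidMonoid A.cox) : Word S := up (pos_surjective A.cox b).choose

theorem pw_steps {ω : List S} {b : BraidMonoid A.cox} (h : pos A.cox ω = b) :
    Steps012 A (up ω) (pw A b) := by
  subst h
  exact steps_of_pos_eq (pos_surjective A.cox (pos A.cox ω)).choose_spec

theorem steps_pw {ω : List S} {b : BraidMonoid A.cox} (h : pos A.cox ω = b) :
    Steps012 A (pw A b) (up ω) := by
  subst h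
  exact steps_of_pos_eq (pos_surjective A.cox (pos A.cox ω)).choose_spec.symm

theorem exists_pw_eq (b : BraidMonoid A.cox) : ∃ ω, pw A b = up ω ∧ pos A.cox ω = b :=
  ⟨_, rfl, (pos_surjective A.cox b).choose_spec.symm⟩

@[simp] theorem pw_one : pw A 1 = [] := (pw_steps A (pos_nil A.cox)).eq_nil

theorem pw_mul (a b : BraidMonoid A.cox) : Steps012 A (pw A (a * b)) (pw A a ++ pw A b) := by
  obtain ⟨u, hu, rfl⟩ := exists_pw_eq A a
  obtain ⟨v, hv, rfl⟩ := exists_pw_eq A b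
  rw [hu, hv, ← up_append]
  exact steps_pw A (pos_append _ _ _)

theorem mul_pw (a b : BraidMonoid A.cox) : Steps012 A (pw A a ++ pw A b) (pw A (a * b)) := by
  obtain ⟨u, hu, rfl⟩ := exists_pw_eq A a
  obtain ⟨v, hv, rfl⟩ := exists_pw_eq A b
  rw [hu, hv, ← up_append]
  exact pw_steps A (pos_append _ _ _)

/-- The canonical map from the Artin monoid to the Artin-Tits group. -/
noncomputable def ev : BraidMonoid A.cox →* ArtinGroup A where
  toFun b := wbar A (pw A b)
  map_one' := by simp
  map_mul' a b := by rw [(pw_mul A a b).wbar_eq, wbar_append]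

@[simp] theorem wbar_pw (b : BraidMonoid A.cox) : wbar A (pw A b) = ev A b := rfl

@[simp] theorem ev_pos (ω : List S) : ev A (pos A.cox ω) = wbar A (up ω) :=
  (pw_steps A rfl).wbar_eq.symm

theorem pw_posRev (b : BraidMonoid A.cox) :
    Steps012 A (pw A (posRev A.cox b)) (pw A b).reverse ∧
      Steps012 A (pw A b).reverse (pw A (posRev A.cox b)) := by
  obtain ⟨u, hu, rfl⟩ := exists_pw_eq A b
  rw [hu, ← up_reverse, posRev_pos]
  exact ⟨steps_pw A rfl, pw_steps A rfl⟩

/-! ### Word reversing -/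

theorem exists_lcm_aux (n : ℕ) (u v x y : BraidMonoid A.cox) (h : u * x = v * y)
    (hn : posLen A.cox (u * x) ≤ n) : ∃ u' v', u * v' = v * u' ∧
      (∀ x y, u * x = v * y → u * v' ∣ u * x) ∧
      Steps012 A (wordInv (pw A u) ++ pw A v) (pw A v' ++ wordInv (pw A u')) := by
  induction n generalizing u v x y with
  | zero =>
    have h1 : posLen A.cox (v * y) = 0 := by rw [← h]; omega
    have h2 : posLen A.cox (u * x) = 0 := by omega
    simp only [posLen_mul, Nat.add_eq_zero_iff, posLen_eq_zero] at h1 h2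
    rw [h1.1, h2.1]
    refine ⟨1, 1, rfl, by simp, ?_⟩
    rw [pw_one]
    exact .refl _ _
  | succ n ih =>
    by_cases hu : u = 1
    · subst hu
      exact ⟨1, v, by simp, fun x y h => ⟨y, by rw [h, one_mul]⟩, by simpa using .refl _ _⟩
    by_cases hv : v = 1
    · subst hv
      exact ⟨u, 1, by simp, by simp, by simpa using .refl _ _⟩
    obtain ⟨s, u₁, rfl⟩ := exists_atom_dvd A.cox hu
    obtain ⟨t, v₁, rfl⟩ := exists_atom_dvd A.cox hv
    have hus : ∀ (s : S) u₁, Steps012 A (pw A (pos A.cox [s] * u₁)) ((s, true) :: pw A u₁) := by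
      intro s u₁
      exact (pw_mul A _ _).trans (((steps_pw A (ω := [s]) rfl).append (.refl _ (pw A u₁))))
    have hstart : Steps012 A (wordInv (pw A (pos A.cox [s] * u₁)) ++ pw A (pos A.cox [t] * v₁))
        (wordInv (pw A u₁) ++ [(s, false), (t, true)] ++ pw A v₁) := by
      have := (hus s u₁).inv.append (hus t v₁)
      simpa [wordInv_cons] using this
    simp only [mul_assoc] at h hn ⊢
    rw [posLen_mul, posLen_pos, length_singleton] at hn
    by_cases hst : s = t
    · subst hst
      obtain ⟨u', v', h1, h2, h3⟩ := ih u₁ v₁ x y (mul_left_cancel h) (by omega)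
      refine ⟨u', v', by rw [h1], fun x y h => mul_dvd_mul_left _ (h2 x y (mul_left_cancel h)),
        hstart.trans (Steps012.trans ?_ h3)⟩
      exact OneStep.steps (Or.inl ⟨_, _, s, false, rfl, rfl⟩)
    have hd := fun x y h => braidWord_dvd A.cox.toCoxeterSystem hst
      (b := pos A.cox [s] * (u₁ * x)) ⟨_, rfl⟩ ⟨v₁ * y, h⟩
    have : ∃ p q : List S, pos A.cox (s :: p) = pos A.cox (t :: q) ∧
        IsRel A (up (s :: p)) (up (t :: q)) ∧ ∀ x y, pos A.cox [s] * (u₁ * x) =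
          pos A.cox [t] * (v₁ * y) → pos A.cox (s :: p) ∣ pos A.cox [s] * (u₁ * x) := by
      have e := pos_braidWord A.cox s t
      have hr := isRel_braidWord hst (hd x y h).1
      obtain ⟨k, hk⟩ := Nat.exists_eq_succ_of_ne_zero (hd x y h).1
      have hd2 := fun x y h => (hd x y h).2
      simp only [braidWord, A.cox.symmetric t s, hk, Nat.succ_eq_add_one,
        CoxeterSystem.alternatingWord_succ'] at e hr hd2
      by_cases hk' : Even k
      · simp only [hk', if_true] at e hr hd2
        exact ⟨_, _, e.symm, hr.symm, fun x y h => e ▸ hd2 x y h⟩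
      · simp only [hk', if_false] at e hr hd2
        exact ⟨_, _, e, hr, hd2⟩
    obtain ⟨p, q, hpq, hrel, hz⟩ := this
    have key : ∀ x y, pos A.cox [s] * (u₁ * x) = pos A.cox [t] * (v₁ * y) →
        ∃ z, u₁ * x = pos A.cox p * z ∧ v₁ * y = pos A.cox q * z := by
      intro x y h
      obtain ⟨z, hz⟩ := hz x y h
      rw [pos_cons _ s p, mul_assoc] at hz
      have hz' : pos A.cox [t] * (v₁ * y) = pos A.cox [t] * (pos A.cox q * z) := by
        rw [← h, hz, ← mul_assoc, ← pos_cons _ s p, hpq, pos_cons _ t q, mul_assoc]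
      exact ⟨z, mul_left_cancel hz, mul_left_cancel hz'⟩
    obtain ⟨z, hz, hz'⟩ := key x y h
    have hn' : posLen A.cox (v₁ * y) ≤ n := by
      have := congrArg (posLen A.cox) h
      simp only [posLen_mul, posLen_pos, length_singleton] at this hn ⊢
      omega
    obtain ⟨u₂, p₁, h1, h2, h3⟩ := ih u₁ (pos A.cox p) x z hz (by omega)
    obtain ⟨q₁, v₂, h4, h5, h6⟩ := ih (pos A.cox q) v₁ z y hz'.symm (hz' ▸ hn')
    have key2 : ∀ x y z, u₁ * x = pos A.cox p * z → v₁ * y = pos A.cox q * z →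
        ∃ z₁ z₂, z = u₂ * z₁ ∧ z = v₂ * z₂ := by
      intro x y z hz hz'
      obtain ⟨z₁, h2⟩ := h2 x z hz
      obtain ⟨z₂, h5⟩ := h5 z y hz'.symm
      rw [hz, h1, mul_assoc] at h2
      rw [mul_assoc] at h5
      exact ⟨z₁, z₂, mul_left_cancel h2, mul_left_cancel h5⟩
    obtain ⟨z₁, z₂, hz₁, hz₂⟩ := key2 x y z hz hz'
    obtain ⟨u₃, v₃, h7, h8, h9⟩ := ih u₂ v₂ z₁ z₂ (by rw [← hz₁, ← hz₂]) (by
      have := congrArg (posLen A.cox) hz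
      rw [← hz₁]
      simp only [posLen_mul] at this hn ⊢
      omega)
    refine ⟨q₁ * u₃, p₁ * v₃, ?_, fun x y h => ?_, hstart.trans ?_⟩
    · rw [← mul_assoc u₁, h1, mul_assoc (pos A.cox p), h7, ← mul_assoc v₁, ← h4,
        mul_assoc (pos A.cox q), ← mul_assoc, ← mul_assoc (pos A.cox [t]), ← pos_cons _ s p,
        ← pos_cons _ t q, hpq]
    · obtain ⟨z, hz, hz'⟩ := key x y h
      obtain ⟨z₁, z₂, hz₁, hz₂⟩ := key2 x y z hz hz'
      obtain ⟨z₃, h8⟩ := h8 z₁ z₂ (hz₁ ▸ hz₂)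
      refine ⟨z₃, ?_⟩
      rw [← mul_assoc u₁, h1, mul_assoc (pos A.cox p), mul_assoc, mul_assoc, ← h8, ← hz₁, hz]
    · have hstep : Steps012 A [(s, false), (t, true)] (up p ++ wordInv (up q)) :=
        OneStep.steps (Or.inr (Or.inr (Or.inl ⟨[], [], [(t, true)], up q, [(s, true)], up p,
          hrel.symm, by simp, by simp, rfl, by simp⟩)))
      have a1 := hstep.trans ((pw_steps A rfl).append (pw_steps A rfl).inv)
      have a2 := a1.context (wordInv (pw A u₁)) (pw A v₁)
      have a3 := h3.append h6
      have a4 := h9.context (pw A p₁) (wordInv (pw A q₁))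
      have a5 := (mul_pw A p₁ v₃).append (mul_pw A q₁ u₃).inv
      simp only [append_assoc, wordInv_append] at a2 a3 a4 a5 ⊢
      exact (a2.trans a3).trans (a4.trans a5)

end

section

open CoxeterSystem (alternatingWord braidWord)

/-! ### Artin monoids with common multiples -/

/-- Any two elements of the Artin monoid have a common right multiple. -/
def HasCommonMultiples (A : ArtinData S) : Prop :=
  ∀ b c : BraidMonoid A.cox, ∃ b' c', b * c' = c * b'

/-- Two elements of the Artin monoid have no common left factor. -/
def LeftCoprime (A : ArtinData S) (p q : BraidMonoid A.cox) : Prop :=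
  ∀ s, pos A.cox [s] ∣ p → ¬ pos A.cox [s] ∣ q

variable {A : ArtinData S}

theorem LeftCoprime.eq_one {d p q : BraidMonoid A.cox} (h : LeftCoprime A (d * p) (d * q)) :
    d = 1 := by
  by_contra hd
  obtain ⟨s, hs⟩ := exists_atom_dvd A.cox hd
  exact h s (hs.mul_right _) (hs.mul_right _)

theorem exists_right_atom {b : BraidMonoid A.cox} (h : b ≠ 1) : ∃ s z, b = z * pos A.cox [s] := by
  have h' : posRev A.cox b ≠ 1 := fun h1 => h (by
    have := congrArg (posRev A.cox) h1
    rwa [posRev_posRev, ← pos_nil, posRev_pos, reverse_nil, pos_nil] at this)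
  obtain ⟨s, z, hz⟩ := exists_atom_dvd A.cox h'
  refine ⟨s, posRev A.cox z, ?_⟩
  have := congrArg (posRev A.cox) hz
  rwa [posRev_posRev, posRev_mul, posRev_pos, reverse_singleton] at this

namespace HasCommonMultiples

variable (hO : HasCommonMultiples A)
include hO

theorem exists_right_lcm (u v : BraidMonoid A.cox) : ∃ u' v', u * v' = v * u' ∧
    (∀ x y, u * x = v * y → ∃ z, x = v' * z ∧ y = u' * z) ∧
    Steps012 A (wordInv (pw A u) ++ pw A v) (pw A v' ++ wordInv (pw A u')) := by
  obtain ⟨y, x, h⟩ := hO u v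
  obtain ⟨u', v', h1, h2, h3⟩ := exists_lcm_aux A _ u v x y h le_rfl
  refine ⟨u', v', h1, fun x y h => ?_, h3⟩
  obtain ⟨z, hz⟩ := h2 x y h
  refine ⟨z, mul_left_cancel (a := u) (by rw [hz, mul_assoc]), mul_left_cancel (a := v) ?_⟩
  rw [← h, hz, h1, mul_assoc]

theorem exists_left_lcm (u v : BraidMonoid A.cox) : ∃ u' v', v' * u = u' * v ∧
    (∀ x y, x * u = y * v → ∃ z, x = z * v' ∧ y = z * u') ∧
    Steps012 A (pw A u ++ wordInv (pw A v)) (wordInv (pw A v') ++ pw A u') := by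
  obtain ⟨v', u', h1, h2, h3⟩ := hO.exists_right_lcm (posRev A.cox v) (posRev A.cox u)
  refine ⟨posRev A.cox u', posRev A.cox v', ?_, fun x y h => ?_, ?_⟩
  · have := congrArg (posRev A.cox) h1
    simpa only [posRev_mul, posRev_posRev, eq_comm] using this
  · have := congrArg (posRev A.cox) h
    rw [posRev_mul, posRev_mul] at this
    obtain ⟨z, hz1, hz2⟩ := h2 _ _ this.symm
    refine ⟨posRev A.cox z, ?_, ?_⟩
    · have := congrArg (posRev A.cox) hz2
      simpa only [posRev_mul, posRev_posRev] using this
    · have := congrArg (posRev A.cox) hz1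
      simpa only [posRev_mul, posRev_posRev] using this
  · have := h3.reverse
    simp only [reverse_append, ← wordInv_reverse] at this
    have a1 := (pw_posRev A (posRev A.cox u)).1.append (pw_posRev A (posRev A.cox v)).1.inv
    have a2 := (pw_posRev A v').2.inv.append (pw_posRev A u').2
    simp only [posRev_posRev] at a1
    exact (a1.trans this).trans a2

theorem ev_injective : Function.Injective (ev A) := by
  have hL : ∀ b c : BraidMonoid A.cox, ∃ b' c', c' * b = b' * c := fun b c => by
    obtain ⟨u', v', h, -⟩ := hO.exists_left_lcm b c
    exact ⟨u', v', h⟩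
  choose num den hnd using hL
  let _ : OreLocalization.OreSet (⊤ : Submonoid (BraidMonoid A.cox)) :=
    { ore_right_cancel := fun r₁ r₂ s h => ⟨1, by rw [mul_right_cancel h]⟩
      oreNum := fun r s => num r s
      oreDenom := fun r s => ⟨den r s, trivial⟩
      ore_eq := fun r s => hnd r s }
  let F := OreLocalization.numeratorHom (S := (⊤ : Submonoid (BraidMonoid A.cox)))
  have hF : Function.Injective F := by
    intro a b h
    rw [OreLocalization.numeratorHom_apply, OreLocalization.numeratorHom_apply,
      OreLocalization.oreDiv_eq_iff] at h
    obtain ⟨u, v, h1, h2⟩ := h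
    simp only [OneMemClass.coe_one, mul_one, Submonoid.smul_def, smul_eq_mul] at h1 h2
    rw [h2] at h1
    exact (mul_left_cancel h1).symm
  have hu : ∀ b, IsUnit (F b) := fun b => OreLocalization.numerator_isUnit (⟨b, Submonoid.mem_top b⟩ : (⊤ : Submonoid _))
  let f : S → (OreLocalization (⊤ : Submonoid (BraidMonoid A.cox)) (BraidMonoid A.cox))ˣ :=
    fun s => (hu (pos A.cox [s])).unit
  have hf : ∀ ω : List S, ((FreeGroup.lift f (FreeGroup.mk (up ω)) :
      (OreLocalization (⊤ : Submonoid (BraidMonoid A.cox)) (BraidMonoid A.cox))ˣ) :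
      OreLocalization (⊤ : Submonoid (BraidMonoid A.cox)) (BraidMonoid A.cox)) =
      F (pos A.cox ω) := by
    intro ω
    induction ω with
    | nil => simp [up, ← FreeGroup.one_eq_mk]
    | cons s ω ih =>
      have : FreeGroup.mk (up (s :: ω)) = FreeGroup.of s * FreeGroup.mk (up ω) := by
        rw [FreeGroup.of, FreeGroup.mul_mk]; rfl
      rw [this, map_mul, Units.val_mul, ih, FreeGroup.lift_apply_of, pos_cons, map_mul]
      rfl
  have hrel : ∀ r ∈ rels A, FreeGroup.lift f r = 1 := by
    rintro r ⟨u, v, ⟨s, t, k, hst, hk, rfl, rfl⟩, rfl⟩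
    rw [map_mul, map_inv, mul_inv_eq_one]
    have hc : A.cox s t = k := by rw [A.cox_apply hst, hk]; rfl
    have h1 := hf (braidWord A.cox s t)
    have h2 := hf (braidWord A.cox t s)
    rw [pos_braidWord] at h1
    have h3 := Units.ext (h1.trans h2.symm)
    simp only [braidWord, up_alternatingWord, A.cox.symmetric t s, hc] at h3
    split_ifs at h3
    exacts [h3, h3.symm]
  intro a b h
  have key : ∀ b, (PresentedGroup.toGroup hrel (ev A b) :
      (OreLocalization (⊤ : Submonoid (BraidMonoid A.cox)) (BraidMonoid A.cox))ˣ) =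
      F b := by
    intro b
    obtain ⟨ω, rfl⟩ := pos_surjective A.cox b
    rw [← hf, ev_pos]
    rfl
  apply hF
  rw [← key, ← key, h]

theorem frac_unique {p q r n : BraidMonoid A.cox} (h : LeftCoprime A p q)
    (e : (ev A p)⁻¹ * ev A q = (ev A r)⁻¹ * ev A n) : ∃ t, r = t * p ∧ n = t * q := by
  obtain ⟨u', v', h1, -⟩ := hO.exists_left_lcm p r
  have h2 : v' * q = u' * n := by
    apply hO.ev_injective
    rw [map_mul, map_mul]
    have := congrArg (ev A) h1
    rw [map_mul, map_mul] at this
    have h3 : ev A v' = ev A u' * ev A r * (ev A p)⁻¹ := by rw [← this]; group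
    have h4 : ev A q = ev A p * ((ev A r)⁻¹ * ev A n) := by rw [← e]; group
    rw [h3, h4]; group
  obtain ⟨a, b, -, h4, -⟩ := hO.exists_right_lcm v' u'
  obtain ⟨z₁, rfl, rfl⟩ := h4 _ _ h1
  obtain ⟨z₂, rfl, rfl⟩ := h4 _ _ h2
  have := h.eq_one
  subst this
  exact ⟨a, by simp, by simp⟩

theorem steps_right_frac (w : Word S) : ∃ a b, Steps012 A w (pw A a ++ wordInv (pw A b)) := by
  induction w with
  | nil => exact ⟨1, 1, by simpa using .refl _ _⟩
  | cons l w ih =>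
    obtain ⟨a, b, h⟩ := ih
    obtain ⟨s, e⟩ := l
    cases e with
    | true =>
      refine ⟨pos A.cox [s] * a, b, ?_⟩
      have h1 := (pw_steps A (ω := [s]) rfl).append (.refl A (pw A a))
      have h2 := (h1.trans (mul_pw A _ _)).context [] (wordInv (pw A b))
      exact (h.context [(s, true)] []).trans (by simpa using h2) |> fun h => by simpa using h
    | false =>
      obtain ⟨u', v', -, -, h3⟩ := hO.exists_right_lcm (pos A.cox [s]) a
      refine ⟨v', b * u', ?_⟩
      have h1 := (pw_steps A (ω := [s]) rfl).inv.append (.refl A (pw A a))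
      have h2 := (h1.trans h3).context [] (wordInv (pw A b))
      have h4 := (mul_pw A b u').inv.context (pw A v') []
      have h5 := h.context [(s, false)] []
      simp only [nil_append, append_nil, cons_append, append_assoc, wordInv_append, up_cons,
        up_nil, wordInv_singleton, Bool.not_true] at h2 h4 h5
      exact h5.trans (h2.trans h4)

omit hO in
theorem steps_coprime (n : ℕ) (p q : BraidMonoid A.cox) (hn : posLen A.cox p ≤ n) :
    ∃ p' q', LeftCoprime A p' q' ∧
      Steps012 A (wordInv (pw A p) ++ pw A q) (wordInv (pw A p') ++ pw A q') := by
  induction n generalizing p q with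
  | zero =>
    have : p = 1 := by rw [← posLen_eq_zero]; omega
    subst this
    refine ⟨1, q, ?_, .refl _ _⟩
    rintro s ⟨z, hz⟩ -
    have := congrArg (posLen A.cox) hz
    rw [posLen_mul, posLen_pos, (posLen_eq_zero A.cox).2 rfl] at this
    simp only [length_singleton] at this
    omega
  | succ n ih =>
    by_cases h : LeftCoprime A p q
    · exact ⟨p, q, h, .refl _ _⟩
    simp only [LeftCoprime, not_forall, not_not] at h
    obtain ⟨s, ⟨p, rfl⟩, ⟨q, rfl⟩⟩ := h
    obtain ⟨p', q', h1, h2⟩ := ih p q (by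
      simp only [posLen_mul, posLen_pos, length_singleton] at hn; omega)
    refine ⟨p', q', h1, Steps012.trans ?_ h2⟩
    have h3 := (pw_mul A (pos A.cox [s]) p).inv.append (pw_mul A (pos A.cox [s]) q)
    have h4 := (steps_wordInv_mul A (pw A (pos A.cox [s]))).context (wordInv (pw A p)) (pw A q)
    simp only [wordInv_append, append_assoc, nil_append] at h3 h4
    exact h3.trans h4

theorem steps_left_frac (a b : BraidMonoid A.cox) : ∃ p q, LeftCoprime A p q ∧
    Steps012 A (pw A a ++ wordInv (pw A b)) (wordInv (pw A p) ++ pw A q) := by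
  obtain ⟨u', v', -, -, h⟩ := hO.exists_left_lcm a b
  obtain ⟨p, q, h1, h2⟩ := steps_coprime _ v' u' le_rfl
  exact ⟨p, q, h1, h.trans h2⟩

theorem exists_nf : ∃ nf : ArtinGroup A → Word S, ∀ w, Steps012 A w (nf (wbar A w)) := by
  have key : ∀ w, ∃ p q, LeftCoprime A p q ∧ Steps012 A w (wordInv (pw A p) ++ pw A q) := by
    intro w
    obtain ⟨a, b, h⟩ := hO.steps_right_frac w
    obtain ⟨p, q, h1, h2⟩ := hO.steps_left_frac a b
    exact ⟨p, q, h1, h.trans h2⟩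
  have key2 : ∀ g : ArtinGroup A, ∃ p q, LeftCoprime A p q ∧ g = (ev A p)⁻¹ * ev A q := by
    intro g
    obtain ⟨w, rfl⟩ := wbar_surjective A g
    obtain ⟨p, q, h, h'⟩ := key w
    exact ⟨p, q, h, by simpa using h'.wbar_eq⟩
  choose P Q h h' using key2
  refine ⟨fun g => wordInv (pw A (P g)) ++ pw A (Q g), fun w => ?_⟩
  obtain ⟨p, q, h1, h2⟩ := key w
  have h3 := h2.wbar_eq
  rw [wbar_append, wbar_wordInv, wbar_pw, wbar_pw] at h3
  have h4 := h' (wbar A w)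
  obtain ⟨t, rfl, rfl⟩ := hO.frac_unique (h (wbar A w)) (h4.symm.trans h3)
  have := h1.eq_one
  subst this
  simpa using h2

end HasCommonMultiples

end

section

open CoxeterSystem (alternatingWord braidWord)

/-! ### Parabolic submonoids and transversals -/

/-- The submonoid of the Artin monoid generated by a set of atoms. -/
def posParab (A : ArtinData S) (T : Set S) : Set (BraidMonoid A.cox) := {b | WordOver T (pw A b)}

variable {A : ArtinData S} {T : Set S}

theorem mul_mem_posParab {a b : BraidMonoid A.cox} :
    a * b ∈ posParab A T ↔ a ∈ posParab A T ∧ b ∈ posParab A T :=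
  ⟨fun h => wordOver_append.1 ((pw_mul A a b).wordOver h),
    fun h => (mul_pw A a b).wordOver (wordOver_append.2 h)⟩

theorem atom_mem_posParab {s : S} : pos A.cox [s] ∈ posParab A T ↔ s ∈ T := by
  have h : WordOver T (up [s]) ↔ s ∈ T := by simp [WordOver]
  exact ⟨fun h' => h.1 ((steps_pw A rfl).wordOver h'),
    fun h' => (pw_steps A rfl).wordOver (h.2 h')⟩

theorem exists_left_decomp (T : Set S) (n : ℕ) (b : BraidMonoid A.cox) (hn : posLen A.cox b ≤ n) :
    ∃ b₂ b₁, b = b₂ * b₁ ∧ b₂ ∈ posParab A T ∧ ∀ s ∈ T, ¬ pos A.cox [s] ∣ b₁ := by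
  induction n generalizing b with
  | zero =>
    have : b = 1 := by rw [← posLen_eq_zero]; omega
    subst this
    refine ⟨1, 1, by simp, by simp [posParab, WordOver], ?_⟩
    rintro s - ⟨z, hz⟩
    have := congrArg (posLen A.cox) hz
    rw [posLen_mul, posLen_pos, (posLen_eq_zero A.cox).2 rfl] at this
    simp only [length_singleton] at this
    omega
  | succ n ih =>
    by_cases h : ∀ s ∈ T, ¬ pos A.cox [s] ∣ b
    · exact ⟨1, b, by simp, by simp [posParab, WordOver], h⟩
    push Not at h
    obtain ⟨s, hs, c, rfl⟩ := h
    obtain ⟨b₂, b₁, rfl, h2, h3⟩ := ih c (by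
      simp only [posLen_mul, posLen_pos, length_singleton] at hn ⊢; omega)
    exact ⟨pos A.cox [s] * b₂, b₁, by rw [mul_assoc],
      mul_mem_posParab.2 ⟨atom_mem_posParab.2 hs, h2⟩, h3⟩

theorem exists_right_decomp (T : Set S) (b : BraidMonoid A.cox) :
    ∃ b₁ b₂, b = b₁ * b₂ ∧ b₂ ∈ posParab A T ∧ ∀ s ∈ T, ∀ z, b₁ ≠ z * pos A.cox [s] := by
  obtain ⟨b₂, b₁, h1, h2, h3⟩ := exists_left_decomp T _ (posRev A.cox b) le_rfl
  refine ⟨posRev A.cox b₁, posRev A.cox b₂, ?_, ?_, ?_⟩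
  · have := congrArg (posRev A.cox) h1
    rwa [posRev_posRev, posRev_mul] at this
  · refine (pw_posRev A b₂).2.wordOver fun l hl => h2 l (by simpa using hl)
  · intro s hs z hz
    refine h3 s hs ⟨posRev A.cox z, ?_⟩
    have := congrArg (posRev A.cox) hz
    rwa [posRev_posRev, posRev_mul, posRev_pos, reverse_singleton] at this

theorem mem_of_dvd_posParab {s : S} {b : BraidMonoid A.cox} (hb : b ∈ posParab A T)
    (h : pos A.cox [s] ∣ b) : s ∈ T := by
  obtain ⟨z, rfl⟩ := h
  exact atom_mem_posParab.1 (mul_mem_posParab.1 hb).1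

namespace HasCommonMultiples

variable (hO : HasCommonMultiples A)
include hO

theorem frac_mem_of_mul_mem {a b v m c : BraidMonoid A.cox}
    (hb : ∀ s ∈ T, ¬ pos A.cox [s] ∣ b) (hv : v ∈ posParab A T)
    (h : ev A c * (ev A a * (ev A b)⁻¹) * ev A v = ev A m) :
    ∃ m', ev A c * (ev A a * (ev A b)⁻¹) = ev A m' := by
  have hcop : LeftCoprime A v b := fun s hs hs' => hb s (mem_of_dvd_posParab hv hs) hs'
  obtain ⟨t, -, ht⟩ := hO.frac_unique hcop (r := m) (n := c * a) (by
    rw [← h, map_mul]; group)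
  refine ⟨t, ?_⟩
  have := congrArg (ev A) ht
  rw [map_mul, map_mul] at this
  rw [← mul_assoc, this]; group

theorem exists_transversal (T : Set S) : ∃ X : Set (ArtinGroup A),
    (∀ x ∈ X, ∀ y ∈ X, x⁻¹ * y ∈ parab A T → x = y) ∧
    ∀ w : Word S, ∃ v u : Word S, WordOver T u ∧ Steps012 A w (v ++ u) ∧ wbar A v ∈ X := by
  refine ⟨{g | ∃ p q, g = (ev A p)⁻¹ * ev A q ∧ (∀ u ∈ posParab A T, LeftCoprime A p (q * u)) ∧
    ∀ s ∈ T, ∀ z, q ≠ z * pos A.cox [s]}, ?_, fun w => ?_⟩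
  · rintro _ ⟨p, q, rfl, h1, h2⟩ _ ⟨p', q', rfl, h1', h2'⟩ hxy
    obtain ⟨w, hw, hw'⟩ := mem_parab_iff.1 hxy
    obtain ⟨a, b, hab⟩ := hO.steps_right_frac w
    obtain ⟨ha, hb⟩ := wordOver_append.1 (hab.wordOver hw)
    replace hb : b ∈ posParab A T := by
      have := hb.inv
      rwa [wordInv_wordInv] at this
    replace hab := hab.wbar_eq
    rw [hw', wbar_append, wbar_wordInv, wbar_pw, wbar_pw] at hab
    have e : (ev A p)⁻¹ * ev A (q * a) = (ev A p')⁻¹ * ev A (q' * b) := by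
      have : (ev A p')⁻¹ * ev A q' = (ev A p)⁻¹ * ev A q * (ev A a * (ev A b)⁻¹) := by
        rw [← hab]; group
      rw [map_mul, map_mul, ← mul_assoc _ (ev A q') , this]; group
    obtain ⟨t, rfl, h3⟩ := hO.frac_unique (h1 a ha) e
    have h4 := h1' b hb
    rw [h3] at h4
    have := h4.eq_one
    subst this
    rw [one_mul] at h3 ⊢
    obtain ⟨u', v', h5, h6, h7⟩ := hO.exists_left_lcm a b
    obtain ⟨z, rfl, rfl⟩ := h6 q q' h3.symm
    obtain ⟨h8, h9⟩ := wordOver_append.1 (h7.wordOver (WordOver.append ha hb.inv))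
    have key : ∀ c : BraidMonoid A.cox, c ∈ posParab A T →
        (∀ s ∈ T, ∀ z', z * c ≠ z' * pos A.cox [s]) → c = 1 := by
      intro c hc h
      by_contra hc1
      obtain ⟨s, z', rfl⟩ := exists_right_atom hc1
      exact h s (atom_mem_posParab.1 (mul_mem_posParab.1 hc).2) (z * z') (by rw [mul_assoc])
    have h10 := h8.inv
    rw [wordInv_wordInv] at h10
    rw [key v' h10 h2, key u' h9 h2']
  · obtain ⟨a, b, h⟩ := hO.steps_right_frac w
    obtain ⟨b₂, b₁, rfl, hb₂, hb₁⟩ := exists_left_decomp T _ b le_rfl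
    obtain ⟨p, q, hpq, h'⟩ := hO.steps_left_frac a b₁
    obtain ⟨q₁, q₂, rfl, hq₂, hq₁⟩ := exists_right_decomp T q
    refine ⟨wordInv (pw A p) ++ pw A q₁, pw A q₂ ++ wordInv (pw A b₂), hq₂.append hb₂.inv, ?_,
      p, q₁, by simp, ?_, hq₁⟩
    · have h1 := (pw_mul A b₂ b₁).inv.context (pw A a) []
      have h2 := h'.context [] (wordInv (pw A b₂))
      have h3 := (pw_mul A q₁ q₂).context (wordInv (pw A p)) (wordInv (pw A b₂))
      simp only [wordInv_append, append_nil, nil_append, append_assoc] at h1 h2 h3 ⊢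
      exact h.trans (h1.trans (h2.trans h3))
    · rintro u hu s ⟨p', rfl⟩ ⟨r, hr⟩
      obtain ⟨u', v', h4, -, h5⟩ := hO.exists_right_lcm q₂ u
      obtain ⟨h6, h7⟩ := wordOver_append.1 (h5.wordOver (WordOver.append (WordOver.inv hq₂) hu))
      have hx := h'.wbar_eq
      simp only [wbar_append, wbar_wordInv, wbar_pw, map_mul] at hx
      obtain ⟨m', hm'⟩ := hO.frac_mem_of_mul_mem hb₁ (c := p') (a := a) (v := v') h6
        (m := r * u') (by
          have h8 := congrArg (ev A) hr
          have h9 := congrArg (ev A) h4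
          simp only [map_mul] at h8 h9 ⊢
          have h10 : ev A v' = (ev A q₂)⁻¹ * (ev A u * ev A u') := by rw [← h9]; group
          have h11 : ev A r = (ev A (pos A.cox [s]))⁻¹ * (ev A q₁ * ev A u) := by rw [h8]; group
          rw [hx, h10, h11]; group)
      obtain ⟨t, ht, -⟩ := hO.frac_unique hpq (r := p') (n := m') (by
        rw [← hm', map_mul, map_mul, hx]; group)
      have := congrArg (posLen A.cox) ht
      simp only [posLen_mul, posLen_pos, length_singleton] at this
      omega

theorem reducible : Reducible A := ⟨hO.exists_nf, hO.exists_transversal⟩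

end HasCommonMultiples

/-! ### Spherical type -/

theorem reducible_of_finite (A : ArtinData S) [Finite A.cox.Group] : Reducible A := by
  let cs := A.cox.toCoxeterSystem
  obtain ⟨N, hN⟩ := (Set.finite_range cs.length).bddAbove
  exact HasCommonMultiples.reducible (exists_common_multiple cs N fun w => hN ⟨w, rfl⟩)

theorem prod_map_altWord {G : Type*} [Group G] (f : S → G) (s t : S) (k : ℕ) :
    FreeGroup.lift f (FreeGroup.mk (altWord s t k)) =
      ((if Even k then alternatingWord s t k else alternatingWord t s k).map f).prod := by
  have key : ∀ ω : List S, FreeGroup.lift f (FreeGroup.mk (up ω)) = (ω.map f).prod := by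
    intro ω
    rw [FreeGroup.lift_mk]
    simp [up, Function.comp_def]
  rw [← key]
  congr 2
  by_cases h : Even k <;> simp [h, up_alternatingWord]

theorem finite_cox_of_sphericalType {A : ArtinData S} {T : Set S} (h : SphericalType A T) :
    Finite (A.restrict T).cox.Group := by
  let cs := (A.restrict T).cox.toCoxeterSystem
  have hrel : ∀ r ∈ coxRels A T, FreeGroup.lift cs.simple r = 1 := by
    rintro r (⟨u, v, ⟨s, t, k, hst, hk, rfl, rfl⟩, rfl⟩ | ⟨s, rfl⟩)
    · rw [map_mul, map_inv, mul_inv_eq_one]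
      have hc : (A.restrict T).cox s t = k := by rw [ArtinData.cox_apply _ hst, hk]; rfl
      have h1 := cs.wordProd_braidWord_eq s t
      simp only [braidWord, CoxeterMatrix.symmetric _ t s, hc, CoxeterSystem.wordProd] at h1
      rw [prod_map_altWord, prod_map_altWord]
      split_ifs
      exacts [h1, h1.symm]
    · simp
  have : Finite (PresentedGroup (coxRels A T)) := h
  refine Finite.of_surjective (PresentedGroup.toGroup hrel) fun w => ?_
  obtain ⟨ω, rfl⟩ := cs.wordProd_surjective w
  refine ⟨PresentedGroup.mk _ (FreeGroup.mk (up ω)), ?_⟩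
  change FreeGroup.lift cs.simple (FreeGroup.mk (up ω)) = _
  rw [FreeGroup.lift_mk]
  simp [up, Function.comp_def, CoxeterSystem.wordProd]

/-! ### Change of generators -/

/-- Renaming the letters of a word. -/
def mapW {S' : Type*} (f : S' → S) (w : Word S') : Word S := w.map fun l => (f l.1, l.2)

section MapW

variable {S' : Type*} (f : S' → S)

@[simp] theorem mapW_nil : mapW f [] = [] := rfl

@[simp] theorem mapW_append (u v : Word S') : mapW f (u ++ v) = mapW f u ++ mapW f v := by
  simp [mapW]

@[simp] theorem mapW_cons (l : S' × Bool) (v : Word S') :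
    mapW f (l :: v) = (f l.1, l.2) :: mapW f v := rfl

@[simp] theorem mapW_wordInv (u : Word S') : mapW f (wordInv u) = wordInv (mapW f u) := by
  simp [mapW, wordInv]

@[simp] theorem mapW_eq_nil {u : Word S'} : mapW f u = [] ↔ u = [] := by simp [mapW]

@[simp] theorem mapW_altWord (s t : S') (k : ℕ) :
    mapW f (altWord s t k) = altWord (f s) (f t) k := by
  induction k generalizing s t with
  | zero => rfl
  | succ k ih => simp [altWord, ih]

theorem WordOver.mapW {f : S' → S} {T : Set S'} {w : Word S'} (h : WordOver T w) :
    WordOver (f '' T) (mapW f w) := by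
  intro l hl
  obtain ⟨l', h', rfl⟩ := List.mem_map.1 hl
  exact ⟨_, h _ h', rfl⟩

variable {f} {A' : ArtinData S'} {A : ArtinData S}

theorem IsRel.mapW (hf : Function.Injective f) (hm : ∀ a b, A.m (f a) (f b) = A'.m a b)
    {u v : Word S'} (h : IsRel A' u v) : IsRel A (mapW f u) (mapW f v) := by
  obtain ⟨s, t, k, hst, hk, rfl, rfl⟩ := h
  exact ⟨f s, f t, k, hf.ne hst, by rw [hm, hk], by simp, by simp⟩

theorem Steps012.mapW (hf : Function.Injective f) (hm : ∀ a b, A.m (f a) (f b) = A'.m a b)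
    {u v : Word S'} (h : Steps012 A' u v) : Steps012 A (mapW f u) (mapW f v) := by
  refine h.induct (p := fun u v => Steps012 A (ArtinTits.mapW f u) (ArtinTits.mapW f v))
    (fun _ => .refl _ _) (fun _ _ _ h h' => h.trans h') fun u v h => OneStep.steps ?_
  rcases h with ⟨w₁, w₂, s, b, rfl, rfl⟩ | ⟨w₁, w₂, u, v, h, h'⟩ | h | h
  · exact Or.inl ⟨ArtinTits.mapW f w₁, ArtinTits.mapW f w₂, f s, b, by simp, by simp⟩
  · refine Or.inr (Or.inl ⟨ArtinTits.mapW f w₁, ArtinTits.mapW f w₂, _, _, h.mapW hf hm, ?_⟩)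
    rcases h' with ⟨rfl, rfl⟩ | ⟨rfl, rfl⟩
    · left; simp
    · right; simp
  · obtain ⟨w₁, w₂, u₁, u₂, v₁, v₂, h, h1, h2, rfl, rfl⟩ := h
    have := h.mapW hf hm
    simp only [mapW_append] at this
    exact Or.inr (Or.inr (Or.inl ⟨ArtinTits.mapW f w₁, ArtinTits.mapW f w₂, _, _, _, _, this,
      by simpa, by simpa, by simp only [mapW_append, mapW_wordInv],
      by simp only [mapW_append, mapW_wordInv]⟩))
  · obtain ⟨w₁, w₂, u₁, u₂, v₁, v₂, h, h1, h2, rfl, rfl⟩ := h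
    have := h.mapW hf hm
    simp only [mapW_append] at this
    exact Or.inr (Or.inr (Or.inr ⟨ArtinTits.mapW f w₁, ArtinTits.mapW f w₂, _, _, _, _, this,
      by simpa, by simpa, by simp only [mapW_append, mapW_wordInv],
      by simp only [mapW_append, mapW_wordInv]⟩))

end MapW

/-- The group homomorphism determined by images of the generators satisfying the braid
relations. -/
theorem exists_artinLift (A : ArtinData S) {G : Type*} [Group G] (F : Word S → G) (hnil : F [] = 1)
    (happ : ∀ u v, F (u ++ v) = F u * F v) (hinv : ∀ s, F [(s, false)] = (F [(s, true)])⁻¹)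
    (hrel : ∀ u v, IsRel A u v → F u = F v) :
    ∃ φ : ArtinGroup A →* G, ∀ w, φ (wbar A w) = F w := by
  let f : S → G := fun s => F [(s, true)]
  have hf : ∀ w : Word S, FreeGroup.lift f (FreeGroup.mk w) = F w := by
    intro w
    induction w with
    | nil => simp [hnil, ← FreeGroup.one_eq_mk]
    | cons l w ih =>
      have h1 : FreeGroup.mk (l :: w) = FreeGroup.mk [l] * FreeGroup.mk w := by
        rw [FreeGroup.mul_mk]; rfl
      have h2 : F (l :: w) = F [l] * F w := happ [l] w
      rw [h1, map_mul, ih, h2]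
      obtain ⟨s, _ | _⟩ := l <;> simp [f, hinv]
  refine ⟨PresentedGroup.toGroup (f := f) ?_, fun w => hf w⟩
  rintro r ⟨u, v, h, rfl⟩
  rw [map_mul, map_inv, mul_inv_eq_one, hf, hf, hrel u v h]

theorem exists_mapHom {S' : Type*} {f : S' → S} {A' : ArtinData S'} {A : ArtinData S}
    (hf : Function.Injective f) (hm : ∀ a b, A.m (f a) (f b) = A'.m a b) :
    ∃ φ : ArtinGroup A' →* ArtinGroup A, ∀ w, φ (wbar A' w) = wbar A (mapW f w) :=
  exists_artinLift A' (fun w => wbar A (mapW f w)) (by simp) (by simp)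
    (fun s => by simpa using wbar_wordInv A [(f s, true)])
    (fun u v h => (h.mapW hf hm).wbar_eq)

end

section

open CoxeterSystem (alternatingWord braidWord)

/-! ### Powers of a letter -/

/-- The reduced word representing a power of a generator. -/
def powW (a : S) : ℤ → Word S
  | Int.ofNat n => replicate n (a, true)
  | Int.negSucc n => replicate (n + 1) (a, false)

@[simp] theorem powW_zero (a : S) : powW a 0 = [] := rfl

theorem powW_natCast (a : S) (n : ℕ) : powW a n = replicate n (a, true) := rfl

@[simp] theorem powW_one (a : S) : powW a 1 = [(a, true)] := rfl

@[simp] theorem powW_neg_one (a : S) : powW a (-1) = [(a, false)] := rfl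

theorem wordInv_replicate (n : ℕ) (l : S × Bool) :
    wordInv (replicate n l) = replicate n (l.1, !l.2) := by
  simp [wordInv]

@[simp] theorem wordInv_powW (a : S) (n : ℤ) : wordInv (powW a n) = powW a (-n) := by
  cases n with
  | ofNat n =>
    cases n with
    | zero => rfl
    | succ n => exact wordInv_replicate _ _
  | negSucc n => exact wordInv_replicate _ _

@[simp] theorem reverse_powW (a : S) (n : ℤ) : (powW a n).reverse = powW a n := by
  cases n <;> simp [powW]

@[simp] theorem mapW_powW {S' : Type*} (f : S' → S) (a : S') (n : ℤ) :
    mapW f (powW a n) = powW (f a) n := by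
  cases n <;> simp [powW, mapW]

theorem wordOver_powW {T : Set S} {a : S} (h : a ∈ T) (n : ℤ) : WordOver T (powW a n) := by
  intro l hl
  cases n <;> · rw [(List.mem_replicate.1 hl).2]; exact h

theorem steps_replicate (A : ArtinData S) (s : S) (b : Bool) (m n : ℕ) :
    Steps012 A (replicate (m + n) (s, b) ++ replicate n (s, !b)) (replicate m (s, b)) := by
  induction n with
  | zero => simpa using .refl _ _
  | succ n ih =>
    refine Steps012.trans (OneStep.steps (Or.inl ⟨replicate (m + n) (s, b),
      replicate n (s, !b), s, b, ?_, rfl⟩)) ih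
    rw [← add_assoc, replicate_succ', replicate_succ]
    simp

theorem steps_powW_add (A : ArtinData S) (a : S) (m n : ℤ) :
    Steps012 A (powW a m ++ powW a n) (powW a (m + n)) := by
  rcases Int.eq_nat_or_neg m with ⟨m, rfl | rfl⟩ <;> rcases Int.eq_nat_or_neg n with ⟨n, rfl | rfl⟩
  · rw [← Nat.cast_add, powW_natCast, powW_natCast, powW_natCast, replicate_add]
    exact .refl _ _
  · rw [← wordInv_powW, powW_natCast, powW_natCast, wordInv_replicate]
    rcases le_total n m with h | h
    · obtain ⟨k, rfl⟩ := Nat.exists_eq_add_of_le' h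
      have : ((k + n : ℕ) : ℤ) + -n = k := by push_cast; ring
      rw [this]
      exact steps_replicate A a true k n
    · obtain ⟨k, rfl⟩ := Nat.exists_eq_add_of_le' h
      have : (m : ℤ) + -((k + m : ℕ) : ℤ) = -k := by push_cast; ring
      rw [this, ← wordInv_powW, powW_natCast, wordInv_replicate]
      have := (steps_replicate A a false k m).reverse
      simpa using this
  · rw [← wordInv_powW, powW_natCast, powW_natCast, wordInv_replicate]
    rcases le_total n m with h | h
    · obtain ⟨k, rfl⟩ := Nat.exists_eq_add_of_le' h
      have : -((k + n : ℕ) : ℤ) + n = -k := by push_cast; ring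
      rw [this, ← wordInv_powW, powW_natCast, wordInv_replicate]
      exact steps_replicate A a false k n
    · obtain ⟨k, rfl⟩ := Nat.exists_eq_add_of_le' h
      have : -(m : ℤ) + ((k + m : ℕ) : ℤ) = k := by push_cast; ring
      rw [this, powW_natCast]
      have := (steps_replicate A a true k m).reverse
      simpa using this
  · rw [← neg_add, ← Nat.cast_add, ← wordInv_powW, ← wordInv_powW, ← wordInv_powW,
      powW_natCast, powW_natCast, powW_natCast, ← wordInv_append, ← replicate_add, add_comm]
    exact .refl _ _

/-- A generator of the Artin-Tits group. -/
def gen (A : ArtinData S) (a : S) : ArtinGroup A := wbar A [(a, true)]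

@[simp] theorem wbar_powW (A : ArtinData S) (a : S) (n : ℤ) : wbar A (powW a n) = gen A a ^ n := by
  have h : ∀ n : ℕ, wbar A (powW a n) = gen A a ^ n := by
    intro n
    induction n with
    | zero => simp
    | succ n ih => rw [powW_natCast, replicate_succ', wbar_append, ← powW_natCast, ih, pow_succ, gen]
  rcases Int.eq_nat_or_neg n with ⟨n, rfl | rfl⟩
  · simp [h]
  · rw [← wordInv_powW, wbar_wordInv, h]; simp

theorem steps_powW_of_wordOver (A : ArtinData S) {a : S} {w : Word S} (h : WordOver {a} w) :
    ∃ n, Steps012 A w (powW a n) := by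
  induction w with
  | nil => exact ⟨0, .refl _ _⟩
  | cons l w ih =>
    obtain ⟨n, hn⟩ := ih fun l hl => h l (by simp [hl])
    have hl : l.1 = a := h l (by simp)
    obtain ⟨s, b⟩ := l
    obtain rfl : s = a := hl
    have h1 := hn.context [(s, b)] []
    simp only [append_nil] at h1
    cases b with
    | true =>
      have h2 := steps_powW_add A s 1 n
      rw [powW_one] at h2
      exact ⟨1 + n, h1.trans h2⟩
    | false =>
      have h2 := steps_powW_add A s (-1) n
      rw [powW_neg_one] at h2
      exact ⟨-1 + n, h1.trans h2⟩

theorem mem_parab_singleton {A : ArtinData S} {a : S} {g : ArtinGroup A} :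
    g ∈ parab A {a} ↔ ∃ n : ℤ, g = gen A a ^ n := by
  rw [mem_parab_iff]
  constructor
  · rintro ⟨w, hw, rfl⟩
    obtain ⟨n, hn⟩ := steps_powW_of_wordOver A hw
    exact ⟨n, by rw [hn.wbar_eq, wbar_powW]⟩
  · rintro ⟨n, rfl⟩
    exact ⟨powW a n, wordOver_powW (Set.mem_singleton a) n, by simp⟩

theorem wbar_reverse_eq (A : ArtinData S) {u v : Word S} (h : wbar A u = wbar A v) :
    wbar A u.reverse = wbar A v.reverse := by
  obtain ⟨φ, hφ⟩ := exists_artinLift A (fun w => MulOpposite.op (wbar A w.reverse)) (by simp)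
    (by simp) (fun s => by
      rw [← MulOpposite.op_inv]
      exact congrArg MulOpposite.op (wbar_wordInv A [(s, true)]))
    (fun u v h => congrArg MulOpposite.op h.reverse.wbar_eq)
  have := congrArg φ h
  rw [hφ, hφ] at this
  exact MulOpposite.op_injective this

end

section

open CoxeterSystem (alternatingWord braidWord)

/-! ### Dihedral type -/

/-- The presentation has two generators `a` and `b`, with a finite label at least `3`. -/
structure Dihedral (A : ArtinData S) (a b : S) : Prop where
  ne : a ≠ b
  cover : ∀ x, x = a ∨ x = b
  label : ∃ k : ℕ, 3 ≤ k ∧ A.m a b = k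

/-- In the monoid, powers of a generator. -/
noncomputable def atomPow (A : ArtinData S) (a : S) (n : ℕ) : BraidMonoid A.cox := pos A.cox (replicate n a)

theorem up_replicate (a : S) (n : ℕ) : up (replicate n a) = powW a n := by
  rw [powW_natCast]; simp [up]

section

variable {A : ArtinData S}

theorem atomPow_succ (a : S) (n : ℕ) :
    atomPow A a (n + 1) = pos A.cox [a] * atomPow A a n := by
  rw [atomPow, replicate_succ, ← singleton_append, pos_append]; rfl

@[simp] theorem atomPow_zero (a : S) : atomPow A a 0 = 1 := pos_nil _

@[simp] theorem ev_atomPow (a : S) (n : ℕ) : ev A (atomPow A a n) = gen A a ^ n := by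
  rw [atomPow, ev_pos, up_replicate, wbar_powW, zpow_natCast]

theorem atomPow_mem (a : S) (n : ℕ) : atomPow A a n ∈ posParab A {a} := by
  induction n with
  | zero => rw [atomPow_zero]; intro l hl; simp at hl
  | succ n ih => rw [atomPow_succ]; exact mul_mem_posParab.2 ⟨atom_mem_posParab.2 rfl, ih⟩

theorem eq_of_dvd_atomPow {a s : S} {n : ℕ} (h : pos A.cox [s] ∣ atomPow A a n) : s = a := by
  simpa using mem_of_dvd_posParab (atomPow_mem a n) h

theorem pw_atomPow_steps (a : S) (n : ℕ) : Steps012 A (pw A (atomPow A a n)) (powW a n) := by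
  rw [← up_replicate]; exact steps_pw A rfl

theorem not_atom_dvd_one (s : S) : ¬ pos A.cox [s] ∣ (1 : BraidMonoid A.cox) := by
  rintro ⟨z, hz⟩
  have := congrArg (posLen A.cox) hz
  rw [posLen_mul, posLen_pos, (posLen_eq_zero A.cox).2 rfl] at this
  simp at this
  omega

theorem HasCommonMultiples.steps_of_coprime (hO : HasCommonMultiples A)
    {p q : BraidMonoid A.cox} (h : LeftCoprime A p q) {w : Word S}
    (hw : wbar A w = (ev A p)⁻¹ * ev A q) : Steps012 A w (wordInv (pw A p) ++ pw A q) := by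
  obtain ⟨a, b, h1⟩ := hO.steps_right_frac w
  obtain ⟨p', q', h', h2⟩ := hO.steps_left_frac a b
  have h3 := (h1.trans h2).wbar_eq
  rw [wbar_append, wbar_wordInv, wbar_pw, wbar_pw] at h3
  obtain ⟨t, rfl, rfl⟩ := hO.frac_unique h (hw.symm.trans h3)
  obtain rfl := h'.eq_one
  simpa using h1.trans h2

end

namespace Dihedral

variable {A : ArtinData S} {a b : S}

theorem symm (D : Dihedral A a b) : Dihedral A b a :=
  ⟨D.ne.symm, fun x => (D.cover x).symm, D.label.imp fun k h => ⟨h.1, by rw [A.symm, h.2]⟩⟩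

variable (D : Dihedral A a b)
include D

theorem three_le_cox : 3 ≤ A.cox a b := by
  obtain ⟨k, h, h'⟩ := D.label
  rw [A.cox_apply D.ne, h']
  exact h

theorem finite : Finite A.cox.Group := by
  let cs := A.cox.toCoxeterSystem
  let r := cs.simple a * cs.simple b
  have hr : IsOfFinOrder r := isOfFinOrder_iff_pow_eq_one.2
    ⟨A.cox a b, by have := D.three_le_cox; omega, cs.simple_mul_simple_pow a b⟩
  have hfin : (Subgroup.zpowers r : Set A.cox.Group).Finite := hr.finite_zpowers
  have ha : cs.simple a * cs.simple a = 1 := cs.simple_mul_simple_self a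
  have hb : cs.simple b * cs.simple b = 1 := cs.simple_mul_simple_self b
  have key : ∀ w, (∃ i : ℤ, w = r ^ i) ∨ ∃ i : ℤ, w = r ^ i * cs.simple a := by
    intro w
    refine cs.simple_induction_right (p := fun w => (∃ i : ℤ, w = r ^ i) ∨
      ∃ i : ℤ, w = r ^ i * cs.simple a) w (Or.inl ⟨0, by simp⟩) ?_
    intro w x h
    have h1 : cs.simple b = r⁻¹ * cs.simple a := by
      simp [r, mul_assoc]
    rcases D.cover x with rfl | rfl <;> rcases h with ⟨i, rfl⟩ | ⟨i, rfl⟩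
    · exact Or.inr ⟨i, rfl⟩
    · exact Or.inl ⟨i, by rw [mul_assoc, ha, mul_one]⟩
    · exact Or.inr ⟨i - 1, by rw [h1, zpow_sub_one, mul_assoc]⟩
    · exact Or.inl ⟨i + 1, by rw [mul_assoc, zpow_add_one]⟩
  refine Set.finite_univ_iff.1 ((hfin.union (hfin.image (· * cs.simple a))).subset ?_)
  rintro w -
  rcases key w with ⟨i, rfl⟩ | ⟨i, rfl⟩
  · exact Or.inl ⟨i, rfl⟩
  · exact Or.inr ⟨_, ⟨i, rfl⟩, rfl⟩

theorem hasCommonMultiples : HasCommonMultiples A := by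
  have := D.finite
  let cs := A.cox.toCoxeterSystem
  obtain ⟨N, hN⟩ := (Set.finite_range cs.length).bddAbove
  exact exists_common_multiple cs N fun w => hN ⟨w, rfl⟩

theorem reducible : Reducible A := D.hasCommonMultiples.reducible

theorem braid_eq : ∃ z, pos A.cox (braidWord A.cox a b) =
    pos A.cox [b] * (pos A.cox [a] * (pos A.cox [b] * z)) := by
  have h3 := D.three_le_cox
  obtain ⟨n, hn⟩ : ∃ n, A.cox a b = n + 1 + 1 + 1 := ⟨A.cox a b - 3, by omega⟩
  by_cases h : Even n
  · rw [braidWord, hn]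
    refine ⟨pos A.cox (alternatingWord a b n), ?_⟩
    rw [← pos_append, ← pos_append, ← pos_append]
    simp [CoxeterSystem.alternatingWord_succ', h, Nat.even_add_one]
  · rw [pos_braidWord, braidWord, A.cox.symmetric b a, hn]
    refine ⟨pos A.cox (alternatingWord b a n), ?_⟩
    rw [← pos_append, ← pos_append, ← pos_append]
    simp [CoxeterSystem.alternatingWord_succ', h, Nat.even_add_one]

theorem not_dvd (k i : ℕ) : ¬ pos A.cox [a] ∣ atomPow A b (k + 1) * atomPow A a i := by
  have step : ∀ z, pos A.cox [a] ∣ pos A.cox [b] * z → ∃ z', z = pos A.cox [a] * z' ∧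
      pos A.cox [b] ∣ z' := by
    intro z hz
    obtain ⟨-, y, hy⟩ := braidWord_dvd A.cox.toCoxeterSystem D.ne hz (dvd_mul_right _ z)
    obtain ⟨x, hx⟩ := D.braid_eq
    rw [hx, mul_assoc, mul_assoc, mul_assoc] at hy
    exact ⟨_, mul_left_cancel hy, dvd_mul_right _ _⟩
  induction k with
  | zero =>
    intro h
    rw [atomPow_succ, atomPow_zero, mul_one] at h
    obtain ⟨z, hz, hz'⟩ := step _ h
    cases i with
    | zero => exact not_atom_dvd_one a ⟨z, hz⟩
    | succ i =>
      rw [atomPow_succ] at hz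
      rw [← mul_left_cancel hz] at hz'
      exact D.ne (eq_of_dvd_atomPow hz').symm
  | succ k ih =>
    intro h
    rw [atomPow_succ, mul_assoc] at h
    obtain ⟨z, hz, -⟩ := step _ h
    exact ih ⟨z, hz⟩

theorem steps_of_nonneg {j : ℤ} {k i : ℕ} {w : Word S}
    (hw : wbar A w = gen A a ^ j * gen A b ^ (k + 1) * gen A a ^ i) :
    Steps012 A w (powW a j ++ powW b (k + 1 : ℕ) ++ powW a i) := by
  rcases Int.eq_nat_or_neg j with ⟨j, rfl | rfl⟩
  · have h := D.hasCommonMultiples.steps_of_coprime (p := 1)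
      (q := atomPow A a j * atomPow A b (k + 1) * atomPow A a i) (w := w)
      (fun s h => (not_atom_dvd_one s h).elim) (by simpa using hw)
    rw [pw_one] at h
    refine h.trans (((pw_mul _ _ _).trans ((pw_mul _ _ _).append (.refl _ _))).trans ?_)
    exact ((pw_atomPow_steps _ _).append (pw_atomPow_steps _ _)).append (pw_atomPow_steps _ _)
  · have h := D.hasCommonMultiples.steps_of_coprime (p := atomPow A a j)
      (q := atomPow A b (k + 1) * atomPow A a i) (w := w)
      (fun s h h' => by
        obtain rfl := eq_of_dvd_atomPow h
        exact D.not_dvd k i h') (by simpa [mul_assoc] using hw)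
    refine h.trans ?_
    rw [append_assoc, ← wordInv_powW]
    exact (pw_atomPow_steps _ _).inv.append
      ((pw_mul _ _ _).trans ((pw_atomPow_steps _ _).append (pw_atomPow_steps _ _)))

theorem steps_of_neg {j k i : ℕ} {w : Word S}
    (hw : wbar A w = gen A a ^ j * (gen A b ^ (k + 1))⁻¹ * gen A a ^ i) :
    Steps012 A w (powW a j ++ powW b (-(k + 1 : ℕ)) ++ powW a i) := by
  have hO := D.hasCommonMultiples
  obtain ⟨p, q, hpq, hs⟩ := hO.steps_left_frac (atomPow A a j) (atomPow A b (k + 1))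
  have e := hs.wbar_eq
  simp only [wbar_append, wbar_wordInv, wbar_pw, ev_atomPow] at e
  have hcop : LeftCoprime A p (q * atomPow A a i) := by
    rintro s ⟨p', rfl⟩ ⟨m, hm⟩
    have hm' := congrArg (ev A) hm
    simp only [map_mul, ev_atomPow] at hm' e
    obtain ⟨m', h⟩ := hO.frac_mem_of_mul_mem (T := {a}) (a := atomPow A a j)
      (b := atomPow A b (k + 1)) (v := atomPow A a i) (m := m) (c := p') (by
        intro s hs h
        exact D.ne ((Set.mem_singleton_iff.1 hs).symm.trans (eq_of_dvd_atomPow h)))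
      (atomPow_mem a i) (by
        simp only [ev_atomPow]
        rw [e, mul_assoc, mul_assoc, hm']
        group)
    simp only [ev_atomPow] at h
    obtain ⟨t, ht, -⟩ := hO.frac_unique hpq (r := p') (n := m') (by
      rw [← h, ← mul_assoc, inv_mul_cancel, one_mul, e, map_mul])
    have := congrArg (posLen A.cox) ht
    simp at this
    omega
  have h1 := hO.steps_of_coprime hcop (w := w) (by
    rw [hw, e, map_mul, ev_atomPow]; group)
  have h2 : Steps012 A (wordInv (pw A p) ++ pw A q) (powW a j ++ powW b (-(k + 1 : ℕ))) := by
    have e2 := wbar_reverse_eq A (u := wordInv (pw A p) ++ pw A q)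
      (v := powW a j ++ powW b (-(k + 1 : ℕ))) (by
        rw [wbar_append, wbar_append, wbar_powW, wbar_powW, zpow_neg, zpow_natCast, zpow_natCast,
          e, wbar_wordInv, wbar_pw, wbar_pw])
    have := hO.steps_of_coprime (p := atomPow A b (k + 1)) (q := atomPow A a j)
      (w := (wordInv (pw A p) ++ pw A q).reverse) (fun s h h' => D.ne
        ((eq_of_dvd_atomPow h').symm.trans (eq_of_dvd_atomPow h))) (by
        rw [e2, reverse_append, reverse_powW, reverse_powW, wbar_append, wbar_powW, wbar_powW,
          zpow_neg, zpow_natCast, zpow_natCast, ev_atomPow, ev_atomPow])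
    have h := (this.trans ((pw_atomPow_steps _ _).inv.append (pw_atomPow_steps _ _))).reverse
    rw [wordInv_powW, reverse_reverse, reverse_append, reverse_powW, reverse_powW] at h
    exact h
  refine h1.trans ?_
  have h3 := h2.append (.refl A (powW a i))
  rw [append_assoc] at h3
  exact ((Steps012.refl _ _).append ((pw_mul _ _ _).trans
    ((Steps012.refl _ _).append (pw_atomPow_steps _ _)))).trans h3

theorem steps_pow_mul_pow_mul_pow {j k i : ℤ} (hk : k ≠ 0) {w : Word S}
    (hw : wbar A w = gen A a ^ j * gen A b ^ k * gen A a ^ i) :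
    Steps012 A w (powW a j ++ powW b k ++ powW a i) := by
  have hpos : ∀ (k : ℕ) (j i : ℤ) (w : Word S),
      wbar A w = gen A a ^ j * gen A b ^ (k + 1) * gen A a ^ i →
      Steps012 A w (powW a j ++ powW b (k + 1 : ℕ) ++ powW a i) := by
    intro k j i w hw
    rcases Int.eq_nat_or_neg i with ⟨i, rfl | rfl⟩
    · exact D.steps_of_nonneg (by simpa using hw)
    rcases Int.eq_nat_or_neg j with ⟨j, rfl | rfl⟩
    · have := wbar_reverse_eq A (u := w) (v := powW a j ++ powW b (k + 1 : ℕ) ++ powW a (-i)) (by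
        simp only [wbar_append, wbar_powW, hw, zpow_natCast])
      have := (D.steps_of_nonneg (j := -i) (k := k) (i := j) (w := w.reverse) (by
        rw [this, reverse_append, reverse_append]; simp only [reverse_powW, wbar_append, wbar_powW, zpow_natCast, mul_assoc])).reverse
      simpa [append_assoc] using this
    · have := (D.steps_of_neg (j := i) (k := k) (i := j) (w := wordInv w) (by
        rw [wbar_wordInv, hw]; simp [mul_assoc])).inv
      simpa [append_assoc, -Nat.cast_add] using this
  rcases lt_or_gt_of_ne hk with h | h
  · obtain ⟨n, rfl⟩ : ∃ n : ℕ, k = -(n + 1 : ℕ) := ⟨(-k - 1).toNat, by omega⟩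
    have := (hpos n (-i) (-j) (wordInv w) (by
        rw [wbar_wordInv, hw, zpow_neg, zpow_natCast]; simp [mul_assoc])).inv
    simpa [append_assoc, -Nat.cast_add] using this
  · obtain ⟨n, rfl⟩ : ∃ n : ℕ, k = (n + 1 : ℕ) := ⟨(k - 1).toNat, by omega⟩
    exact hpos n j i w (by rw [hw, zpow_natCast])

end Dihedral

end

section

open CoxeterSystem (alternatingWord braidWord)

/-! ### A linear representation in dihedral type -/

/-- Upper unipotent matrices. -/
def upperUnip (t : ℝ) : Matrix.SpecialLinearGroup (Fin 2) ℝ :=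
  ⟨!![1, t; 0, 1], by simp [Matrix.det_fin_two]⟩

/-- Lower unipotent matrices. -/
def lowerUnip (t : ℝ) : Matrix.SpecialLinearGroup (Fin 2) ℝ :=
  ⟨!![1, 0; t, 1], by simp [Matrix.det_fin_two]⟩

theorem upperUnip_mul (s t : ℝ) : upperUnip s * upperUnip t = upperUnip (s + t) := by
  apply Subtype.ext
  rw [Matrix.SpecialLinearGroup.coe_mul]
  simp [upperUnip, add_comm]

theorem lowerUnip_mul (s t : ℝ) : lowerUnip s * lowerUnip t = lowerUnip (s + t) := by
  apply Subtype.ext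
  rw [Matrix.SpecialLinearGroup.coe_mul]
  simp [lowerUnip]

theorem upperUnip_zpow (t : ℝ) (n : ℤ) : upperUnip t ^ n = upperUnip (n * t) := by
  have h0 : upperUnip 0 = 1 := by
    have := upperUnip_mul 0 0
    rw [add_zero] at this
    exact mul_eq_left.1 this
  let φ : Multiplicative ℝ →* Matrix.SpecialLinearGroup (Fin 2) ℝ :=
    ⟨⟨fun s => upperUnip s.toAdd, h0⟩, fun s t => (upperUnip_mul _ _).symm⟩
  have := map_zpow φ (Multiplicative.ofAdd t) n
  rw [← ofAdd_zsmul, zsmul_eq_mul] at this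
  exact this.symm

theorem lowerUnip_zpow (t : ℝ) (n : ℤ) : lowerUnip t ^ n = lowerUnip (n * t) := by
  have h0 : lowerUnip 0 = 1 := by
    have := lowerUnip_mul 0 0
    rw [add_zero] at this
    exact mul_eq_left.1 this
  let φ : Multiplicative ℝ →* Matrix.SpecialLinearGroup (Fin 2) ℝ :=
    ⟨⟨fun s => lowerUnip s.toAdd, h0⟩, fun s t => (lowerUnip_mul _ _).symm⟩
  have := map_zpow φ (Multiplicative.ofAdd t) n
  rw [← ofAdd_zsmul, zsmul_eq_mul] at this
  exact this.symm

/-- Alternating product of `k` factors beginning with `x`. -/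
def altProd {G : Type*} [Monoid G] (x y : G) : ℕ → G
  | 0 => 1
  | k + 1 => x * altProd y x k

theorem lift_altWord {G : Type*} [Group G] (f : S → G) (s t : S) (k : ℕ) :
    FreeGroup.lift f (FreeGroup.mk (altWord s t k)) = altProd (f s) (f t) k := by
  induction k generalizing s t with
  | zero => exact map_one _
  | succ k ih =>
    rw [altProd, ← ih]
    simp [altWord]

theorem altProd_map {G H : Type*} [Monoid G] [Monoid H] (φ : G →* H) (x y : G) (k : ℕ) :
    φ (altProd x y k) = altProd (φ x) (φ y) k := by
  induction k generalizing x y with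
  | zero => exact map_one _
  | succ k ih => simp [altProd, ih]

theorem altProd_even (x : ℝ) (s : ℤ → ℝ) (h0 : s 0 = 0) (h1 : s 1 = 1)
    (hs : ∀ n, s (n + 1) = x * s n - s (n - 1)) (l : ℕ) :
    altProd !![1, x; 0, 1] !![1, 0; -x, 1] (2 * l) =
      (-1 : ℝ) ^ l • !![s (2 * l + 1), -s (2 * l); s (2 * l), -s (2 * l - 1)] ∧
    altProd !![1, 0; -x, 1] !![1, x; 0, 1] (2 * l) =
      (-1 : ℝ) ^ l • !![-s (2 * l - 1), -s (2 * l); s (2 * l), s (2 * l + 1)] := by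
  induction l with
  | zero =>
    have h2 : s (-1) = -1 := by have := hs 0; norm_num [h0, h1] at this; linarith
    constructor <;> · ext i j; fin_cases i <;> fin_cases j <;> simp [altProd, h0, h1, h2]
  | succ l ih =>
    have e0 := hs (2 * l)
    have e1 := hs (2 * l + 1)
    have e2 := hs (2 * l + 1 + 1)
    have n1 : (2 * ((l + 1 : ℕ) : ℤ) + 1) = 2 * l + 1 + 1 + 1 := by push_cast; ring
    have n2 : (2 * ((l + 1 : ℕ) : ℤ)) = 2 * l + 1 + 1 := by push_cast; ring
    have n3 : (2 * (l : ℤ) + 1 + 1 - 1) = 2 * l + 1 := by ring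
    have n4 : (2 * (l : ℤ) + 1 - 1) = 2 * l := by ring
    rw [n4] at e1
    rw [n3] at e2
    have n0 : 2 * (l + 1) = 2 * l + 1 + 1 := by ring
    rw [n0, altProd, altProd, altProd, altProd, ih.1, ih.2, n1, n2, n3]
    constructor
    · ext i j; fin_cases i <;> fin_cases j <;>
        simp [pow_succ, e2, e1, e0] <;> ring
    · ext i j; fin_cases i <;> fin_cases j <;>
        simp [pow_succ, e2, e1, e0] <;> ring

theorem altProd_unip {m : ℕ} (hm : 3 ≤ m) :
    altProd (upperUnip (2 * Real.cos (Real.pi / m))) (lowerUnip (-(2 * Real.cos (Real.pi / m)))) m =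
      altProd (lowerUnip (-(2 * Real.cos (Real.pi / m)))) (upperUnip (2 * Real.cos (Real.pi / m)))
        m := by
  set θ := Real.pi / m with hθ
  set x := 2 * Real.cos θ
  have hm0 : (0 : ℝ) < m := by positivity
  have hmθ : m * θ = Real.pi := by rw [hθ]; field_simp
  have hsin : 0 < Real.sin θ := by
    apply Real.sin_pos_of_pos_of_lt_pi (by positivity)
    rw [hθ]; apply div_lt_self Real.pi_pos; exact_mod_cast (by omega : 1 < m)
  let s : ℤ → ℝ := fun n => Real.sin (n * θ) / Real.sin θ
  have h0 : s 0 = 0 := by simp [s]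
  have h1 : s 1 = 1 := by simp [s, hsin.ne']
  have hs : ∀ n, s (n + 1) = x * s n - s (n - 1) := by
    intro n
    have a1 : Real.sin ((n + 1) * θ) = Real.sin (n * θ) * Real.cos θ +
      Real.cos (n * θ) * Real.sin θ := by rw [add_mul, one_mul, Real.sin_add]
    have a2 : Real.sin ((n - 1) * θ) = Real.sin (n * θ) * Real.cos θ -
      Real.cos (n * θ) * Real.sin θ := by rw [sub_mul, one_mul, Real.sin_sub]
    simp only [s]
    push_cast
    rw [a1, a2]
    field_simp
    ring
  have hsm : s m = 0 := by simp [s, hmθ]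
  have hsm1 : s (m + 1) = - s (m - 1) := by rw [hs, hsm]; ring
  clear_value s x
  let φ : Matrix.SpecialLinearGroup (Fin 2) ℝ →* Matrix (Fin 2) (Fin 2) ℝ :=
    ⟨⟨Subtype.val, rfl⟩, fun _ _ => rfl⟩
  refine Subtype.ext (?_ : φ _ = φ _)
  rw [altProd_map, altProd_map]
  have hU : φ (upperUnip x) = !![1, x; 0, 1] := rfl
  have hL : φ (lowerUnip (-x)) = !![1, 0; -x, 1] := rfl
  rw [hU, hL]
  rcases Nat.even_or_odd' m with ⟨l, hl | hl⟩
  · obtain ⟨e1, e2⟩ := altProd_even x s h0 h1 hs l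
    rw [hl] at hsm hsm1 ⊢
    push_cast at hsm hsm1
    rw [e1, e2, hsm1, hsm]
  · obtain ⟨e1, e2⟩ := altProd_even x s h0 h1 hs l
    have e3 := hs (2 * l)
    have e4 := hs (2 * l + 1)
    rw [hl] at hsm hsm1 ⊢
    push_cast at hsm hsm1
    have n4 : (2 * (l : ℤ) + 1 - 1) = 2 * l := by ring
    rw [n4] at hsm1 e4
    rw [hsm] at e3 e4
    rw [altProd, altProd, e1, e2, hsm]
    ext i j
    fin_cases i <;> fin_cases j <;> simp <;> first
      | done
      | linear_combination ((-1 : ℝ) ^ l) * e3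
      | linear_combination (-(-1 : ℝ) ^ l) * e3

namespace Dihedral

variable {A : ArtinData S} {a b : S} (D : Dihedral A a b)
include D

theorem exists_rep : ∃ (x : ℝ) (φ : ArtinGroup A →* Matrix.SpecialLinearGroup (Fin 2) ℝ), x ≠ 0 ∧
    φ (gen A a) = upperUnip x ∧ φ (gen A b) = lowerUnip (-x) := by
  obtain ⟨m, hm, hab⟩ := D.label
  set x := 2 * Real.cos (Real.pi / m) with hx
  have hcos : 0 < Real.cos (Real.pi / m) := by
    apply Real.cos_pos_of_mem_Ioo
    have h3 : (3 : ℝ) ≤ m := by exact_mod_cast hm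
    have : Real.pi / m < Real.pi / 2 :=
      div_lt_div_of_pos_left Real.pi_pos (by norm_num) (by linarith)
    constructor
    · have : 0 < Real.pi / m := div_pos Real.pi_pos (by linarith)
      linarith [Real.pi_pos]
    · exact this
  let f : S → Matrix.SpecialLinearGroup (Fin 2) ℝ :=
    fun s => if s = a then upperUnip x else lowerUnip (-x)
  have key := altProd_unip hm
  have hf : ∀ r ∈ rels A, FreeGroup.lift f r = 1 := by
    rintro r ⟨u, v, ⟨s, t, k, hst, hk, rfl, rfl⟩, rfl⟩
    rw [map_mul, map_inv, mul_inv_eq_one, lift_altWord, lift_altWord]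
    rcases D.cover s with rfl | rfl <;> rcases D.cover t with rfl | rfl
    · exact absurd rfl hst
    · obtain rfl : m = k := by exact_mod_cast hab.symm.trans hk
      simpa [f, D.ne.symm] using key
    · rw [A.symm] at hk
      obtain rfl : m = k := by exact_mod_cast hab.symm.trans hk
      simpa [f, D.ne.symm] using key.symm
    · exact absurd rfl hst
  refine ⟨x, PresentedGroup.toGroup hf, by positivity, ?_, ?_⟩
  · exact (PresentedGroup.toGroup.of hf).trans (if_pos rfl)
  · exact (PresentedGroup.toGroup.of hf).trans (if_neg D.ne.symm)

theorem eq_zero_of_mul_eq {d j j' n : ℤ} (hj : j ≠ 0)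
    (h : gen A a ^ d * gen A b ^ j = gen A b ^ j' * gen A a ^ n) : d = 0 ∧ n = 0 ∧ j = j' := by
  obtain ⟨x, φ, hx, ha, hb⟩ := D.exists_rep
  have e := congrArg φ h
  rw [map_mul, map_mul, map_zpow, map_zpow, map_zpow, map_zpow, ha, hb, upperUnip_zpow,
    lowerUnip_zpow, upperUnip_zpow, lowerUnip_zpow] at e
  have e' := congrArg Subtype.val e
  rw [Matrix.SpecialLinearGroup.coe_mul, Matrix.SpecialLinearGroup.coe_mul] at e'
  have e00 := congrFun (congrFun e' 0) 0
  have e01 := congrFun (congrFun e' 0) 1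
  have e10 := congrFun (congrFun e' 1) 0
  simp [upperUnip, lowerUnip, hx, hj] at e00 e01 e10
  refine ⟨e00, ?_, e10⟩
  rw [e00] at e01
  simpa [hx] using e01.symm

/-- The relation: `n` is the exponent of the `a`-part of `v`, with respect to a set of
representatives of the remaining cosets. -/
def IsExp (A : ArtinData S) (a b : S) (T : Set (ArtinGroup A)) (v : ArtinGroup A) (n : ℤ) : Prop :=
  (∃ i j : ℤ, j ≠ 0 ∧ v = gen A a ^ i * gen A b ^ j * gen A a ^ n) ∨ v = gen A a ^ n ∨
    ((¬ ∃ i j k : ℤ, v = gen A a ^ i * gen A b ^ j * gen A a ^ k) ∧ v * gen A a ^ (-n) ∈ T)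

theorem exists_exp : ∃ κ : ArtinGroup A → ℤ, κ 1 = 0 ∧
    (∀ v i, κ (v * gen A a ^ i) = κ v + i) ∧
    (∀ i j : ℤ, j ≠ 0 → κ (gen A a ^ i * gen A b ^ j) = 0) ∧
    ∀ w, ∃ v, Steps012 A w (v ++ powW a (κ (wbar A w))) := by
  obtain ⟨T, hT, hreach⟩ := D.reducible.tr {a}
  have hinj : ∀ m n : ℤ, gen A a ^ m = gen A a ^ n → m = n := by
    intro m n h
    have := (D.eq_zero_of_mul_eq (d := m - n) (j := 1) (j' := 1) (n := 0) one_ne_zero (by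
      rw [zpow_sub, h]; simp)).1
    omega
  have hab : ∀ i j k n : ℤ, j ≠ 0 → gen A a ^ i * gen A b ^ j * gen A a ^ k ≠ gen A a ^ n := by
    intro i j k n hj h
    have := (D.eq_zero_of_mul_eq (d := i) (j := j) (j' := 0) (n := n - k) hj (by
      rw [zpow_zero, one_mul, zpow_sub, ← h, mul_inv_cancel_right])).2.2
    exact hj this
  have huniq : ∀ v m n, IsExp A a b T v m → IsExp A a b T v n → m = n := by
    rintro v m n (⟨i, j, hj, h⟩ | h | ⟨h, h'⟩) (⟨i', j', hj', e⟩ | e | ⟨e, e'⟩)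
    · have := (D.eq_zero_of_mul_eq (d := i' - i) (j := j') (j' := j) (n := m - n) hj' (by
        calc gen A a ^ (i' - i) * gen A b ^ j' =
              gen A a ^ (-i) * (gen A a ^ i' * gen A b ^ j' * gen A a ^ n) * gen A a ^ (-n) := by
              group
          _ = _ := by rw [← e, h]; group)).2.1
      omega
    · exact absurd (h.symm.trans e) (hab _ _ _ _ hj)
    · exact absurd ⟨i, j, m, h⟩ e
    · exact absurd (e.symm.trans h) (hab _ _ _ _ hj')
    · exact hinj _ _ (h.symm.trans e)
    · exact absurd ⟨0, 0, m, by simpa using h⟩ e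
    · exact absurd ⟨i', j', n, e⟩ h
    · exact absurd ⟨0, 0, n, by simpa using e⟩ h
    · have := hT _ h' _ e' (mem_parab_singleton.2 ⟨m - n, by
        rw [zpow_sub, zpow_neg, zpow_neg]; group⟩)
      have := hinj _ _ (mul_left_cancel this)
      omega
  have hex : ∀ v, ∃ n, IsExp A a b T v n ∧ ∀ w, wbar A w = v →
      ∃ w', Steps012 A w (w' ++ powW a n) := by
    intro v
    by_cases h : ∃ i j k : ℤ, v = gen A a ^ i * gen A b ^ j * gen A a ^ k
    · obtain ⟨i, j, k, rfl⟩ := h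
      by_cases hj : j = 0
      · subst hj
        refine ⟨i + k, Or.inr (Or.inl (by simp [zpow_add])), fun w hw => ⟨[], ?_⟩⟩
        rw [zpow_zero, mul_one, ← zpow_add] at hw
        obtain ⟨u, hu, h⟩ := D.reducible.exists_wordOver (T := {a}) (w := w)
          (by rw [hw]; exact mem_parab_singleton.2 ⟨_, rfl⟩)
        obtain ⟨n, hn⟩ := steps_powW_of_wordOver A hu
        have := (h.trans hn).wbar_eq
        rw [wbar_powW, hw] at this
        rw [hinj _ _ this]
        exact h.trans hn
      · exact ⟨k, Or.inl ⟨i, j, hj, rfl⟩, fun w hw =>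
          ⟨_, D.steps_pow_mul_pow_mul_pow hj hw⟩⟩
    · obtain ⟨w₀, rfl⟩ := wbar_surjective A v
      have hw : ∀ w, wbar A w = wbar A w₀ → ∃ n, IsExp A a b T (wbar A w₀) n ∧ ∃ w',
          Steps012 A w (w' ++ powW a n) := by
        intro w hw
        obtain ⟨v, u, hu, hs, hv⟩ := hreach w
        obtain ⟨n, hn⟩ := steps_powW_of_wordOver A hu
        have := hs.trans ((Steps012.refl A v).append hn)
        refine ⟨n, Or.inr (Or.inr ⟨h, ?_⟩), v, this⟩
        rw [← hw, this.wbar_eq]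
        simpa using hv
      obtain ⟨n, hn, -⟩ := hw w₀ rfl
      refine ⟨n, hn, fun w h => ?_⟩
      obtain ⟨n', hn', h'⟩ := hw w h
      rwa [huniq _ _ _ hn hn']
  choose κ hκ hs using hex
  refine ⟨κ, huniq _ _ _ (hκ 1) (Or.inr (Or.inl (by simp))), fun v i => ?_, fun i j hj => ?_,
    fun w => hs _ w rfl⟩
  · refine huniq _ _ _ (hκ _) ?_
    rcases hκ v with ⟨i', j, hj, h⟩ | h | ⟨h, h'⟩
    · exact Or.inl ⟨i', j, hj, by rw [zpow_add, ← mul_assoc, ← h]⟩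
    · exact Or.inr (Or.inl (by rw [zpow_add, ← h]))
    · refine Or.inr (Or.inr ⟨fun ⟨i', j, k, e⟩ => h ⟨i', j, k - i, ?_⟩, ?_⟩)
      · rw [zpow_sub, ← mul_assoc, ← e]; simp
      · rw [neg_add, zpow_add, zpow_neg _ i]
        convert h' using 1
        rw [← zpow_neg, mul_assoc, ← zpow_add, ← zpow_add]; congr 2; ring
  · exact huniq _ _ _ (hκ _) (Or.inl ⟨i, j, hj, by simp⟩)

end Dihedral

end

section

universe u

/-! ### Normal forms in large type -/

/-- `P` is the pair of the distinct generators `a` and `b`. -/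
structure PairEq {S : Type u} (P : Set S) (a b : S) : Prop where
  ne : a ≠ b
  eq : P = {a, b}

/-- A family of groups indexed by pairs of generators, with the properties of dihedral Artin-Tits
groups that control the normal forms in large type. -/
structure PairSystem (S : Type u) where
  Γ : Set S → Type u
  grp : ∀ P, Group (Γ P)
  g : ∀ P, S → Γ P
  exp : ∀ P, S → Γ P → ℤ
  exp_one : ∀ {P a b}, PairEq P a b → exp P a 1 = 0
  exp_mul : ∀ {P a b}, PairEq P a b → ∀ v i, exp P a (v * g P a ^ i) = exp P a v + i
  exp_pow_mul_pow : ∀ {P a b}, PairEq P a b → ∀ i j : ℤ, j ≠ 0 →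
    exp P a (g P a ^ i * g P b ^ j) = 0
  eq_of_mul_eq : ∀ {P a b}, PairEq P a b → ∀ d j j' n : ℤ, j ≠ 0 →
    g P a ^ d * g P b ^ j = g P b ^ j' * g P a ^ n → d = 0 ∧ n = 0 ∧ j = j'

instance {S : Type u} (PS : PairSystem S) (P : Set S) : Group (PS.Γ P) := PS.grp P

variable {S : Type u}

namespace PairEq

variable {P : Set S} {a b : S}

theorem symm (h : PairEq P a b) : PairEq P b a := ⟨h.ne.symm, by rw [h.eq, Set.pair_comm]⟩

theorem left (h : PairEq P a b) : a ∈ P := by simp [h.eq]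

theorem right (h : PairEq P a b) : b ∈ P := by simp [h.eq]

theorem mem_iff (h : PairEq P a b) {c : S} : c ∈ P ↔ c = a ∨ c = b := by simp [h.eq]

theorem exists_of_mem (h : PairEq P a b) {c : S} (hc : c ∈ P) : ∃ d, PairEq P c d := by
  rcases h.mem_iff.1 hc with rfl | rfl
  exacts [⟨_, h⟩, ⟨_, h.symm⟩]

end PairEq

namespace PairSystem

variable (PS : PairSystem S) {P : Set S} {a b : S}

section

variable (h : PairEq P a b)
include h

theorem exp_pow (i : ℤ) : PS.exp P a (PS.g P a ^ i) = i := by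
  have := PS.exp_mul h 1 i
  rwa [one_mul, PS.exp_one h, zero_add] at this

theorem exp_other_pow (i : ℤ) : PS.exp P a (PS.g P b ^ i) = 0 := by
  by_cases hi : i = 0
  · subst hi; simp [PS.exp_one h]
  · simpa using PS.exp_pow_mul_pow h 0 i hi

theorem pow_injective {i j : ℤ} (e : PS.g P a ^ i = PS.g P a ^ j) : i = j := by
  rw [← PS.exp_pow h i, e, PS.exp_pow h]

theorem pow_eq_pow {i j : ℤ} (e : PS.g P a ^ i = PS.g P b ^ j) : i = 0 ∧ j = 0 := by
  have h1 := congrArg (PS.exp P a) e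
  have h2 := congrArg (PS.exp P b) e
  rw [PS.exp_pow h, PS.exp_other_pow h] at h1
  rw [PS.exp_pow h.symm, PS.exp_other_pow h.symm] at h2
  exact ⟨h1, h2.symm⟩

theorem pow_mul_pow_injective {i j i' j' : ℤ}
    (e : PS.g P a ^ i * PS.g P b ^ j = PS.g P a ^ i' * PS.g P b ^ j') : i = i' ∧ j = j' := by
  have := PS.pow_eq_pow h (i := i - i') (j := j' - j) (by
    rw [sub_eq_neg_add, sub_eq_add_neg, zpow_add, zpow_add, zpow_neg, zpow_neg, inv_mul_eq_iff_eq_mul,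
      ← mul_assoc, ← e, mul_inv_cancel_right])
  omega

theorem pow_mul_pow_ne {i j i' j' : ℤ} (hi : i ≠ 0) (hj : j ≠ 0) :
    PS.g P a ^ i * PS.g P b ^ j ≠ PS.g P b ^ j' * PS.g P a ^ i' :=
  fun e => hi (PS.eq_of_mul_eq h _ _ _ _ hj e).1

end

/-- An element that is not a product of two powers of generators. -/
def Big (P : Set S) (v : PS.Γ P) : Prop :=
  ∀ a b, PairEq P a b → ∀ i j : ℤ, v ≠ PS.g P a ^ i * PS.g P b ^ j

theorem Big.ne_pow {v : PS.Γ P} (hv : PS.Big P v) (h : PairEq P a b) (i : ℤ) :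
    v ≠ PS.g P a ^ i := by simpa using hv a b h i 0

theorem big_pow_mul_pow_mul_pow (h : PairEq P a b) {l n k : ℤ} (hl : l ≠ 0) (hn : n ≠ 0)
    (hk : k ≠ 0) : PS.Big P (PS.g P a ^ l * PS.g P b ^ n * PS.g P a ^ k) := by
  intro c d hcd i j e
  have h1 : ∀ i j : ℤ, PS.g P a ^ l * PS.g P b ^ n * PS.g P a ^ k ≠ PS.g P a ^ i * PS.g P b ^ j := by
    intro i j e
    have e2 : PS.g P a ^ (i - l) * PS.g P b ^ j = PS.g P b ^ n * PS.g P a ^ k := by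
      rw [sub_eq_neg_add, zpow_add, mul_assoc, ← e, zpow_neg, mul_assoc, inv_mul_cancel_left]
    by_cases hj : j = 0
    · subst hj
      rw [zpow_zero, mul_one] at e2
      refine hn (PS.pow_eq_pow h (i := i - l - k) (j := n) ?_).2
      rw [zpow_sub, e2, mul_inv_cancel_right]
    · exact hk (PS.eq_of_mul_eq h _ _ _ _ hj e2).2.1
  have h2 : ∀ i j : ℤ, PS.g P a ^ l * PS.g P b ^ n * PS.g P a ^ k ≠ PS.g P b ^ j * PS.g P a ^ i := by
    intro i j e
    refine hl (PS.eq_of_mul_eq h l n j (i - k) hn ?_).1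
    rw [zpow_sub, ← mul_assoc, ← e, mul_inv_cancel_right]
  rcases h.mem_iff.1 hcd.left with rfl | rfl <;> rcases h.mem_iff.1 hcd.right with rfl | rfl
  · exact hcd.ne rfl
  · exact h1 _ _ e
  · exact h2 _ _ e
  · exact hcd.ne rfl

theorem Big.mul_pow {v : PS.Γ P} (hv : PS.Big P v) (h : PairEq P a b) (h0 : PS.exp P a v = 0)
    (k : ℤ) : PS.Big P (v * PS.g P a ^ k) := by
  have h1 : ∀ i j : ℤ, v * PS.g P a ^ k ≠ PS.g P a ^ i * PS.g P b ^ j := by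
    intro i j e
    by_cases hj : j = 0
    · subst hj
      rw [zpow_zero, mul_one] at e
      exact hv.ne_pow PS h (i - k) (by rw [zpow_sub, ← e, mul_inv_cancel_right])
    · have := PS.exp_mul h v k
      rw [e, PS.exp_pow_mul_pow h _ _ hj, h0, zero_add] at this
      subst this
      exact hv a b h i j (by simpa using e)
  have h2 : ∀ i j : ℤ, v * PS.g P a ^ k ≠ PS.g P b ^ j * PS.g P a ^ i := by
    intro i j e
    exact hv b a h.symm j (i - k) (by rw [zpow_sub, ← mul_assoc, ← e, mul_inv_cancel_right])
  intro c d hcd i j e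
  rcases h.mem_iff.1 hcd.left with rfl | rfl <;> rcases h.mem_iff.1 hcd.right with rfl | rfl
  · exact hcd.ne rfl
  · exact h1 _ _ e
  · exact h2 _ _ e
  · exact hcd.ne rfl

/-- Classification of the elements of a pair group, relative to an ordering of the pair. -/
theorem cases (h : PairEq P a b) (v : PS.Γ P) :
    (∃ i : ℤ, v = PS.g P a ^ i) ∨ (∃ j : ℤ, j ≠ 0 ∧ v = PS.g P b ^ j) ∨
      (∃ i j : ℤ, i ≠ 0 ∧ j ≠ 0 ∧ v = PS.g P a ^ i * PS.g P b ^ j) ∨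
      (∃ j i : ℤ, j ≠ 0 ∧ i ≠ 0 ∧ v = PS.g P b ^ j * PS.g P a ^ i) ∨ PS.Big P v := by
  by_cases hv : PS.Big P v
  · simp [hv]
  simp only [Big] at hv
  push Not at hv
  obtain ⟨c, d, hcd, i, j, rfl⟩ := hv
  by_cases hi : i = 0
  · subst hi
    rcases h.mem_iff.1 hcd.right with rfl | rfl
    · exact Or.inl ⟨j, by simp⟩
    · by_cases hj : j = 0
      · subst hj; exact Or.inl ⟨0, by simp⟩
      · exact Or.inr (Or.inl ⟨j, hj, by simp⟩)
  by_cases hj : j = 0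
  · subst hj
    rcases h.mem_iff.1 hcd.left with rfl | rfl
    · exact Or.inl ⟨i, by simp⟩
    · exact Or.inr (Or.inl ⟨i, hi, by simp⟩)
  rcases h.mem_iff.1 hcd.left with rfl | rfl <;> rcases h.mem_iff.1 hcd.right with rfl | rfl
  · exact absurd rfl hcd.ne
  · exact Or.inr (Or.inr (Or.inl ⟨i, j, hi, hj, rfl⟩))
  · exact Or.inr (Or.inr (Or.inr (Or.inl ⟨i, j, hi, hj, rfl⟩)))
  · exact absurd rfl hcd.ne

/-- Candidate normal forms: sequences of syllables and of blocks. -/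
inductive Pre : Type u
  | one : Pre
  | syl : Pre → S → ℤ → Pre
  | blk : Pre → (P : Set S) → PS.Γ P → Pre

namespace Pre

variable {PS}

/-- The exponent of the final `a`-syllable. -/
noncomputable def expo : PS.Pre → S → ℤ
  | one, _ => 0
  | syl _ b k, a => if b = a then k else 0
  | blk _ P e, a => if a ∈ P then PS.exp P a e else 0

/-- Multiplication by an element of a pair group, given the multiplication by powers. -/
noncomputable def multWith (h : PS.Pre) (add : S → ℤ → PS.Pre) (P : Set S) (v : PS.Γ P) : PS.Pre :=
  if v = 1 then h else
  if H : ∃ q : S × ℤ, q.1 ∈ P ∧ v = PS.g P q.1 ^ q.2 then add H.choose.1 H.choose.2 else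
  if H : ∃ q : (S × ℤ) × (S × ℤ), PairEq P q.1.1 q.2.1 ∧
      v = PS.g P q.1.1 ^ q.1.2 * PS.g P q.2.1 ^ q.2.2 then
    syl (add H.choose.1.1 H.choose.1.2) H.choose.2.1 H.choose.2.2
  else blk h P v

/-- Removal of the final syllable, and addition of a syllable. -/
noncomputable def stripAdd : PS.Pre → (S → PS.Pre) × (S → ℤ → PS.Pre)
  | one => (fun _ => one, fun a k => if k = 0 then one else syl one a k)
  | syl y c n => (fun a => if c = a then y else syl y c n, fun a k =>
      if k = 0 then syl y c n else
      if expo y a ≠ 0 then blk ((stripAdd y).1 a) {a, c}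
        (PS.g {a, c} a ^ expo y a * PS.g {a, c} c ^ n * PS.g {a, c} a ^ k)
      else syl (syl y c n) a k)
  | blk h P e => (fun a => if a ∈ P ∧ PS.exp P a e ≠ 0 then
        multWith h (stripAdd h).2 P (e * PS.g P a ^ (-PS.exp P a e)) else blk h P e,
      fun a k => if k = 0 then blk h P e else
        if a ∈ P then blk h P (e * PS.g P a ^ k) else syl (blk h P e) a k)

/-- Removal of the final `a`-syllable. -/
noncomputable def strip (x : PS.Pre) : S → PS.Pre := (stripAdd x).1

/-- Addition of the syllable `a ^ k`. -/
noncomputable def add (x : PS.Pre) : S → ℤ → PS.Pre := (stripAdd x).2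

/-- Multiplication by an element of a pair group. -/
noncomputable def mult (h : PS.Pre) (P : Set S) (v : PS.Γ P) : PS.Pre := multWith h (add h) P v

@[simp] theorem add_zero (x : PS.Pre) (a : S) : add x a 0 = x := by
  cases x <;> simp [add, stripAdd]

@[simp] theorem mult_one (h : PS.Pre) (P : Set S) : mult h P 1 = h := if_pos rfl

theorem mult_pow (h : PS.Pre) (hP : PairEq P a b) (k : ℤ) :
    mult h P (PS.g P a ^ k) = add h a k := by
  by_cases hk : k = 0
  · subst hk; simp
  have h1 : PS.g P a ^ k ≠ 1 := fun e => hk (PS.pow_injective hP (by simpa using e))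
  have H : ∃ q : S × ℤ, q.1 ∈ P ∧ PS.g P a ^ k = PS.g P q.1 ^ q.2 := ⟨(a, k), hP.left, rfl⟩
  rw [mult, multWith, if_neg h1, dif_pos H]
  obtain ⟨h2, h3⟩ := H.choose_spec
  rcases hP.mem_iff.1 h2 with h4 | h4
  · rw [h4] at h3 ⊢
    exact congrArg _ (PS.pow_injective hP h3).symm
  · rw [h4] at h3
    exact absurd (PS.pow_eq_pow hP h3).1 hk

theorem mult_pow_mul_pow (h : PS.Pre) (hP : PairEq P a b) {i j : ℤ} (hi : i ≠ 0) (hj : j ≠ 0) :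
    mult h P (PS.g P a ^ i * PS.g P b ^ j) = syl (add h a i) b j := by
  have h1 : PS.g P a ^ i * PS.g P b ^ j ≠ 1 := fun e =>
    hi (PS.pow_mul_pow_injective hP (i' := 0) (j' := 0) (by simpa using e)).1
  have h2 : ¬ ∃ q : S × ℤ, q.1 ∈ P ∧ PS.g P a ^ i * PS.g P b ^ j = PS.g P q.1 ^ q.2 := by
    rintro ⟨⟨c, k⟩, hc, e⟩
    rcases hP.mem_iff.1 hc with h | h <;> dsimp only at h e <;> rw [h] at e
    · exact hj (PS.pow_mul_pow_injective hP (i' := k) (j' := 0) (by simpa using e)).2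
    · exact hi (PS.pow_mul_pow_injective hP (i' := 0) (j' := k) (by simpa using e)).1
  have H : ∃ q : (S × ℤ) × (S × ℤ), PairEq P q.1.1 q.2.1 ∧
      PS.g P a ^ i * PS.g P b ^ j = PS.g P q.1.1 ^ q.1.2 * PS.g P q.2.1 ^ q.2.2 :=
    ⟨((a, i), (b, j)), hP, rfl⟩
  rw [mult, multWith, if_neg h1, dif_neg h2, dif_pos H]
  obtain ⟨h3, h4⟩ := H.choose_spec
  rcases hP.mem_iff.1 h3.left with h5 | h5 <;> rcases hP.mem_iff.1 h3.right with h6 | h6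
  · exact absurd (h5.trans h6.symm) h3.ne
  · rw [h5, h6] at h4 ⊢
    obtain ⟨e1, e2⟩ := PS.pow_mul_pow_injective hP h4
    rw [show H.choose.1.2 = i from e1.symm, show H.choose.2.2 = j from e2.symm]
  · rw [h5, h6] at h4
    exact absurd h4 (PS.pow_mul_pow_ne hP hi hj)
  · exact absurd (h5.trans h6.symm) h3.ne

theorem mult_big (h : PS.Pre) (hP : PairEq P a b) {v : PS.Γ P} (hv : PS.Big P v) :
    mult h P v = blk h P v := by
  rw [mult, multWith, if_neg, dif_neg, dif_neg]
  · rintro ⟨q, hq, e⟩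
    exact hv _ _ hq _ _ e
  · rintro ⟨q, hq, e⟩
    obtain ⟨d, hd⟩ := hP.exists_of_mem hq
    exact hv.ne_pow PS hd _ e
  · intro e
    exact hv.ne_pow PS hP 0 (by simpa using e)

end Pre

end PairSystem

end

section

universe u

variable {S : Type u}

theorem PairEq.unique {P P' : Set S} {a b c d : S} (h : PairEq P a b) (h' : PairEq P' c d)
    (ha : a ∈ P') (hb : b ∈ P') : P' = P := by
  have := h.ne
  rcases h'.mem_iff.1 ha with rfl | rfl <;> rcases h'.mem_iff.1 hb with rfl | rfl
  · exact absurd rfl this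
  · rw [h.eq, h'.eq]
  · rw [h.eq, h'.symm.eq]
  · exact absurd rfl this

namespace PairSystem

variable {PS : PairSystem S} {P : Set S} {a b : S}

namespace Pre

@[simp] theorem strip_one (a : S) : strip (one : PS.Pre) a = one := rfl

theorem strip_syl (y : PS.Pre) (c a : S) (n : ℤ) :
    strip (syl y c n) a = if c = a then y else syl y c n := rfl

theorem strip_blk (h : PS.Pre) (P : Set S) (e : PS.Γ P) (a : S) :
    strip (blk h P e) a = if a ∈ P ∧ PS.exp P a e ≠ 0 then
      mult h P (e * PS.g P a ^ (-PS.exp P a e)) else blk h P e := rfl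

theorem add_one {a : S} {k : ℤ} (hk : k ≠ 0) : add (one : PS.Pre) a k = syl one a k :=
  if_neg hk

theorem add_syl (y : PS.Pre) {c a : S} {n k : ℤ} (hk : k ≠ 0) :
    add (syl y c n) a k = if expo y a ≠ 0 then blk (strip y a) {a, c}
      (PS.g {a, c} a ^ expo y a * PS.g {a, c} c ^ n * PS.g {a, c} a ^ k)
      else syl (syl y c n) a k := if_neg hk

theorem add_blk (h : PS.Pre) (P : Set S) (e : PS.Γ P) (a : S) {k : ℤ} (hk : k ≠ 0) :
    add (blk h P e) a k = if a ∈ P then blk h P (e * PS.g P a ^ k) else syl (blk h P e) a k :=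
  if_neg hk

/-- Whether a syllable in the letter `b` can follow. -/
def Fits : PS.Pre → S → Prop
  | one, _ => True
  | syl z a _, b => a ≠ b ∧ expo z b = 0
  | blk _ P _, b => b ∉ P

/-- Whether a block of type `P` can follow. -/
def Free (P : Set S) (x : PS.Pre) : Prop :=
  (∀ a ∈ P, expo x a = 0) ∧ ∀ h e, x ≠ blk h P e

/-- The normal forms. -/
def Valid : PS.Pre → Prop
  | one => True
  | syl y b j => j ≠ 0 ∧ Valid y ∧ Fits y b
  | blk h P e => Valid h ∧ (∃ a b, PairEq P a b) ∧ Free P h ∧ PS.Big P e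

theorem Fits.expo {x : PS.Pre} (h : Fits x b) : expo x b = 0 := by
  cases x with
  | one => rfl
  | syl z a k => exact if_neg h.1
  | blk h' P e => exact if_neg h

theorem Fits.add {x : PS.Pre} (h : Fits x b) {j : ℤ} (hj : j ≠ 0) : add x b j = syl x b j := by
  cases x with
  | one => exact add_one hj
  | syl z a k => rw [add_syl _ hj, if_neg (by simp [h.2])]
  | blk h' P e => rw [add_blk _ _ _ _ hj, if_neg h]

theorem Valid.strip_eq {x : PS.Pre} (hx : Valid x) (ha : expo x a = 0) : strip x a = x := by
  cases x with
  | one => rfl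
  | syl y c n =>
    rw [strip_syl, if_neg]
    rintro rfl
    exact hx.1 (by simpa [Pre.expo] using ha)
  | blk h P e =>
    rw [strip_blk, if_neg]
    rintro ⟨h1, h2⟩
    exact h2 (by simpa [Pre.expo, h1] using ha)

theorem Valid.ne_of_expo {y : PS.Pre} {c : S} {n : ℤ} (hx : Valid (syl y c n))
    (ha : expo (syl y c n) a = 0) : a ≠ c := by
  rintro rfl
  exact hx.1 (by simpa [Pre.expo] using ha)

theorem Valid.add_cases {x : PS.Pre} (hx : Valid x) (ha : expo x a = 0) {k : ℤ} (hk : k ≠ 0) :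
    (add x a k = syl x a k ∧ Fits x a) ∨
    (∃ y c n, x = syl y c n ∧ a ≠ c ∧ expo y a ≠ 0 ∧ add x a k = blk (strip y a) {a, c}
      (PS.g {a, c} a ^ expo y a * PS.g {a, c} c ^ n * PS.g {a, c} a ^ k)) ∨
    (∃ h P e, x = blk h P e ∧ a ∈ P ∧ add x a k = blk h P (e * PS.g P a ^ k)) := by
  cases x with
  | one => exact Or.inl ⟨add_one hk, trivial⟩
  | syl y c n =>
    have hac := hx.ne_of_expo ha
    by_cases h : expo y a = 0
    · exact Or.inl ⟨by rw [add_syl _ hk, if_neg (by simp [h])], hac.symm, h⟩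
    · exact Or.inr (Or.inl ⟨y, c, n, rfl, hac, h, by rw [add_syl _ hk, if_pos h]⟩)
  | blk h P e =>
    by_cases h1 : a ∈ P
    · exact Or.inr (Or.inr ⟨h, P, e, rfl, h1, by rw [add_blk _ _ _ _ hk, if_pos h1]⟩)
    · exact Or.inl ⟨by rw [add_blk _ _ _ _ hk, if_neg h1], h1⟩

theorem Valid.expo_add {x : PS.Pre} (hx : Valid x) (ha : expo x a = 0) (k : ℤ) :
    expo (add x a k) a = k := by
  by_cases hk : k = 0
  · subst hk; rwa [add_zero]
  rcases hx.add_cases ha hk with ⟨e, -⟩ | ⟨y, c, n, rfl, hac, hy, e⟩ | ⟨h, P, v, rfl, haP, e⟩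
  · rw [e]; simp [Pre.expo]
  · have hp : PairEq {a, c} a c := ⟨hac, rfl⟩
    rw [e, Pre.expo, if_pos hp.left, PS.exp_mul hp, PS.exp_pow_mul_pow hp _ _ hx.1, zero_add]
  · obtain ⟨-, ⟨c, d, hcd⟩, -⟩ := hx
    obtain ⟨d, hp⟩ := hcd.exists_of_mem haP
    rw [Pre.expo, if_pos haP] at ha
    rw [e, Pre.expo, if_pos haP, PS.exp_mul hp, ha, zero_add]

theorem Valid.fits_add {h : PS.Pre} (hh : Valid h) (hf : Free P h) (hP : PairEq P a b) {n : ℤ}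
    (hn : n ≠ 0) : Fits (Pre.add h b n) a := by
  rcases hh.add_cases (hf.1 b hP.right) hn with
    ⟨e, -⟩ | ⟨y, c, m, rfl, hac, hy, e⟩ | ⟨h', P', v, rfl, hbP, e⟩
  · rw [e]; exact ⟨hP.ne.symm, hf.1 a hP.left⟩
  · rw [e]
    have := hh.ne_of_expo (hf.1 a hP.left)
    simp [Fits, hP.ne, this]
  · rw [e]
    intro haP
    obtain ⟨-, ⟨c, d, hcd⟩, -⟩ := hh
    obtain rfl := hP.unique hcd haP hbP
    exact hf.2 _ _ rfl

theorem Valid.expo_mult {h : PS.Pre} (hh : Valid h) (hf : Free P h) (hP : PairEq P a b)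
    (v : PS.Γ P) : expo (mult h P v) a = PS.exp P a v := by
  rcases PS.cases hP v with ⟨i, rfl⟩ | ⟨j, hj, rfl⟩ | ⟨i, j, hi, hj, rfl⟩ | ⟨j, i, hj, hi, rfl⟩ | hv
  · rw [mult_pow _ hP, hh.expo_add (hf.1 a hP.left), PS.exp_pow hP]
  · rw [mult_pow _ hP.symm, (hh.fits_add hf hP hj).expo, PS.exp_other_pow hP]
  · rw [mult_pow_mul_pow _ hP hi hj, PS.exp_pow_mul_pow hP _ _ hj, expo, if_neg hP.ne.symm]
  · rw [mult_pow_mul_pow _ hP.symm hj hi, PS.exp_mul hP, PS.exp_other_pow hP, expo, if_pos rfl,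
      zero_add]
  · rw [mult_big _ hP hv, expo, if_pos hP.left]

theorem Valid.mult_mul_pow_aux {h : PS.Pre} (hh : Valid h) (hf : Free P h) (hP : PairEq P a b)
    (hs : ∀ k, strip (Pre.add h a k) a = h) (v : PS.Γ P) (hv0 : PS.exp P a v = 0) (k : ℤ) :
    mult h P (v * PS.g P a ^ k) = Pre.add (mult h P v) a k := by
  by_cases hk : k = 0
  · subst hk; simp
  rcases PS.cases hP v with ⟨i, rfl⟩ | ⟨j, hj, rfl⟩ | ⟨i, j, hi, hj, rfl⟩ | ⟨j, i, hj, hi, rfl⟩ | hv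
  · rw [PS.exp_pow hP] at hv0
    subst hv0
    rw [zpow_zero, one_mul, mult_pow _ hP, mult_one]
  · rw [mult_pow_mul_pow _ hP.symm hj hk, mult_pow _ hP.symm, (hh.fits_add hf hP hj).add hk]
  · rw [mult_big _ hP (PS.big_pow_mul_pow_mul_pow hP hi hj hk), mult_pow_mul_pow _ hP hi hj,
      add_syl _ hk, hh.expo_add (hf.1 a hP.left), if_pos hi, hs]
    obtain rfl := hP.eq
    rfl
  · rw [PS.exp_mul hP, PS.exp_other_pow hP, zero_add] at hv0
    exact absurd hv0 hi
  · rw [mult_big _ hP hv, mult_big _ hP (hv.mul_pow PS hP hv0 k), add_blk _ _ _ _ hk,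
      if_pos hP.left]

theorem Valid.strip_add_aux {x : PS.Pre} (hx : Valid x) : ∀ a,
    (expo x a = 0 → ∀ k, strip (Pre.add x a k) a = x) ∧
      Pre.add (strip x a) a (expo x a) = x ∧ expo (strip x a) a = 0 := by
  induction x with
  | one =>
    intro a
    refine ⟨fun _ k => ?_, add_zero _ _, rfl⟩
    by_cases hk : k = 0
    · subst hk; simp
    · rw [add_one hk, strip_syl, if_pos rfl]
  | syl y c n ih =>
    intro a
    have hx' := hx
    obtain ⟨hn, hy, hf⟩ := hx
    constructor
    · intro ha k
      by_cases hk : k = 0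
      · subst hk; rw [add_zero, hx'.strip_eq ha]
      have hac := hx'.ne_of_expo ha
      have hp : PairEq {a, c} a c := ⟨hac, rfl⟩
      rw [add_syl _ hk]
      split_ifs with h
      · rw [strip_blk, PS.exp_mul hp, PS.exp_pow_mul_pow hp _ _ hn, zero_add,
          if_pos ⟨hp.left, hk⟩, zpow_neg, mul_inv_cancel_right, mult_pow_mul_pow _ hp h hn,
          (ih hy a).2.1]
      · rw [strip_syl, if_pos rfl]
    · rw [strip_syl]
      split_ifs with h
      · subst h
        rw [expo, if_pos rfl, hf.add hn]
        exact ⟨rfl, hf.expo⟩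
      · rw [expo, if_neg h, add_zero]
        exact ⟨rfl, rfl⟩
  | blk h P e ih =>
    intro a
    have hx' := hx
    obtain ⟨hh, ⟨c, d, hcd⟩, hf, he⟩ := hx
    constructor
    · intro ha k
      by_cases hk : k = 0
      · subst hk; rw [add_zero, hx'.strip_eq ha]
      rw [add_blk _ _ _ _ hk]
      split_ifs with haP
      · obtain ⟨d, hp⟩ := hcd.exists_of_mem haP
        rw [expo, if_pos haP] at ha
        rw [strip_blk, PS.exp_mul hp, ha, zero_add, if_pos ⟨haP, hk⟩, zpow_neg,
          mul_inv_cancel_right, mult_big _ hp he]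
      · rw [strip_syl, if_pos rfl]
    · rw [strip_blk]
      split_ifs with h1
      · obtain ⟨d, hp⟩ := hcd.exists_of_mem h1.1
        have h2 : PS.exp P a (e * PS.g P a ^ (-PS.exp P a e)) = 0 := by
          rw [PS.exp_mul hp, add_neg_cancel]
        constructor
        · rw [expo, if_pos h1.1, ← hh.mult_mul_pow_aux hf hp ((ih hh a).1 (hf.1 a h1.1)) _ h2,
            zpow_neg, inv_mul_cancel_right, mult_big _ hp he]
        · rw [hh.expo_mult hf hp, h2]
      · have h2 : expo (blk h P e) a = 0 := by
          rw [expo]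
          split_ifs with h3
          · by_contra h4
            exact h1 ⟨h3, h4⟩
          · rfl
        rw [h2, add_zero]
        exact ⟨rfl, rfl⟩

theorem Valid.strip_add {x : PS.Pre} (hx : Valid x) (ha : expo x a = 0) (k : ℤ) :
    strip (Pre.add x a k) a = x := (hx.strip_add_aux a).1 ha k

theorem Valid.add_strip {x : PS.Pre} (hx : Valid x) (a : S) :
    Pre.add (strip x a) a (expo x a) = x := (hx.strip_add_aux a).2.1

theorem Valid.expo_strip {x : PS.Pre} (hx : Valid x) (a : S) : expo (strip x a) a = 0 :=
  (hx.strip_add_aux a).2.2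

theorem Valid.mult_mul_pow {h : PS.Pre} (hh : Valid h) (hf : Free P h) (hP : PairEq P a b)
    (v : PS.Γ P) (hv0 : PS.exp P a v = 0) (k : ℤ) :
    mult h P (v * PS.g P a ^ k) = Pre.add (mult h P v) a k :=
  hh.mult_mul_pow_aux hf hP (hh.strip_add (hf.1 a hP.left)) v hv0 k

theorem strip_blk_cases (h : PS.Pre) (hP : PairEq P a b) {e : PS.Γ P} (he : PS.Big P e) :
    (∃ i j : ℤ, i ≠ 0 ∧ j ≠ 0 ∧ strip (blk h P e) a = syl (Pre.add h a i) b j) ∨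
    (∃ v, PS.Big P v ∧ PS.exp P a v = 0 ∧ strip (blk h P e) a = blk h P v) := by
  rw [strip_blk]
  split_ifs with h1
  · set k := PS.exp P a e
    set v := e * PS.g P a ^ (-k) with hv
    have hev : e = v * PS.g P a ^ k := by rw [hv, zpow_neg, inv_mul_cancel_right]
    have hv0 : PS.exp P a v = 0 := by rw [hv, PS.exp_mul hP, add_neg_cancel]
    rcases PS.cases hP v with ⟨i, e1⟩ | ⟨j, hj, e1⟩ | ⟨i, j, hi, hj, e1⟩ | ⟨j, i, hj, hi, e1⟩ | hv
    · rw [e1, ← zpow_add] at hev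
      exact absurd hev (he.ne_pow PS hP _)
    · rw [e1] at hev
      exact absurd hev (he _ _ hP.symm _ _)
    · exact Or.inl ⟨i, j, hi, hj, by rw [e1, mult_pow_mul_pow _ hP hi hj]⟩
    · rw [e1, mul_assoc, ← zpow_add] at hev
      exact absurd hev (he _ _ hP.symm _ _)
    · exact Or.inr ⟨v, hv, hv0, mult_big _ hP hv⟩
  · exact Or.inr ⟨e, he, by by_contra h2; exact h1 ⟨hP.left, h2⟩, rfl⟩

/-- Stripping a block is invisible from outside the block. -/
theorem strip_blk_outside {Q : Set S} (h : PS.Pre) (hQ : PairEq Q a b) {e : PS.Γ Q}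
    (he : PS.Big Q e) {c : S} (hc : c ∉ Q) : expo (strip (blk h Q e) a) c = 0 ∧
      ∀ P h' e', c ∈ P → strip (blk h Q e) a ≠ blk h' P e' := by
  rcases strip_blk_cases h hQ he with ⟨i, j, hi, hj, e1⟩ | ⟨v, hv, hv0, e1⟩ <;> rw [e1]
  · refine ⟨if_neg ?_, by simp⟩
    rintro rfl
    exact hc hQ.right
  · refine ⟨if_neg hc, fun P h' e' hcP e2 => ?_⟩
    simp only [blk.injEq] at e2
    exact hc (e2.2.1 ▸ hcP)

theorem Valid.free_strip {y : PS.Pre} {c : S} {n : ℤ} (hx : Valid (syl y c n)) (hac : a ≠ c) :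
    Free {a, c} (strip y a) := by
  obtain ⟨-, hy, hf⟩ := hx
  have key : expo (strip y a) c = 0 ∧ ∀ h e, strip y a ≠ blk h {a, c} e := by
    cases y with
    | one => simp [expo]
    | syl z d i =>
      rw [strip_syl]
      split_ifs with hda
      · subst hda
        refine ⟨hf.2, ?_⟩
        rintro h e rfl
        exact hy.2.2 (by simp)
      · exact ⟨if_neg hf.1, by simp⟩
    | blk h Q e =>
      by_cases haQ : a ∈ Q
      · obtain ⟨-, ⟨p, q, hpq⟩, -, he⟩ := hy
        obtain ⟨d, hQ⟩ := hpq.exists_of_mem haQ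
        have := strip_blk_outside h hQ he (c := c) hf
        exact ⟨this.1, fun h' e' => this.2 _ _ _ (by simp)⟩
      · rw [strip_blk, if_neg (fun h => haQ h.1)]
        refine ⟨if_neg hf, fun h' e' e2 => ?_⟩
        simp only [blk.injEq] at e2
        exact haQ (e2.2.1 ▸ by simp)
  refine ⟨?_, key.2⟩
  rintro d (rfl | rfl)
  exacts [hy.expo_strip _, key.1]

theorem Valid.mult_aux {h : PS.Pre} (hh : Valid h) (hf : Free P h) (hP : PairEq P a b)
    (hv : ∀ a k, expo h a = 0 → Valid (Pre.add h a k)) (v : PS.Γ P) : Valid (mult h P v) := by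
  rcases PS.cases hP v with ⟨i, rfl⟩ | ⟨j, hj, rfl⟩ | ⟨i, j, hi, hj, rfl⟩ | ⟨j, i, hj, hi, rfl⟩ | h1
  · rw [mult_pow _ hP]; exact hv _ _ (hf.1 _ hP.left)
  · rw [mult_pow _ hP.symm]; exact hv _ _ (hf.1 _ hP.right)
  · rw [mult_pow_mul_pow _ hP hi hj]
    exact ⟨hj, hv _ _ (hf.1 _ hP.left), hh.fits_add hf hP.symm hi⟩
  · rw [mult_pow_mul_pow _ hP.symm hj hi]
    exact ⟨hi, hv _ _ (hf.1 _ hP.right), hh.fits_add hf hP hj⟩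
  · rw [mult_big _ hP h1]
    exact ⟨hh, ⟨_, _, hP⟩, hf, h1⟩

theorem Valid.strip_and_add {x : PS.Pre} (hx : Valid x) :
    ∀ a, Valid (strip x a) ∧ ∀ k, expo x a = 0 → Valid (Pre.add x a k) := by
  induction x with
  | one =>
    intro a
    refine ⟨trivial, fun k _ => ?_⟩
    by_cases hk : k = 0
    · subst hk; simpa
    · rw [add_one hk]; exact ⟨hk, trivial, trivial⟩
  | syl y c n ih =>
    intro a
    have hx' := hx
    obtain ⟨hn, hy, hf⟩ := hx
    constructor
    · rw [strip_syl]
      split_ifs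
      exacts [hy, hx']
    · intro k ha
      by_cases hk : k = 0
      · subst hk; simpa
      rcases hx'.add_cases ha hk with ⟨e, h⟩ | ⟨y', c', n', h1, hac, hy', e⟩ | ⟨h, P, e, h1, -⟩
      · rw [e]; exact ⟨hk, hx', h⟩
      · simp only [syl.injEq] at h1
        obtain ⟨rfl, rfl, rfl⟩ := h1
        rw [e]
        have hp : PairEq {a, c} a c := ⟨hac, rfl⟩
        exact ⟨(ih hy a).1, ⟨a, c, hp⟩, hx'.free_strip hac,
          PS.big_pow_mul_pow_mul_pow hp hy' hn hk⟩
      · simp at h1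
  | blk h P e ih =>
    intro a
    have hx' := hx
    obtain ⟨hh, ⟨c, d, hcd⟩, hf, he⟩ := hx
    constructor
    · rw [strip_blk]
      split_ifs
      exacts [hh.mult_aux hf hcd (fun a k => (ih hh a).2 k) _, hx']
    · intro k ha
      by_cases hk : k = 0
      · subst hk; simpa
      rw [add_blk _ _ _ _ hk]
      split_ifs with h1
      · obtain ⟨d, hp⟩ := hcd.exists_of_mem h1
        rw [expo, if_pos h1] at ha
        exact ⟨hh, ⟨c, _, hcd⟩, hf, he.mul_pow PS hp ha k⟩
      · exact ⟨hk, hx', h1⟩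

theorem Valid.strip {x : PS.Pre} (hx : Valid x) (a : S) : Valid (Pre.strip x a) :=
  (hx.strip_and_add a).1

theorem Valid.add {x : PS.Pre} (hx : Valid x) (ha : expo x a = 0) (k : ℤ) :
    Valid (Pre.add x a k) := (hx.strip_and_add a).2 k ha

theorem Valid.mult {h : PS.Pre} (hh : Valid h) (hf : Free P h) (hP : PairEq P a b) (v : PS.Γ P) :
    Valid (Pre.mult h P v) :=
  hh.mult_aux hf hP (fun _ k ha => hh.add ha k) v

theorem Valid.exists_mult {x : PS.Pre} (hx : Valid x) (hP : PairEq P a b) :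
    ∃ h v, Valid h ∧ Free P h ∧ x = Pre.mult h P v := by
  by_cases hf : Free P x
  · exact ⟨x, 1, hx, hf, by simp⟩
  by_cases hb : ∃ h e, x = blk h P e
  · obtain ⟨h, e, rfl⟩ := hb
    exact ⟨h, e, hx.1, hx.2.2.1, (mult_big _ hP hx.2.2.2).symm⟩
  push Not at hb
  have : ∃ c ∈ P, expo x c ≠ 0 := by
    by_contra h
    push Not at h
    exact hf ⟨h, hb⟩
  obtain ⟨c, hc, hxc⟩ := this
  obtain ⟨d, hp⟩ := hP.exists_of_mem hc
  cases x with
  | one => exact absurd rfl hxc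
  | syl y c' k =>
    have hcc : c' = c := by
      by_contra h
      exact hxc (if_neg h)
    subst hcc
    have hx' := hx
    obtain ⟨hk, hy, hfit⟩ := hx
    by_cases hd : expo y d = 0
    · refine ⟨y, PS.g P c' ^ k, hy, ⟨fun e he => ?_, ?_⟩, by rw [mult_pow _ hp, hfit.add hk]⟩
      · rcases hp.mem_iff.1 he with rfl | rfl
        exacts [hfit.expo, hd]
      · rintro h e rfl
        exact hfit hc
    · refine ⟨Pre.strip y d, PS.g P d ^ expo y d * PS.g P c' ^ k, hy.strip d, ?_, ?_⟩
      · rw [hp.symm.eq]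
        exact hx'.free_strip hp.ne.symm
      · rw [mult_pow_mul_pow _ hp.symm hd hk, hy.add_strip]
  | blk h Q e =>
    have hQc : c ∈ Q := by
      by_contra h
      exact hxc (if_neg h)
    have hPQ : Q ≠ P := by
      rintro rfl
      exact hb _ _ rfl
    obtain ⟨p, q, hpq⟩ := hx.2.1
    obtain ⟨r, hQ⟩ := hpq.exists_of_mem hQc
    have hd : d ∉ Q := fun hd => hPQ (hp.unique hpq hQc hd)
    have h1 := strip_blk_outside h hQ hx.2.2.2 hd
    refine ⟨Pre.strip (blk h Q e) c, PS.g P c ^ expo (blk h Q e) c, hx.strip c,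
      ⟨fun f hf => ?_, fun h' e' => h1.2 P h' e' hp.right⟩, by rw [mult_pow _ hp, hx.add_strip]⟩
    rcases hp.mem_iff.1 hf with rfl | rfl
    exacts [hx.expo_strip _, h1.1]

end Pre

end PairSystem

end

section

universe u

variable {S : Type u}

theorem singleton_eq_powW (l : S × Bool) : [l] = powW l.1 (if l.2 then 1 else -1) := by
  obtain ⟨a, b⟩ := l
  cases b <;> simp

/-- Induction on words, adding powers of generators at the end. -/
@[elab_as_elim]
theorem word_induction {p : Word S → Prop} (w : Word S) (nil : p [])
    (append : ∀ w a k, p w → p (w ++ powW a k)) : p w := by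
  induction w using List.reverseRecOn with
  | nil => exact nil
  | append_singleton w l ih => rw [singleton_eq_powW l]; exact append _ _ _ ih

/-- Induction on words over `T`, adding powers of generators at the end. -/
@[elab_as_elim]
theorem WordOver.induction {T : Set S} {p : Word S → Prop} {w : Word S} (hw : WordOver T w)
    (nil : p []) (append : ∀ w a k, a ∈ T → p w → p (w ++ powW a k)) : p w := by
  induction w using List.reverseRecOn with
  | nil => exact nil
  | append_singleton w l ih =>
    rw [wordOver_append] at hw
    rw [singleton_eq_powW l]
    exact append _ _ _ (hw.2 l (by simp)) (ih hw.1)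

namespace PairSystem

variable {PS : PairSystem S} {P : Set S} {a b : S}

variable (PS) in
/-- The valid normal forms. -/
abbrev NF : Type u := {x : PS.Pre // x.Valid}

namespace Pre

/-- Right multiplication by `a ^ i`. -/
noncomputable def act (x : PS.Pre) (a : S) (i : ℤ) : PS.Pre := add (strip x a) a (expo x a + i)

theorem Valid.act {x : PS.Pre} (hx : Valid x) (a : S) (i : ℤ) : Valid (act x a i) :=
  (hx.strip a).add (hx.expo_strip a) _

theorem Valid.act_zero {x : PS.Pre} (hx : Valid x) (a : S) : Pre.act x a 0 = x := by
  rw [Pre.act, _root_.add_zero, hx.add_strip]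

theorem Valid.act_act {x : PS.Pre} (hx : Valid x) (a : S) (i j : ℤ) :
    Pre.act (Pre.act x a i) a j = Pre.act x a (i + j) := by
  have h1 := (hx.strip a).strip_add (hx.expo_strip a) (Pre.expo x a + i)
  have h2 := (hx.strip a).expo_add (hx.expo_strip a) (Pre.expo x a + i)
  rw [Pre.act, Pre.act, h1, h2, Pre.act, add_assoc]

theorem Valid.act_eq_add {x : PS.Pre} (hx : Valid x) (ha : Pre.expo x a = 0) (i : ℤ) :
    Pre.act x a i = Pre.add x a i := by
  rw [Pre.act, ha, zero_add, hx.strip_eq ha]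

theorem Valid.act_mult {h : PS.Pre} (hh : Valid h) (hf : Free P h) (hP : PairEq P a b)
    (v : PS.Γ P) (i : ℤ) : Pre.act (Pre.mult h P v) a i = Pre.mult h P (v * PS.g P a ^ i) := by
  set k := PS.exp P a v
  set w := v * PS.g P a ^ (-k) with hw
  have hvw : v = w * PS.g P a ^ k := by rw [hw, zpow_neg, inv_mul_cancel_right]
  have hw0 : PS.exp P a w = 0 := by rw [hw, PS.exp_mul hP, add_neg_cancel]
  have hm : Pre.expo (Pre.mult h P w) a = 0 := by rw [hh.expo_mult hf hP, hw0]
  have hM := hh.mult hf hP w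
  rw [hvw, hh.mult_mul_pow hf hP w hw0, ← hM.act_eq_add hm, hM.act_act, hM.act_eq_add hm,
    mul_assoc, ← zpow_add, hh.mult_mul_pow hf hP w hw0]

end Pre

variable (PS) in
/-- The permutation of normal forms given by right multiplication by `a ^ i`. -/
noncomputable def actPerm (a : S) (i : ℤ) : Equiv.Perm PS.NF where
  toFun x := ⟨x.1.act a i, x.2.act a i⟩
  invFun x := ⟨x.1.act a (-i), x.2.act a (-i)⟩
  left_inv x := Subtype.ext (by simp [x.2.act_act, x.2.act_zero])
  right_inv x := Subtype.ext (by simp [x.2.act_act, x.2.act_zero])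

variable (PS) in
theorem actPerm_zpow (a : S) (i : ℤ) : PS.actPerm a 1 ^ i = PS.actPerm a i := by
  let ψ : Multiplicative ℤ →* Equiv.Perm PS.NF :=
    ⟨⟨fun i => PS.actPerm a i.toAdd, Equiv.ext fun x => Subtype.ext (x.2.act_zero a)⟩, fun i j => by
      refine Equiv.ext fun x => Subtype.ext ?_
      change _ = Pre.act (Pre.act _ _ _) _ _
      rw [x.2.act_act, add_comm]
      rfl⟩
  have := map_zpow ψ (Multiplicative.ofAdd 1) i
  rw [← ofAdd_zsmul, zsmul_eq_mul, mul_one] at this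
  exact this.symm

theorem altProd_actPerm {h : PS.Pre} (hh : h.Valid) (hf : h.Free P) (hP : PairEq P a b) (v : PS.Γ P)
    (k : ℕ) : ((altProd (MulOpposite.op (PS.actPerm a 1)) (MulOpposite.op (PS.actPerm b 1)) k).unop
      ⟨h.mult P v, hh.mult hf hP v⟩).1 = h.mult P (v * altProd (PS.g P a) (PS.g P b) k) := by
  induction k generalizing a b v with
  | zero => rw [altProd, altProd, mul_one]; rfl
  | succ k ih =>
    have e : PS.actPerm a 1 ⟨h.mult P v, hh.mult hf hP v⟩ =
        ⟨h.mult P (v * PS.g P a), hh.mult hf hP _⟩ :=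
      Subtype.ext ((hh.act_mult hf hP v 1).trans (by rw [zpow_one]))
    rw [altProd, MulOpposite.unop_mul, Equiv.Perm.mul_apply, MulOpposite.unop_op, e,
      altProd, ← mul_assoc]
    exact ih hP.symm _

/-- The Artin-Tits group acts on the normal forms. -/
theorem exists_run (A : ArtinData S) (hrel : ∀ {P : Set S} {a b : S} {k : ℕ}, PairEq P a b →
      A.m a b = k → altProd (PS.g P a) (PS.g P b) k = altProd (PS.g P b) (PS.g P a) k) :
    ∃ run : PS.NF → ArtinGroup A → PS.NF, (∀ x, run x 1 = x) ∧
      (∀ x g h, run x (g * h) = run (run x g) h) ∧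
      ∀ x a i, (run x (gen A a ^ i)).1 = x.1.act a i := by
  let f : S → (Equiv.Perm PS.NF)ᵐᵒᵖ := fun a => MulOpposite.op (PS.actPerm a 1)
  obtain ⟨φ, hφ⟩ := exists_artinLift A (fun w => FreeGroup.lift f (FreeGroup.mk w)) (map_one _)
    (fun u v => by rw [← FreeGroup.mul_mk, map_mul]) (fun s => by
      rw [← map_inv, FreeGroup.inv_mk]; rfl) (by
      rintro _ _ ⟨s, t, k, hst, hk, rfl, rfl⟩
      rw [lift_altWord, lift_altWord]
      apply MulOpposite.unop_injective
      apply Equiv.ext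
      rintro ⟨x, hx⟩
      apply Subtype.ext
      have hP : PairEq {s, t} s t := ⟨hst, rfl⟩
      obtain ⟨h, v, hh, hf, rfl⟩ := hx.exists_mult hP
      rw [altProd_actPerm hh hf hP, altProd_actPerm hh hf hP.symm, hrel hP hk])
  refine ⟨fun x g => (φ g).unop x, fun x => by simp, fun x g h => by simp, fun x a i => ?_⟩
  have h1 : φ (gen A a) = f a := (hφ _).trans (by simp)
  change ((φ (gen A a ^ i)).unop x).1 = _
  rw [map_zpow, h1, MulOpposite.unop_zpow, MulOpposite.unop_op, actPerm_zpow]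
  rfl

end PairSystem

/-- A pair system together with words representing the elements of the pair groups. -/
structure WordSystem (A : ArtinData S) extends PairSystem S where
  rel : ∀ {P : Set S} {a b : S} {k : ℕ}, PairEq P a b → A.m a b = k →
    altProd (g P a) (g P b) k = altProd (g P b) (g P a) k
  N : ∀ P, Γ P → Word S
  wordOver_N : ∀ P v, WordOver P (N P v)
  eval : ∀ {P a b}, PairEq P a b → ∀ v, FreeGroup.lift (g P) (FreeGroup.mk (N P v)) = v
  N_one : ∀ P, N P 1 = []
  N_pow : ∀ {P a b}, PairEq P a b → ∀ i : ℤ, N P (g P a ^ i) = powW a i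
  N_pow_mul_pow : ∀ {P a b}, PairEq P a b → ∀ i j : ℤ,
    N P (g P a ^ i * g P b ^ j) = powW a i ++ powW b j
  steps_mul : ∀ {P a b}, PairEq P a b → ∀ v (k : ℤ),
    Steps012 A (N P v ++ powW a k) (N P (v * g P a ^ k))
  steps_exp : ∀ {P a b}, PairEq P a b → ∀ v,
    Steps012 A (N P v) (N P (v * g P a ^ (-exp P a v)) ++ powW a (exp P a v))

namespace WordSystem

open PairSystem Pre

variable {A : ArtinData S} {W : WordSystem A} {P : Set S} {a b : S}

/-- The word of a normal form. -/
def wd : W.Pre → Word S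
  | one => []
  | syl y a k => wd y ++ powW a k
  | blk h P e => wd h ++ W.N P e

theorem steps_mult_aux {h : W.Pre}
    (H : ∀ a, expo h a = 0 → ∀ k, Steps012 A (wd h ++ powW a k) (wd (add h a k)))
    (hf : Free P h) (hP : PairEq P a b) (v : W.Γ P) :
    Steps012 A (wd h ++ W.N P v) (wd (mult h P v)) := by
  have key : ∀ {a b}, PairEq P a b → ∀ i j : ℤ, i ≠ 0 → j ≠ 0 →
      Steps012 A (wd h ++ W.N P (W.g P a ^ i * W.g P b ^ j))
        (wd (mult h P (W.g P a ^ i * W.g P b ^ j))) := by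
    intro a b hP i j hi hj
    rw [mult_pow_mul_pow _ hP hi hj, W.N_pow_mul_pow hP, ← append_assoc]
    exact (H a (hf.1 a hP.left) i).append (.refl _ _)
  rcases W.cases hP v with ⟨i, rfl⟩ | ⟨j, hj, rfl⟩ | ⟨i, j, hi, hj, rfl⟩ | ⟨j, i, hj, hi, rfl⟩ | hv
  · rw [mult_pow _ hP, W.N_pow hP]; exact H a (hf.1 a hP.left) i
  · rw [mult_pow _ hP.symm, W.N_pow hP.symm]; exact H b (hf.1 b hP.right) j
  · exact key hP i j hi hj
  · exact key hP.symm j i hj hi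
  · rw [mult_big _ hP hv]; exact .refl _ _

theorem steps_aux {x : W.Pre} (hx : Valid x) : ∀ a,
    (expo x a = 0 → ∀ k, Steps012 A (wd x ++ powW a k) (wd (add x a k))) ∧
      Steps012 A (wd x) (wd (strip x a) ++ powW a (expo x a)) := by
  induction x with
  | one =>
    intro a
    refine ⟨fun _ k => ?_, .refl _ _⟩
    by_cases hk : k = 0
    · subst hk; exact .refl _ _
    · rw [add_one hk]; exact .refl _ _
  | syl y c n ih =>
    intro a
    have hx' := hx
    obtain ⟨hn, hy, hf⟩ := hx
    constructor
    · intro ha k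
      by_cases hk : k = 0
      · subst hk; simpa using .refl _ _
      have hac := hx'.ne_of_expo ha
      have hp : PairEq {a, c} a c := ⟨hac, rfl⟩
      rw [add_syl _ hk]
      split_ifs with h
      · refine Steps012.trans (((ih hy a).2.append (.refl _ _)).append (.refl _ _)) ?_
        have := W.steps_mul hp (W.g {a, c} a ^ expo y a * W.g {a, c} c ^ n) k
        rw [W.N_pow_mul_pow hp] at this
        simpa [wd] using (Steps012.refl A (wd (strip y a))).append this
      · exact .refl _ _
    · rw [strip_syl]
      split_ifs with h
      · subst h
        rw [expo, if_pos rfl]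
        exact .refl _ _
      · rw [expo, if_neg h]
        simpa using .refl _ _
  | blk h P e ih =>
    intro a
    have hx' := hx
    obtain ⟨hh, ⟨c, d, hcd⟩, hf, he⟩ := hx
    constructor
    · intro ha k
      by_cases hk : k = 0
      · subst hk; simpa using .refl _ _
      rw [add_blk _ _ _ _ hk]
      split_ifs with haP
      · obtain ⟨d, hp⟩ := hcd.exists_of_mem haP
        simpa [wd] using (Steps012.refl A (wd h)).append (W.steps_mul hp e k)
      · exact .refl _ _
    · rw [strip_blk, expo]
      by_cases haP : a ∈ P
      · obtain ⟨d, hp⟩ := hcd.exists_of_mem haP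
        rw [if_pos haP]
        split_ifs with h1
        · have := (Steps012.refl A (wd h)).append (W.steps_exp hp e)
          rw [← append_assoc] at this
          exact this.trans ((steps_mult_aux (fun a => (ih hh a).1) hf hp _).append (.refl _ _))
        · have h2 : W.exp P a e = 0 := by
            by_contra h2
            exact h1 ⟨haP, h2⟩
          rw [h2]
          simpa using .refl _ _
      · rw [if_neg haP, if_neg fun h => haP h.1]
        simpa using .refl _ _

theorem steps_add {x : W.Pre} (hx : Valid x) (ha : expo x a = 0) (k : ℤ) :
    Steps012 A (wd x ++ powW a k) (wd (add x a k)) := (steps_aux hx a).1 ha k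

theorem steps_strip {x : W.Pre} (hx : Valid x) (a : S) :
    Steps012 A (wd x) (wd (strip x a) ++ powW a (expo x a)) := (steps_aux hx a).2

theorem steps_act {x : W.Pre} (hx : Valid x) (a : S) (k : ℤ) :
    Steps012 A (wd x ++ powW a k) (wd (act x a k)) := by
  refine ((steps_strip hx a).append (.refl _ _)).trans ?_
  rw [append_assoc]
  exact ((Steps012.refl _ _).append (steps_powW_add A a _ _)).trans
    (steps_add (hx.strip a) (hx.expo_strip a) _)

end WordSystem

end

section

universe u

variable {S : Type u}

namespace PairSystem

variable {PS : PairSystem S} {P : Set S} {a b : S}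

namespace Pre

/-- Normal forms that do not end in `S₀`. -/
def Red (S₀ : Set S) : PS.Pre → Prop
  | one => True
  | syl _ c _ => c ∉ S₀
  | blk _ Q e => ¬ Q ⊆ S₀ ∧ ∀ a ∈ Q, a ∈ S₀ → PS.exp Q a e = 0

/-- Normal forms with all letters in `S₀`. -/
def Over (S₀ : Set S) : PS.Pre → Prop
  | one => True
  | syl y c _ => Over S₀ y ∧ c ∈ S₀
  | blk h Q _ => Over S₀ h ∧ Q ⊆ S₀

/-- Concatenation of normal forms. -/
noncomputable def cat (r : PS.Pre) : PS.Pre → PS.Pre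
  | one => r
  | syl y a k => add (cat r y) a k
  | blk h P e => mult (cat r h) P e

variable {S₀ : Set S}

theorem Red.expo {r : PS.Pre} (hr : Red S₀ r) (ha : a ∈ S₀) : expo r a = 0 := by
  cases r with
  | one => rfl
  | syl y c n =>
    refine if_neg ?_
    rintro rfl
    exact hr ha
  | blk h Q e =>
    rw [Pre.expo]
    split_ifs with h1
    exacts [hr.2 a h1 ha, rfl]

theorem Over.mult_aux {h : PS.Pre} (hh : Over S₀ h) (hP : PairEq P a b) (hPS : P ⊆ S₀)
    (hadd : ∀ a ∈ S₀, ∀ k, Over S₀ (add h a k)) (v : PS.Γ P) : Over S₀ (mult h P v) := by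
  have ha := hPS hP.left
  have hb := hPS hP.right
  rcases PS.cases hP v with ⟨i, rfl⟩ | ⟨j, hj, rfl⟩ | ⟨i, j, hi, hj, rfl⟩ | ⟨j, i, hj, hi, rfl⟩ | h1
  · rw [mult_pow _ hP]; exact hadd _ ha _
  · rw [mult_pow _ hP.symm]; exact hadd _ hb _
  · rw [mult_pow_mul_pow _ hP hi hj]; exact ⟨hadd _ ha _, hb⟩
  · rw [mult_pow_mul_pow _ hP.symm hj hi]; exact ⟨hadd _ hb _, ha⟩
  · rw [mult_big _ hP h1]; exact ⟨hh, hPS⟩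

theorem Over.strip_and_add {x : PS.Pre} (hx : Valid x) (ho : Over S₀ x) :
    ∀ a, Over S₀ (strip x a) ∧ ∀ k, a ∈ S₀ → Over S₀ (add x a k) := by
  induction x with
  | one =>
    refine fun a => ⟨trivial, fun k ha => ?_⟩
    by_cases hk : k = 0
    · subst hk; exact trivial
    · rw [add_one hk]; exact ⟨trivial, ha⟩
  | syl y c n ih =>
    intro a
    constructor
    · rw [strip_syl]
      split_ifs
      exacts [ho.1, ho]
    · intro k ha
      by_cases hk : k = 0
      · subst hk; simpa
      rw [add_syl _ hk]
      split_ifs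
      · refine ⟨(ih hx.2.1 ho.1 a).1, ?_⟩
        rintro d (rfl | rfl)
        exacts [ha, ho.2]
      · exact ⟨ho, ha⟩
  | blk h P e ih =>
    intro a
    obtain ⟨c, d, hcd⟩ := hx.2.1
    constructor
    · rw [strip_blk]
      split_ifs
      · exact ho.1.mult_aux hcd ho.2 (fun a ha k => (ih hx.1 ho.1 a).2 k ha) _
      · exact ho
    · intro k ha
      by_cases hk : k = 0
      · subst hk; simpa
      rw [add_blk _ _ _ _ hk]
      split_ifs
      exacts [ho, ⟨ho, ha⟩]

/-- Compatibility of the concatenation `cat r z` with the other operations. -/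
structure Cat (S₀ : Set S) (r z : PS.Pre) : Prop where
  valid : Valid (cat r z)
  expo : ∀ a ∈ S₀, expo (cat r z) a = Pre.expo z a
  strip : ∀ a ∈ S₀, strip (cat r z) a = cat r (Pre.strip z a)
  free : ∀ P a b, PairEq P a b → a ∈ S₀ → b ∈ S₀ → Free P (Pre.strip z b) →
    Free P (Pre.strip (cat r z) b)
  add : ∀ a ∈ S₀, ∀ k, Pre.expo z a = 0 → add (cat r z) a k = cat r (Pre.add z a k)

theorem add_eq_blk {x h : PS.Pre} {P : Set S} {e : PS.Γ P} {c : S} {n : ℤ} (hn : n ≠ 0)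
    (he : add x c n = blk h P e) : c ∈ P := by
  cases x with
  | one => simp [add_one hn] at he
  | syl y d m =>
    rw [add_syl _ hn] at he
    split_ifs at he
    simp only [blk.injEq] at he
    rw [← he.2.1]
    simp
  | blk h' Q e' =>
    rw [add_blk _ _ _ _ hn] at he
    split_ifs at he with h1
    simp only [blk.injEq] at he
    exact he.2.1 ▸ h1

theorem Red.cat_one {r : PS.Pre} (hv : Valid r) (hr : Red S₀ r) : Cat S₀ r one where
  valid := hv
  expo a ha := hr.expo ha
  strip a ha := hv.strip_eq (hr.expo ha)
  free P a b hP ha hb _ := by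
    rw [cat, hv.strip_eq (hr.expo hb)]
    constructor
    · intro c hc
      rcases hP.mem_iff.1 hc with rfl | rfl
      exacts [hr.expo ha, hr.expo hb]
    · rintro h e rfl
      refine hr.1 fun c hc => ?_
      rcases hP.mem_iff.1 hc with rfl | rfl
      exacts [ha, hb]
  add a ha k _ := by
    by_cases hk : k = 0
    · subst hk; simp
    · rw [add_one hk]; rfl

/-- Without an `a`-syllable to strip, the concatenation preserves freeness. -/
theorem Cat.free_of_expo {r y : PS.Pre} (H : Cat S₀ r y) (hy : Valid y) (hP : PairEq P a b)
    (ha : a ∈ S₀) (hb : b ∈ S₀) (hf : Free P y) : Free P (cat r y) := by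
  have h0 := hf.1 b hP.right
  have := H.free P a b hP ha hb (by rwa [hy.strip_eq h0])
  rwa [H.valid.strip_eq (by rw [H.expo b hb, h0])] at this

theorem Cat.syl {r y : PS.Pre} {c : S} {n : ℤ} (H : Cat S₀ r y) (hz : Valid (syl y c n))
    (hc : c ∈ S₀) : Cat S₀ r (syl y c n) := by
  obtain ⟨hn, hy, hf⟩ := id hz
  have hc0 : Pre.expo (cat r y) c = 0 := by rw [H.expo c hc, hf.expo]
  have hval : Valid (cat r (Pre.syl y c n)) := H.valid.add hc0 n
  have key : ∀ a ∈ S₀, a ≠ c → Free {a, c} (cat r (Pre.strip y a)) ∧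
      Valid (cat r (Pre.strip y a)) ∧ cat r (Pre.syl y c n) =
        mult (cat r (Pre.strip y a)) {a, c}
          (PS.g {a, c} a ^ Pre.expo y a * PS.g {a, c} c ^ n) := by
    intro a ha hac
    have hp : PairEq {a, c} a c := ⟨hac, rfl⟩
    have h1 := H.free _ _ _ hp.symm hc ha (hz.free_strip hac)
    rw [H.strip a ha] at h1
    have h2 := H.valid.strip a
    rw [H.strip a ha] at h2
    refine ⟨h1, h2, ?_⟩
    rw [h2.mult_mul_pow h1 hp.symm _ (PS.exp_other_pow hp.symm _), mult_pow _ hp, ← H.strip a ha,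
      ← H.expo a ha, H.valid.add_strip, cat]
  have hexpo : ∀ a ∈ S₀, Pre.expo (cat r (Pre.syl y c n)) a = Pre.expo (Pre.syl y c n) a := by
    intro a ha
    by_cases hac : a = c
    · subst hac
      rw [cat, H.valid.expo_add hc0, Pre.expo, if_pos rfl]
    · obtain ⟨h1, h2, h3⟩ := key a ha hac
      have hp : PairEq {a, c} a c := ⟨hac, rfl⟩
      rw [h3, h2.expo_mult h1 hp, PS.exp_pow_mul_pow hp _ _ hn, Pre.expo, if_neg (Ne.symm hac)]
  refine ⟨hval, hexpo, fun a ha => ?_, fun P a b hP ha hb hfr => ?_, fun a ha k h0 => ?_⟩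
  · by_cases hac : a = c
    · subst hac
      rw [cat, H.valid.strip_add hc0, strip_syl, if_pos rfl]
    · have h0 : Pre.expo (Pre.syl y c n) a = 0 := if_neg (Ne.symm hac)
      rw [hval.strip_eq (by rw [hexpo a ha, h0]), hz.strip_eq h0]
  · by_cases hbc : b = c
    · subst hbc
      rw [strip_syl, if_pos rfl] at hfr
      rw [cat, H.valid.strip_add hc0]
      exact H.free_of_expo hy hP ha hb hfr
    · have h0 : Pre.expo (Pre.syl y c n) b = 0 := if_neg (Ne.symm hbc)
      rw [hz.strip_eq h0] at hfr
      rw [hval.strip_eq (by rw [hexpo b hb, h0])]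
      constructor
      · intro d hd
        have : d ∈ S₀ := by rcases hP.mem_iff.1 hd with rfl | rfl <;> assumption
        rw [hexpo d this]
        exact hfr.1 d hd
      · intro h e he
        have hcP := add_eq_blk hn he
        exact hn (by simpa [Pre.expo] using hfr.1 c hcP)
  · have hac := hz.ne_of_expo h0
    by_cases hk : k = 0
    · subst hk; simp
    rw [add_syl _ hk]
    split_ifs with h
    · obtain ⟨h1, h2, h3⟩ := key a ha hac
      have hp : PairEq {a, c} a c := ⟨hac, rfl⟩
      rw [h3, cat, h2.mult_mul_pow h1 hp _ (PS.exp_pow_mul_pow hp _ _ hn)]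
    · rfl

theorem Cat.mult {r h : PS.Pre} (H : Cat S₀ r h) (hh : Valid h) (hf : Free P h)
    (hP : PairEq P a b) (ha : a ∈ S₀) (hb : b ∈ S₀) (v : PS.Γ P) :
    cat r (mult h P v) = mult (cat r h) P v := by
  have hfc := H.free_of_expo hh hP ha hb hf
  rcases PS.cases hP v with ⟨i, rfl⟩ | ⟨j, hj, rfl⟩ | ⟨i, j, hi, hj, rfl⟩ | ⟨j, i, hj, hi, rfl⟩ | h1
  · rw [mult_pow _ hP, mult_pow _ hP, H.add a ha _ (hf.1 a hP.left)]
  · rw [mult_pow _ hP.symm, mult_pow _ hP.symm, H.add b hb _ (hf.1 b hP.right)]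
  · rw [mult_pow_mul_pow _ hP hi hj, mult_pow_mul_pow _ hP hi hj, cat,
      ← H.add a ha _ (hf.1 a hP.left), (H.valid.fits_add hfc hP.symm hi).add hj]
  · rw [mult_pow_mul_pow _ hP.symm hj hi, mult_pow_mul_pow _ hP.symm hj hi, cat,
      ← H.add b hb _ (hf.1 b hP.right), (H.valid.fits_add hfc hP hj).add hi]
  · rw [mult_big _ hP h1, cat]

theorem Cat.blk {r h : PS.Pre} {e : PS.Γ P} (H : Cat S₀ r h) (hz : Valid (blk h P e))
    (hPS : P ⊆ S₀) : Cat S₀ r (blk h P e) := by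
  obtain ⟨hh, ⟨p, q, hpq⟩, hf, he⟩ := id hz
  have hp0 := hPS hpq.left
  have hq0 := hPS hpq.right
  have hfc := H.free_of_expo hh hpq hp0 hq0 hf
  have hcat : cat r (Pre.blk h P e) = Pre.blk (cat r h) P e := mult_big _ hpq he
  have hval : Valid (Pre.blk (cat r h) P e) := ⟨H.valid, ⟨p, q, hpq⟩, hfc, he⟩
  refine ⟨by rwa [hcat], fun a _ => by rw [hcat]; rfl, fun a ha => ?_,
    fun P' a b hP' ha hb hfr => ?_, fun a ha k h0 => ?_⟩ <;> rw [hcat]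
  · rw [strip_blk, strip_blk]
    split_ifs with h1
    · rw [H.mult hh hf hpq hp0 hq0]
    · rw [hcat]
  · by_cases hbP : b ∈ P
    · obtain ⟨d, hQ⟩ := hpq.exists_of_mem hbP
      by_cases haP : a ∈ P
      · obtain rfl := hP'.unique hpq haP hbP
        exfalso
        rcases strip_blk_cases h hP'.symm he with ⟨i, j, hi, hj, e1⟩ | ⟨v, hv, hv0, e1⟩ <;>
          rw [e1] at hfr
        · exact hj (by simpa [Pre.expo] using hfr.1 a haP)
        · exact hfr.2 _ _ rfl
      · have h1 := strip_blk_outside (cat r h) hQ he haP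
        refine ⟨fun c hc => ?_, fun h' e' => h1.2 _ _ _ hP'.left⟩
        rcases hP'.mem_iff.1 hc with rfl | rfl
        exacts [h1.1, hval.expo_strip _]
    · rw [strip_blk, if_neg fun h => hbP h.1] at hfr ⊢
      refine ⟨fun c hc => hfr.1 c hc, fun h' e' e2 => ?_⟩
      simp only [Pre.blk.injEq] at e2
      exact hbP (e2.2.1 ▸ hP'.right)
  · by_cases hk : k = 0
    · subst hk; simp [hcat]
    rw [add_blk _ _ _ _ hk, add_blk _ _ _ _ hk]
    split_ifs with h1
    · obtain ⟨d, hQ⟩ := hpq.exists_of_mem h1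
      rw [Pre.expo, if_pos h1] at h0
      rw [cat, mult_big _ hQ (he.mul_pow PS hQ h0 k)]
    · rw [cat, hcat, add_blk _ _ _ _ hk, if_neg h1]

theorem Red.cat {r z : PS.Pre} (hv : Valid r) (hr : Red S₀ r) (hz : Valid z) (ho : Over S₀ z) :
    Cat S₀ r z := by
  induction z with
  | one => exact hr.cat_one hv
  | syl y c n ih => exact (ih hz.2.1 ho.1).syl hz ho.2
  | blk h P e ih => exact (ih hz.1 ho.1).blk hz ho.2

theorem Red.eq_one {r z : PS.Pre} (hv : Valid r) (hr : Red S₀ r) (hz : Valid z) (ho : Over S₀ z)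
    (h : Red S₀ (Pre.cat r z)) : z = one := by
  cases z with
  | one => rfl
  | syl y c n =>
    have := (hr.cat hv hz ho).expo c ho.2
    rw [h.expo ho.2, Pre.expo, if_pos rfl] at this
    exact absurd this.symm hz.1
  | blk h' P e =>
    obtain ⟨p, q, hpq⟩ := hz.2.1
    rw [Pre.cat, mult_big _ hpq hz.2.2.2] at h
    exact absurd ho.2 h.1

theorem Red.act_cat {r z : PS.Pre} (hv : Valid r) (hr : Red S₀ r) (hz : Valid z) (ho : Over S₀ z)
    (ha : a ∈ S₀) (i : ℤ) : act (Pre.cat r z) a i = Pre.cat r (act z a i) := by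
  have h1 := hr.cat hv hz ho
  have h2 := hr.cat hv (hz.strip a) (ho.strip_and_add hz a).1
  rw [act, h1.strip a ha, h1.expo a ha, h2.add a ha _ (hz.expo_strip a), act]

end Pre

end PairSystem

namespace WordSystem

open PairSystem Pre

variable {A : ArtinData S} {W : WordSystem A} {P : Set S} {a b : S}

/-- An action of the Artin-Tits group on the normal forms. -/
structure IsRun (W : WordSystem A) (run : W.NF → ArtinGroup A → W.NF) : Prop where
  one : ∀ x, run x 1 = x
  mul : ∀ x g h, run x (g * h) = run (run x g) h
  pow : ∀ x a i, (run x (gen A a ^ i)).1 = x.1.act a i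

/-- The trivial normal form. -/
def nfOne : W.NF := ⟨Pre.one, trivial⟩

variable {run : W.NF → ArtinGroup A → W.NF}

theorem IsRun.append (R : IsRun W run) (x : W.NF) (w : Word S) (a : S) (k : ℤ) :
    (run x (wbar A (w ++ powW a k))).1 = (run x (wbar A w)).1.act a k := by
  rw [wbar_append, R.mul, wbar_powW, R.pow]

theorem IsRun.steps (R : IsRun W run) (w : Word S) :
    Steps012 A w (wd (run nfOne (wbar A w)).1) := by
  refine word_induction w ?_ fun w a k ih => ?_
  · rw [wbar_nil, R.one]
    exact .refl _ _
  · rw [R.append]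
    exact (ih.append (.refl _ _)).trans (steps_act (run _ _).2 a k)

theorem IsRun.run_mult (R : IsRun W run) {h : W.Pre} (hh : Valid h) (hf : Free P h)
    (hP : PairEq P a b) {u : Word S} (hu : WordOver P u) :
    (run ⟨h, hh⟩ (wbar A u)).1 = mult h P (FreeGroup.lift (W.g P) (FreeGroup.mk u)) := by
  refine hu.induction ?_ fun u c k hc ih => ?_
  · rw [wbar_nil, R.one, ← FreeGroup.one_eq_mk, map_one, mult_one]
  · obtain ⟨d, hp⟩ := hP.exists_of_mem hc
    have hk : FreeGroup.lift (W.g P) (FreeGroup.mk (powW c k)) = W.g P c ^ k := by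
      rw [← W.N_pow hp, W.eval hp]
    rw [R.append, ih, hh.act_mult hf hp, ← FreeGroup.mul_mk, map_mul, hk]

theorem IsRun.run_wd (R : IsRun W run) {x : W.Pre} (hx : Valid x) :
    (run nfOne (wbar A (wd x))).1 = x := by
  induction x with
  | one => rw [wd, wbar_nil, R.one]; rfl
  | syl y c n ih =>
    rw [wd, R.append, ih hx.2.1, hx.2.1.act_eq_add hx.2.2.expo, hx.2.2.add hx.1]
  | blk h P e ih =>
    obtain ⟨hh, ⟨p, q, hpq⟩, hf, he⟩ := hx
    have h1 : run nfOne (wbar A (wd h)) = ⟨h, hh⟩ := Subtype.ext (ih hh)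
    rw [wd, wbar_append, R.mul, h1, R.run_mult hh hf hpq (W.wordOver_N P e), W.eval hpq,
      mult_big _ hpq he]

theorem exists_red {x : W.Pre} (hx : Valid x) (S₀ : Set S) : ∃ (r : W.Pre) (u : Word S),
    Valid r ∧ Red S₀ r ∧ WordOver S₀ u ∧ Steps012 A (wd x) (wd r ++ u) := by
  have self : ∀ {x : W.Pre}, Valid x → Red S₀ x → ∃ (r : W.Pre) (u : Word S),
      Valid r ∧ Red S₀ r ∧ WordOver S₀ u ∧ Steps012 A (wd x) (wd r ++ u) :=
    fun {x} hx hr => ⟨x, [], hx, hr, by simp [WordOver], by simpa using .refl _ _⟩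
  induction x with
  | one => exact self hx trivial
  | syl y c n ih =>
    by_cases hc : c ∈ S₀
    · obtain ⟨r, u, h1, h2, h3, h4⟩ := ih hx.2.1
      refine ⟨r, u ++ powW c n, h1, h2, h3.append (wordOver_powW hc n), ?_⟩
      rw [← append_assoc]
      exact h4.append (.refl _ _)
    · exact self hx hc
  | blk h P e ih =>
    obtain ⟨hh, ⟨p, q, hpq⟩, hf, he⟩ := id hx
    by_cases hP : P ⊆ S₀
    · obtain ⟨r, u, h1, h2, h3, h4⟩ := ih hh
      refine ⟨r, u ++ W.N P e, h1, h2, h3.append ((W.wordOver_N P e).mono hP), ?_⟩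
      rw [← append_assoc]
      exact h4.append (.refl _ _)
    · by_cases h1 : ∀ a ∈ P, a ∈ S₀ → W.exp P a e = 0
      · exact self hx ⟨hP, h1⟩
      push Not at h1
      obtain ⟨a, haP, ha, -⟩ := h1
      obtain ⟨d, hp⟩ := hpq.exists_of_mem haP
      have hd : d ∉ S₀ := fun hd => hP fun c hc => by
        rcases hp.mem_iff.1 hc with rfl | rfl <;> assumption
      refine ⟨strip (blk h P e) a, powW a _, hx.strip a, ?_, wordOver_powW ha _, steps_strip hx a⟩
      rcases strip_blk_cases h hp he with ⟨i, j, -, -, e1⟩ | ⟨v, hv, hv0, e1⟩ <;> rw [e1]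
      · exact hd
      · refine ⟨hP, fun c hc hc0 => ?_⟩
        rcases hp.mem_iff.1 hc with rfl | rfl
        exacts [hv0, absurd hc0 hd]

theorem IsRun.run_over (R : IsRun W run) {S₀ : Set S} {u : Word S} (hu : WordOver S₀ u) :
    Over S₀ (run nfOne (wbar A u)).1 := by
  refine hu.induction ?_ fun u a k ha ih => ?_
  · rw [wbar_nil, R.one]; trivial
  · rw [R.append, act]
    have h1 := (run nfOne (wbar A u)).2
    exact ((ih.strip_and_add h1 a).1.strip_and_add (h1.strip a) a).2 _ ha

theorem IsRun.run_red (R : IsRun W run) {S₀ : Set S} {r : W.NF} (hr : Red S₀ r.1) {u : Word S}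
    (hu : WordOver S₀ u) : (run r (wbar A u)).1 = cat r.1 (run nfOne (wbar A u)).1 := by
  suffices h : WordOver S₀ u ∧ (run r (wbar A u)).1 = cat r.1 (run nfOne (wbar A u)).1 from h.2
  refine hu.induction ?_ fun u a k ha ih => ?_
  · rw [wbar_nil, R.one, R.one]
    exact ⟨by simp [WordOver], rfl⟩
  · refine ⟨ih.1.append (wordOver_powW ha k), ?_⟩
    rw [R.append, R.append, ih.2, hr.act_cat r.2 (run _ _).2 (R.run_over ih.1) ha]

theorem reducible (W : WordSystem A) : Reducible A := by
  obtain ⟨run, h1, h2, h3⟩ := PairSystem.exists_run A W.rel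
  have R : IsRun W run := ⟨h1, h2, h3⟩
  refine ⟨⟨fun g => wd (run nfOne g).1, R.steps⟩, fun S₀ =>
    ⟨{g | Red S₀ (run nfOne g).1}, fun x hx y hy hxy => ?_, fun w => ?_⟩⟩
  · obtain ⟨u, hu, hux⟩ := mem_parab_iff.1 hxy
    have hy' : y = x * wbar A u := by rw [hux, mul_inv_cancel_left]
    have e1 := R.run_red hx hu
    rw [← R.mul, ← hy'] at e1
    rw [Set.mem_ofPred_eq, e1] at hy
    have e2 := hx.eq_one (run _ _).2 (run _ _).2 (R.run_over hu) hy
    have e3 := R.steps u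
    rw [e2] at e3
    rw [hy', e3.wbar_eq, wd, wbar_nil, mul_one]
  · obtain ⟨r, u, hv, hr, hu, hs⟩ := exists_red (run nfOne (wbar A w)).2 S₀
    refine ⟨wd r, u, hu, (R.steps w).trans hs, ?_⟩
    rw [Set.mem_ofPred_eq, R.run_wd hv]
    exact hr

end WordSystem

end

section

universe u

variable {S : Type u}

/-! ### Artin-Tits groups of large type -/

section

variable {A : ArtinData S} {P : Set S} {a b : S}

theorem Dihedral.of_pairEq (hA : ∀ a b, a ≠ b → ∃ k : ℕ, 3 ≤ k ∧ A.m a b = k) (h : PairEq P a b) :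
    Dihedral (A.restrict P) ⟨a, h.left⟩ ⟨b, h.right⟩ where
  ne e := h.ne (congrArg Subtype.val e)
  cover x := by
    rcases h.mem_iff.1 x.2 with e | e
    exacts [Or.inl (Subtype.ext e), Or.inr (Subtype.ext e)]
  label := hA a b h.ne

theorem exists_exp_of_large (hA : ∀ a b, a ≠ b → ∃ k : ℕ, 3 ≤ k ∧ A.m a b = k) (P : Set S) (a : S) :
    ∃ κ : ArtinGroup (A.restrict P) → ℤ, ∀ b, ∀ h : PairEq P a b,
      κ 1 = 0 ∧ (∀ v i, κ (v * gen (A.restrict P) ⟨a, h.left⟩ ^ i) = κ v + i) ∧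
      (∀ i j : ℤ, j ≠ 0 →
        κ (gen (A.restrict P) ⟨a, h.left⟩ ^ i * gen (A.restrict P) ⟨b, h.right⟩ ^ j) = 0) ∧
      ∀ w, ∃ v, Steps012 (A.restrict P) w
        (v ++ powW (⟨a, h.left⟩ : P) (κ (wbar (A.restrict P) w))) := by
  by_cases hb : ∃ b, PairEq P a b
  · obtain ⟨b, h⟩ := hb
    obtain ⟨κ, hκ⟩ := (Dihedral.of_pairEq hA h).exists_exp
    refine ⟨κ, fun c hc => ?_⟩
    obtain rfl : c = b := by
      have := hc.right
      rw [h.mem_iff] at this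
      exact this.resolve_left hc.ne.symm
    exact hκ
  · exact ⟨0, fun b h => (hb ⟨b, h⟩).elim⟩

/-- The dihedral parabolic subgroups of an Artin-Tits group of large type. -/
noncomputable def largePairs (A : ArtinData S)
    (hA : ∀ a b, a ≠ b → ∃ k : ℕ, 3 ≤ k ∧ A.m a b = k) : PairSystem S where
  Γ P := ArtinGroup (A.restrict P)
  grp P := inferInstance
  g P a := if h : a ∈ P then gen (A.restrict P) ⟨a, h⟩ else 1
  exp P a := (exists_exp_of_large hA P a).choose
  exp_one {P a b} h := ((exists_exp_of_large hA P a).choose_spec b h).1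
  exp_mul {P a b} h v i := by
    rw [dif_pos h.left]
    exact ((exists_exp_of_large hA P a).choose_spec b h).2.1 v i
  exp_pow_mul_pow {P a b} h i j hj := by
    rw [dif_pos h.left, dif_pos h.right]
    exact ((exists_exp_of_large hA P a).choose_spec b h).2.2.1 i j hj
  eq_of_mul_eq {P a b} h d j j' n hj := by
    rw [dif_pos h.left, dif_pos h.right]
    exact (Dihedral.of_pairEq hA h).eq_zero_of_mul_eq hj

variable (hA : ∀ a b, a ≠ b → ∃ k : ℕ, 3 ≤ k ∧ A.m a b = k)

theorem largePairs_g (h : a ∈ P) : (largePairs A hA).g P a = gen (A.restrict P) ⟨a, h⟩ := dif_pos h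

theorem steps_mapW_restrict {w w' : Word P} (h : Steps012 (A.restrict P) w w') :
    Steps012 A (mapW Subtype.val w) (mapW Subtype.val w') :=
  h.mapW Subtype.val_injective fun _ _ => rfl

/-- Representatives of the elements of a dihedral parabolic subgroup that can be reached from every
word, and that are alternating on the products of two powers of generators. -/
structure GoodRep (A : ArtinData S) (P : Set S) (N : ArtinGroup (A.restrict P) → Word S) :
    Prop where
  exists_word : ∀ v, ∃ w : Word P, wbar (A.restrict P) w = v ∧ N v = mapW Subtype.val w
  steps : ∀ w : Word P, Steps012 A (mapW Subtype.val w) (N (wbar (A.restrict P) w))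
  pow_mul_pow : ∀ x y : P, x ≠ y → ∀ i j : ℤ,
    N (gen (A.restrict P) x ^ i * gen (A.restrict P) y ^ j) = powW x.1 i ++ powW y.1 j

theorem exists_goodRep (hA : ∀ a b, a ≠ b → ∃ k : ℕ, 3 ≤ k ∧ A.m a b = k) (hP : PairEq P a b) :
    ∃ N, GoodRep A P N := by
  obtain ⟨nf, hnf⟩ := (Dihedral.of_pairEq hA hP).reducible.nf
  have pair {x y : P} (h : x ≠ y) : PairEq P x.1 y.1 := by
    have hne : x.1 ≠ y.1 := fun e => h (Subtype.ext e)
    refine ⟨hne, ?_⟩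
    rcases hP.mem_iff.1 x.2 with hx | hx <;> rcases hP.mem_iff.1 y.2 with hy | hy
    · exact (hne (hx.trans hy.symm)).elim
    · rw [hx, hy, hP.eq]
    · rw [hx, hy, hP.symm.eq]
    · exact (hne (hx.trans hy.symm)).elim
  have inj {x y : P} (h : x ≠ y) {i j i' j' : ℤ}
      (e : gen (A.restrict P) x ^ i * gen (A.restrict P) y ^ j =
        gen (A.restrict P) x ^ i' * gen (A.restrict P) y ^ j') : i = i' ∧ j = j' := by
    refine (largePairs A hA).pow_mul_pow_injective (pair h) ?_
    rw [largePairs_g hA x.2, largePairs_g hA y.2]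
    exact e
  have ne {x y : P} (h : x ≠ y) {i j i' j' : ℤ} (hi : i ≠ 0) (hj : j ≠ 0) :
      gen (A.restrict P) x ^ i * gen (A.restrict P) y ^ j ≠
        gen (A.restrict P) y ^ i' * gen (A.restrict P) x ^ j' := by
    have := (largePairs A hA).pow_mul_pow_ne (i' := j') (j' := i') (pair h) hi hj
    rwa [largePairs_g hA x.2, largePairs_g hA y.2] at this
  let Q (v : ArtinGroup (A.restrict P)) (w : Word P) : Prop :=
    ∃ x y : P, x ≠ y ∧ ∃ i j : ℤ, v = gen (A.restrict P) x ^ i * gen (A.restrict P) y ^ j ∧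
      w = powW x i ++ powW y j
  have hQ {v w w'} (h : Q v w) (h' : Q v w') : w = w' := by
    obtain ⟨x, y, hxy, i, j, rfl, rfl⟩ := h
    obtain ⟨x', y', hxy', i', j', e, rfl⟩ := h'
    have hp := pair hxy
    have hx' : x' = x ∨ x' = y := by
      simpa [Subtype.ext_iff] using hp.mem_iff.1 x'.2
    have hy' : y' = x ∨ y' = y := by
      simpa [Subtype.ext_iff] using hp.mem_iff.1 y'.2
    rcases hx' with rfl | rfl <;> rcases hy' with rfl | rfl
    · exact (hxy' rfl).elim
    · obtain ⟨rfl, rfl⟩ := inj hxy e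
      rfl
    · by_cases hi : i = 0
      · subst hi
        rw [zpow_zero, one_mul] at e
        obtain ⟨rfl, rfl⟩ := inj hxy' (i := j) (j := 0) (i' := i') (j' := j')
          (by rw [zpow_zero, mul_one]; exact e)
        simp
      · by_cases hj : j = 0
        · subst hj
          rw [zpow_zero, mul_one] at e
          obtain ⟨rfl, rfl⟩ := inj hxy' (i := 0) (j := i) (i' := i') (j' := j')
            (by rw [zpow_zero, one_mul]; exact e)
          simp
        · exact (ne hxy hi hj e).elim
    · exact (hxy' rfl).elim
  let N₀ (v : ArtinGroup (A.restrict P)) : Word P :=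
    if h : ∃ w, Q v w then h.choose else nf v
  have hN {v w} (h : Q v w) : N₀ v = w := by
    have : ∃ w, Q v w := ⟨w, h⟩
    simp only [N₀, dif_pos this]
    exact hQ this.choose_spec h
  refine ⟨fun v => mapW Subtype.val (N₀ v), fun v => ⟨N₀ v, ?_, rfl⟩, fun w => ?_, ?_⟩
  · by_cases h : ∃ w, Q v w
    · obtain ⟨w, h⟩ := h
      rw [hN h]
      obtain ⟨x, y, hxy, i, j, rfl, rfl⟩ := h
      rw [wbar_append, wbar_powW, wbar_powW]
    · simp only [N₀, dif_neg h]
      obtain ⟨w, rfl⟩ := wbar_surjective _ v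
      exact (hnf w).wbar_eq.symm
  · refine steps_mapW_restrict ?_
    by_cases h : ∃ w', Q (wbar (A.restrict P) w) w'
    · obtain ⟨w', h⟩ := h
      rw [hN h]
      obtain ⟨x, y, hxy, i, j, e, rfl⟩ := h
      have hd := Dihedral.of_pairEq hA (pair hxy)
      by_cases hj : j = 0
      · subst hj
        rw [zpow_zero, mul_one] at e
        obtain ⟨w', h1, h2⟩ := hd.reducible.exists_wordOver (T := {x})
          (mem_parab_singleton.2 ⟨i, e⟩)
        obtain ⟨n, h3⟩ := steps_powW_of_wordOver _ h1
        have := (h2.trans h3).wbar_eq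
        rw [wbar_powW, e, ← largePairs_g hA x.2] at this
        rw [(largePairs A hA).pow_injective (pair hxy) this, powW_zero, append_nil]
        exact h2.trans h3
      · simpa using hd.steps_pow_mul_pow_mul_pow (j := i) (k := j) (i := 0) hj (w := w)
          (by rw [e, zpow_zero, mul_one])
    · simp only [N₀, dif_neg h]
      exact hnf w
  · intro x y hxy i j
    rw [hN ⟨x, y, hxy, i, j, rfl, rfl⟩]
    simp [mapW_powW]

theorem lift_largePairs_g (w : Word P) :
    FreeGroup.lift ((largePairs A hA).g P) (FreeGroup.mk (mapW Subtype.val w)) =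
      wbar (A.restrict P) w := by
  induction w with
  | nil => exact map_one _
  | cons l w ih =>
    obtain ⟨x, e⟩ := l
    rw [mapW_cons, ← singleton_append, ← FreeGroup.mul_mk, map_mul, ih, ← singleton_append (l := w),
      wbar_append]
    congr 1
    cases e
    · refine (FreeGroup.lift_mk.trans ?_)
      simp only [map_cons, map_nil, prod_cons, prod_nil, cond_false, mul_one]
      rw [largePairs_g hA x.2]
      have := wbar_powW (A.restrict P) x (-1)
      rw [zpow_neg_one, powW_neg_one] at this
      exact this.symm
    · refine (FreeGroup.lift_mk.trans ?_)
      simp only [map_cons, map_nil, prod_cons, prod_nil, cond_true, mul_one]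
      rw [largePairs_g hA x.2]
      rfl

theorem altProd_gen_eq {A : ArtinData S} {x y : S} {k : ℕ} (hxy : x ≠ y) (h : A.m x y = k) :
    altProd (gen A x) (gen A y) k = altProd (gen A y) (gen A x) k := by
  have : IsRel A (altWord x y k) (altWord y x k) := ⟨x, y, k, hxy, h, rfl, rfl⟩
  have := this.wbar_eq
  have key (x y : S) : wbar A (altWord x y k) = altProd (gen A x) (gen A y) k := by
    refine Eq.trans ?_ (altProd_map (PresentedGroup.mk (rels A)) (FreeGroup.of x) (FreeGroup.of y) k)
    rw [← lift_altWord]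
    exact congrArg _ (FreeGroup.lift_of_apply _).symm
  rwa [key, key] at this

/-- The word system of an Artin-Tits group of large type. -/
noncomputable def largeSystem (A : ArtinData S)
    (hA : ∀ a b, a ≠ b → ∃ k : ℕ, 3 ≤ k ∧ A.m a b = k) : WordSystem A :=
  have hN (P : Set S) : ∃ N : ArtinGroup (A.restrict P) → Word S,
      (∀ v, WordOver P (N v)) ∧ N 1 = [] ∧ ∀ a b, PairEq P a b → GoodRep A P N := by
    by_cases h : ∃ a b, PairEq P a b
    · obtain ⟨a, b, h⟩ := h
      obtain ⟨N, hN⟩ := exists_goodRep hA h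
      refine ⟨N, fun v => ?_, ?_, fun _ _ _ => hN⟩
      · obtain ⟨w, -, e⟩ := hN.exists_word v
        rw [e]
        simpa using (wordOver_univ w).mapW (f := (Subtype.val : P → S))
      · simpa using hN.pow_mul_pow ⟨a, h.left⟩ ⟨b, h.right⟩ (by simpa using h.ne) 0 0
    · exact ⟨fun _ => [], fun v l hl => by simp at hl, rfl, fun a b h' => (h ⟨a, b, h'⟩).elim⟩
  { largePairs A hA with
    rel := fun {P a b k} h hk => by
      change altProd ((largePairs A hA).g P a) ((largePairs A hA).g P b) k =
        altProd ((largePairs A hA).g P b) ((largePairs A hA).g P a) k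
      rw [largePairs_g hA h.left, largePairs_g hA h.right]
      exact altProd_gen_eq (A := A.restrict P) (by simpa using h.ne) hk
    N := fun P => (hN P).choose
    wordOver_N := fun P => (hN P).choose_spec.1
    eval := fun {P a b} h v => by
      obtain ⟨w, h1, h2⟩ := ((hN P).choose_spec.2.2 a b h).exists_word v
      refine (congrArg (fun w => FreeGroup.lift ((largePairs A hA).g P) (FreeGroup.mk w)) h2).trans ?_
      exact (lift_largePairs_g hA w).trans h1
    N_one := fun P => (hN P).choose_spec.2.1
    N_pow := fun {P a b} h i => by
      have := ((hN P).choose_spec.2.2 a b h).pow_mul_pow ⟨a, h.left⟩ ⟨b, h.right⟩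
        (by simpa using h.ne) i 0
      rw [zpow_zero, mul_one, powW_zero, append_nil] at this
      refine Eq.trans (congrArg (fun x => (hN P).choose (x ^ i)) ?_) this
      exact largePairs_g hA h.left
    N_pow_mul_pow := fun {P a b} h i j => by
      have := ((hN P).choose_spec.2.2 a b h).pow_mul_pow ⟨a, h.left⟩ ⟨b, h.right⟩
        (by simpa using h.ne) i j
      refine Eq.trans (congrArg₂ (fun x y => (hN P).choose (x ^ i * y ^ j)) ?_ ?_) this
      exacts [largePairs_g hA h.left, largePairs_g hA h.right]
    steps_mul := fun {P a b} h v k => by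
      have hG := (hN P).choose_spec.2.2 a b h
      obtain ⟨w, h1, h2⟩ := hG.exists_word v
      have := hG.steps (w ++ powW ⟨a, h.left⟩ k)
      rw [mapW_append, ← h2, mapW_powW, wbar_append, h1, wbar_powW] at this
      have key : ∀ g' : ArtinGroup (A.restrict P), g' = gen (A.restrict P) ⟨a, h.left⟩ →
          Steps012 A ((hN P).choose v ++ powW a k)
            ((hN P).choose ((id v : ArtinGroup (A.restrict P)) * g' ^ k)) := by
        rintro _ rfl
        exact this
      exact key _ (largePairs_g hA h.left)
    steps_exp := fun {P a b} h v => by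
      have hG := (hN P).choose_spec.2.2 a b h
      obtain ⟨w, h1, h2⟩ := hG.exists_word v
      obtain ⟨w', hw'⟩ := ((exists_exp_of_large hA P a).choose_spec b h).2.2.2 w
      have h3 := hw'.wbar_eq
      rw [wbar_append, wbar_powW, h1] at h3
      have h4 := (steps_mapW_restrict hw').trans
        (by rw [mapW_append]; exact (hG.steps w').append (Steps012.refl A _))
      rw [← h2, eq_mul_inv_of_mul_eq h3.symm, ← zpow_neg, mapW_powW, h1] at h4
      have key : ∀ g' : ArtinGroup (A.restrict P), g' = gen (A.restrict P) ⟨a, h.left⟩ →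
          Steps012 A ((hN P).choose v) ((hN P).choose ((id v : ArtinGroup (A.restrict P)) *
            g' ^ (-(exists_exp_of_large hA P a).choose v)) ++
              powW a ((exists_exp_of_large hA P a).choose v)) := by
        rintro _ rfl
        exact h4
      exact key _ (largePairs_g hA h.left) }

theorem reducible_of_large (A : ArtinData S)
    (hA : ∀ a b, a ≠ b → ∃ k : ℕ, 3 ≤ k ∧ A.m a b = k) : Reducible A :=
  (largeSystem A hA).reducible

end

end

section

/-! ### Direct products -/

section

variable {A : ArtinData S}

theorem steps_swap_letters {s t : S} (hne : s ≠ t) (h : A.m s t = 2) (b c : Bool) :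
    Steps012 A [(s, b), (t, c)] [(t, c), (s, b)] := by
  have h' : A.m t s = 2 := by rw [A.symm, h]
  have r1 : IsRel A [(t, true), (s, true)] [(s, true), (t, true)] :=
    ⟨t, s, 2, hne.symm, by simpa using h', rfl, rfl⟩
  cases b <;> cases c
  · exact Relation.ReflTransGen.single (Or.inr (Or.inl ⟨[], [], _, _, r1.symm, Or.inr ⟨rfl, rfl⟩⟩))
  · exact Relation.ReflTransGen.single (Or.inr (Or.inr (Or.inl
      ⟨[], [], [(t, true)], [(s, true)], [(s, true)], [(t, true)], r1, by simp, by simp, rfl, rfl⟩)))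
  · exact Relation.ReflTransGen.single (Or.inr (Or.inr (Or.inr
      ⟨[], [], [(s, true)], [(t, true)], [(t, true)], [(s, true)], r1.symm, by simp, by simp, rfl,
        rfl⟩)))
  · exact Relation.ReflTransGen.single (Or.inr (Or.inl ⟨[], [], _, _, r1, Or.inl ⟨rfl, rfl⟩⟩))

/-- The labels between elements of `U` and of `V` are all equal to `2`. -/
def Commuting (A : ArtinData S) (U V : Set S) : Prop :=
  ∀ s ∈ U, ∀ t ∈ V, s ≠ t ∧ A.m s t = 2

theorem Commuting.steps_letter {U V : Set S} (h : Commuting A U V) {l : S × Bool} (hl : l.1 ∈ U)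
    {w : Word S} (hw : WordOver V w) : Steps012 A (l :: w) (w ++ [l]) := by
  induction w with
  | nil => exact Steps012.refl A _
  | cons l' w ih =>
    have h1 := h _ hl l'.1 (hw l' (by simp))
    have h2 := (steps_swap_letters h1.1 h1.2 l.2 l'.2).append (Steps012.refl A w)
    refine h2.trans ?_
    exact (Steps012.refl A [l']).append (ih fun x hx => hw x (by simp [hx]))

theorem Commuting.steps_swap {U V : Set S} (h : Commuting A U V) {u w : Word S}
    (hu : WordOver U u) (hw : WordOver V w) : Steps012 A (u ++ w) (w ++ u) := by
  induction u with
  | nil => simpa using Steps012.refl A w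
  | cons l u ih =>
    have h1 := (Steps012.refl A [l]).append (ih fun x hx => hu x (by simp [hx]))
    refine h1.trans ?_
    have h2 := (h.steps_letter (hu l (by simp)) hw).append (Steps012.refl A u)
    simpa using h2

/-- The word obtained by deleting the letters outside `U`. -/
noncomputable def resW (U : Set S) (w : Word S) : Word U :=
  w.filterMap fun l => if h : l.1 ∈ U then some (⟨l.1, h⟩, l.2) else none

variable {U : Set S}

@[simp] theorem resW_nil : resW U [] = [] := rfl

@[simp] theorem resW_append (u v : Word S) : resW U (u ++ v) = resW U u ++ resW U v :=
  filterMap_append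

theorem resW_cons_of_mem {s : S} (h : s ∈ U) (b : Bool) (w : Word S) :
    resW U ((s, b) :: w) = (⟨s, h⟩, b) :: resW U w := by
  simp [resW, h]

theorem resW_cons_of_notMem {s : S} (h : s ∉ U) (b : Bool) (w : Word S) :
    resW U ((s, b) :: w) = resW U w := by
  simp [resW, h]

@[simp] theorem resW_mapW (w : Word U) : resW U (mapW Subtype.val w) = w := by
  induction w with
  | nil => rfl
  | cons l w ih => rw [mapW_cons, resW_cons_of_mem l.1.2, ih]

theorem resW_eq_nil {w : Word S} (h : WordOver Uᶜ w) : resW U w = [] := by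
  induction w with
  | nil => rfl
  | cons l w ih =>
    obtain ⟨s, b⟩ := l
    rw [resW_cons_of_notMem (h (s, b) (by simp)), ih fun x hx => h x (by simp [hx])]

theorem resW_altWord_of_mem {s t : S} (hs : s ∈ U) (ht : t ∈ U) (k : ℕ) :
    resW U (altWord s t k) = altWord ⟨s, hs⟩ ⟨t, ht⟩ k := by
  induction k generalizing s t with
  | zero => rfl
  | succ k ih => rw [altWord, altWord, resW_cons_of_mem hs, ih ht hs]

theorem WordOver.resW {T : Set S} {w : Word S} (h : WordOver T w) :
    WordOver (Subtype.val ⁻¹' T : Set U) (resW U w) := by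
  intro l hl
  simp only [ArtinTits.resW, mem_filterMap] at hl
  obtain ⟨l', h1, h2⟩ := hl
  split_ifs at h2 with h3
  cases h2
  exact h l' h1

theorem wordOver_mapW_val (w : Word U) : WordOver U (mapW Subtype.val w) := by
  simpa using (wordOver_univ w).mapW (f := (Subtype.val : U → S))

theorem Commuting.exists_proj (h : Commuting A U Uᶜ) :
    ∃ φ : ArtinGroup A →* ArtinGroup (A.restrict U), ∀ w, φ (wbar A w) = wbar _ (resW U w) := by
  refine exists_artinLift A (fun w => wbar (A.restrict U) (resW U w)) (by simp) (by simp) ?_ ?_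
  · intro s
    by_cases hs : s ∈ U
    · rw [resW_cons_of_mem hs, resW_cons_of_mem hs, resW_nil, ← wbar_wordInv]; rfl
    · rw [resW_cons_of_notMem hs, resW_cons_of_notMem hs]; simp
  · rintro u v ⟨s, t, k, hst, hk, rfl, rfl⟩
    by_cases hs : s ∈ U <;> by_cases ht : t ∈ U
    · simp only [resW_altWord_of_mem hs ht, resW_altWord_of_mem ht hs]
      exact IsRel.wbar_eq (A := A.restrict U)
        ⟨⟨s, hs⟩, ⟨t, ht⟩, k, by simpa using hst, hk, rfl, rfl⟩
    · obtain rfl : k = 2 := by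
        have := (h s hs t ht).2
        rw [hk] at this
        exact_mod_cast this
      simp [altWord, resW_cons_of_mem hs, resW_cons_of_notMem ht]
    · obtain rfl : k = 2 := by
        have := (h t ht s hs).2
        rw [A.symm, hk] at this
        exact_mod_cast this
      simp [altWord, resW_cons_of_mem ht, resW_cons_of_notMem hs]
    · rw [resW_eq_nil, resW_eq_nil]
      · exact fun l hl => by rcases (mem_altWord hl).2 with e | e <;> simpa [e]
      · exact fun l hl => by rcases (mem_altWord hl).2 with e | e <;> simpa [e]

theorem Commuting.symm {V : Set S} (h : Commuting A U V) : Commuting A V U :=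
  fun s hs t ht => ⟨(h t ht s hs).1.symm, by rw [A.symm]; exact (h t ht s hs).2⟩

theorem Commuting.steps_split (h : Commuting A U Uᶜ) (w : Word S) :
    Steps012 A w (mapW Subtype.val (resW U w) ++ mapW Subtype.val (resW Uᶜ w)) := by
  induction w with
  | nil => exact Steps012.refl A _
  | cons l w ih =>
    obtain ⟨s, b⟩ := l
    have h1 := (Steps012.refl A [(s, b)]).append ih
    by_cases hs : s ∈ U
    · rw [resW_cons_of_mem hs, resW_cons_of_notMem (U := Uᶜ) (by simpa)]
      exact h1
    · rw [resW_cons_of_notMem hs, resW_cons_of_mem (U := Uᶜ) hs]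
      refine h1.trans ?_
      have := (h.symm.steps_letter (l := (s, b)) hs (wordOver_mapW_val (resW U w))).append
        (Steps012.refl A (mapW Subtype.val (resW Uᶜ w)))
      simpa using this

theorem Commuting.reducible (h : Commuting A U Uᶜ) (h1 : Reducible (A.restrict U))
    (h2 : Reducible (A.restrict Uᶜ)) : Reducible A := by
  have h' : Commuting A Uᶜ Uᶜᶜ := by rw [compl_compl]; exact h.symm
  obtain ⟨φ, hφ⟩ := h.exists_proj
  obtain ⟨ψ, hψ⟩ := h'.exists_proj
  constructor
  · obtain ⟨n1, hn1⟩ := h1.nf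
    obtain ⟨n2, hn2⟩ := h2.nf
    refine ⟨fun g => mapW Subtype.val (n1 (φ g)) ++ mapW Subtype.val (n2 (ψ g)), fun w => ?_⟩
    simp only [hφ, hψ]
    exact (h.steps_split w).trans
      ((steps_mapW_restrict (hn1 _)).append (steps_mapW_restrict (hn2 _)))
  · intro S₀
    obtain ⟨T1, hT1, hr1⟩ := h1.tr (Subtype.val ⁻¹' S₀)
    obtain ⟨T2, hT2, hr2⟩ := h2.tr (Subtype.val ⁻¹' S₀)
    refine ⟨{g | φ g ∈ T1 ∧ ψ g ∈ T2}, fun x hx y hy hxy => ?_, fun w => ?_⟩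
    · obtain ⟨w, hw, e⟩ := mem_parab_iff.1 hxy
      have e1 : φ x = φ y := hT1 _ hx.1 _ hy.1 (by
        rw [← map_inv, ← map_mul, ← e, hφ]; exact wbar_mem_parab hw.resW)
      have e2 : ψ x = ψ y := hT2 _ hx.2 _ hy.2 (by
        rw [← map_inv, ← map_mul, ← e, hψ]; exact wbar_mem_parab hw.resW)
      obtain ⟨u, rfl⟩ := wbar_surjective A x
      obtain ⟨v, rfl⟩ := wbar_surjective A y
      obtain ⟨f, hf⟩ := exists_mapHom (A := A) (A' := A.restrict U) Subtype.val_injective fun _ _ => rfl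
      obtain ⟨g, hg⟩ := exists_mapHom (A := A) (A' := A.restrict Uᶜ) Subtype.val_injective
        fun _ _ => rfl
      rw [(h.steps_split u).wbar_eq, (h.steps_split v).wbar_eq, wbar_append, wbar_append, ← hf, ← hf,
        ← hg, ← hg, ← hφ, ← hφ, ← hψ, ← hψ, e1, e2]
    · obtain ⟨v1, u1, a1, b1, c1⟩ := hr1 (resW U w)
      obtain ⟨v2, u2, a2, b2, c2⟩ := hr2 (resW Uᶜ w)
      refine ⟨mapW Subtype.val v1 ++ mapW Subtype.val v2, mapW Subtype.val u1 ++ mapW Subtype.val u2,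
        (a1.mapW.mono (by simp)).append (a2.mapW.mono (by simp)), ?_, ?_⟩
      · refine (h.steps_split w).trans
          (((steps_mapW_restrict b1).append (steps_mapW_restrict b2)).trans ?_)
        have := (h.steps_swap (wordOver_mapW_val u1) (wordOver_mapW_val v2)).context
          (mapW Subtype.val v1) (mapW Subtype.val u2)
        simpa using this
      · rw [Set.mem_ofPred_eq, hφ, hψ, resW_append, resW_append, resW_mapW, resW_mapW,
          resW_eq_nil (wordOver_mapW_val v2), resW_eq_nil (U := Uᶜ) (by
            rw [compl_compl]; exact wordOver_mapW_val v1), append_nil, nil_append]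
        exact ⟨c1, c2⟩

end

end

section

/-! ### Normal forms in amalgamated products -/

/-- Groups `G i` with a common subgroup `K`, and a decomposition `g = τ g * η g` of the elements of
`G i` given by a transversal of the left cosets of `K`. -/
structure Amalgam (I : Type*) (K : Type*) [Group K] (G : I → Type*) [∀ i, Group (G i)] where
  ι : ∀ i, K →* G i
  τ : ∀ i, G i → G i
  η : ∀ i, G i → K
  dec : ∀ i g, τ i g * ι i (η i g) = g
  τ_mul : ∀ i g k, τ i (g * ι i k) = τ i g
  η_mul : ∀ i g k, η i (g * ι i k) = η i g * k
  τ_one : ∀ i, τ i 1 = 1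
  η_one : ∀ i, η i 1 = 1

namespace Amalgam

variable {I K : Type*} [Group K] {G : I → Type*} [∀ i, Group (G i)] (M : Amalgam I K G)

theorem τ_ι (i : I) (k : K) : M.τ i (M.ι i k) = 1 := by
  have := M.τ_mul i 1 k
  rwa [one_mul, M.τ_one] at this

theorem η_ι (i : I) (k : K) : M.η i (M.ι i k) = k := by
  have := M.η_mul i 1 k
  rwa [one_mul, M.η_one, one_mul] at this

theorem τ_eq (i : I) (g : G i) : M.τ i g = g * M.ι i (M.η i g)⁻¹ := by
  rw [map_inv, eq_mul_inv_iff_mul_eq, M.dec]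

theorem τ_τ (i : I) (g : G i) : M.τ i (M.τ i g) = M.τ i g := by
  rw [M.τ_eq i g, M.τ_mul, M.τ_eq]

theorem η_of_τ_eq {i : I} {t : G i} (h : M.τ i t = t) : M.η i t = 1 := by
  have := M.dec i t
  rw [h, mul_eq_left] at this
  rw [← M.η_ι i (M.η i t), this, M.η_one]

/-- The last syllable, which comes first in the list, does not belong to `G i`. -/
def Away (_ : Amalgam I K G) (i : I) : List (Σ i, G i) → Prop
  | [] => True
  | x :: _ => x.1 ≠ i

/-- The lists of syllables that are in normal form. -/
def Good : List (Σ i, G i) → Prop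
  | [] => True
  | x :: L => M.τ x.1 x.2 = x.2 ∧ x.2 ≠ 1 ∧ M.Away x.1 L ∧ Good L

/-- The normal forms. -/
def NF : Type _ := {L : List (Σ i, G i) // M.Good L} × K

/-- Isolate the part in `G i` at the end of a product. -/
noncomputable def pop (i : I) : List (Σ i, G i) → K → List (Σ i, G i) × G i
  | [], k => ([], M.ι i k)
  | ⟨j, t⟩ :: L, k =>
    if h : j = i then (L, (h ▸ t) * M.ι i k) else (⟨j, t⟩ :: L, M.ι i k)

theorem pop_cons_self (i : I) (t : G i) (L : List (Σ i, G i)) (k : K) :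
    M.pop i (⟨i, t⟩ :: L) k = (L, t * M.ι i k) := by simp [pop]

theorem pop_away {i : I} {L : List (Σ i, G i)} (h : M.Away i L) (k : K) :
    M.pop i L k = (L, M.ι i k) := by
  cases L with
  | nil => rfl
  | cons x L => exact dif_neg h

/-- Normal form of the product of `L` and of an element of `G i`. -/
noncomputable def push (L : List (Σ i, G i)) (i : I) (x : G i) : List (Σ i, G i) × K :=
  if M.τ i x = 1 then (L, M.η i x) else (⟨i, M.τ i x⟩ :: L, M.η i x)

variable {M}

theorem pop_push {L : List (Σ i, G i)} {i : I} (h : M.Away i L) (x : G i) :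
    M.pop i (M.push L i x).1 (M.push L i x).2 = (L, x) := by
  rw [push]
  split_ifs with hx
  · rw [M.pop_away h]
    have := M.dec i x
    rw [hx, one_mul] at this
    rw [this]
  · rw [M.pop_cons_self, M.dec]

theorem Good.push {L : List (Σ i, G i)} {i : I} (hL : M.Good L) (h : M.Away i L) (x : G i) :
    M.Good (M.push L i x).1 := by
  rw [Amalgam.push]
  split_ifs with hx
  · exact hL
  · exact ⟨M.τ_τ i x, hx, h, hL⟩

theorem Good.cases {L : List (Σ i, G i)} (hL : M.Good L) (i : I) :
    M.Away i L ∨ ∃ t L', L = ⟨i, t⟩ :: L' ∧ M.τ i t = t ∧ t ≠ 1 ∧ M.Away i L' ∧ M.Good L' := by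
  rcases L with _ | ⟨⟨j, t⟩, L⟩
  · exact Or.inl trivial
  · by_cases h : j = i
    · subst h
      exact Or.inr ⟨t, L, rfl, hL⟩
    · exact Or.inl h

theorem Good.pop {L : List (Σ i, G i)} (hL : M.Good L) (i : I) (k : K) :
    M.Away i (M.pop i L k).1 ∧ M.Good (M.pop i L k).1 ∧
      M.push (M.pop i L k).1 i (M.pop i L k).2 = (L, k) := by
  rcases hL.cases i with h | ⟨t, L, rfl, h1, h2, h3, h4⟩
  · rw [M.pop_away h]
    exact ⟨h, hL, by rw [Amalgam.push, if_pos (M.τ_ι i k), M.η_ι]⟩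
  · rw [M.pop_cons_self]
    refine ⟨h3, h4, ?_⟩
    rw [Amalgam.push, M.τ_mul, M.η_mul, h1, if_neg h2, M.η_of_τ_eq h1, one_mul]

theorem push_pop_mul_ι {L : List (Σ i, G i)} (hL : M.Good L) (i : I) (k k' : K) :
    M.push (M.pop i L k).1 i ((M.pop i L k).2 * M.ι i k') = (L, k * k') := by
  have h : M.pop i L (k * k') = ((M.pop i L k).1, (M.pop i L k).2 * M.ι i k') := by
    rcases hL.cases i with h | ⟨t, L, rfl, -⟩
    · rw [M.pop_away h, M.pop_away h, map_mul]
    · rw [M.pop_cons_self, M.pop_cons_self, map_mul, mul_assoc]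
  have := (hL.pop i (k * k')).2.2
  rwa [h] at this

variable (M)

/-- Right multiplication of a normal form by an element of `G i`. -/
noncomputable def act (i : I) (g : G i) (X : M.NF) : M.NF :=
  let p := M.pop i X.1.1 X.2
  (⟨(M.push p.1 i (p.2 * g)).1, (X.1.2.pop i X.2).2.1.push (X.1.2.pop i X.2).1 _⟩,
    (M.push p.1 i (p.2 * g)).2)

variable {M}

theorem NF.ext {X Y : M.NF} (h : (X.1.1, X.2) = (Y.1.1, Y.2)) : X = Y :=
  Prod.ext (Subtype.ext (Prod.mk.inj h).1) (Prod.mk.inj h).2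

theorem pop_act (i : I) (g : G i) (X : M.NF) :
    M.pop i (M.act i g X).1.1 (M.act i g X).2 =
      ((M.pop i X.1.1 X.2).1, (M.pop i X.1.1 X.2).2 * g) :=
  pop_push (X.1.2.pop i X.2).1 _

theorem act_one (i : I) (X : M.NF) : M.act i 1 X = X :=
  NF.ext <| by
    simp only [act, mul_one]
    exact (X.1.2.pop i X.2).2.2

theorem act_act (i : I) (g h : G i) (X : M.NF) : M.act i h (M.act i g X) = M.act i (g * h) X :=
  NF.ext <| by
    change M.push (M.pop i (M.act i g X).1.1 (M.act i g X).2).1 i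
      ((M.pop i (M.act i g X).1.1 (M.act i g X).2).2 * h) = _
    rw [pop_act, mul_assoc]
    rfl

theorem act_ι (i j : I) (k : K) (X : M.NF) : M.act i (M.ι i k) X = M.act j (M.ι j k) X :=
  NF.ext <| (push_pop_mul_ι X.1.2 i X.2 k).trans (push_pop_mul_ι X.1.2 j X.2 k).symm

variable (M)

/-- The right action of `G i` on the normal forms. -/
noncomputable def actHom (i : I) : G i →* (Equiv.Perm M.NF)ᵐᵒᵖ where
  toFun g := MulOpposite.op
    { toFun := M.act i g
      invFun := M.act i g⁻¹
      left_inv := fun X => by rw [act_act, mul_inv_cancel, act_one]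
      right_inv := fun X => by rw [act_act, inv_mul_cancel, act_one] }
  map_one' := MulOpposite.unop_injective <| Equiv.ext fun X => act_one i X
  map_mul' g h := MulOpposite.unop_injective <| Equiv.ext fun X => (act_act i g h X).symm

theorem actHom_ι (i j : I) (k : K) : M.actHom i (M.ι i k) = M.actHom j (M.ι j k) :=
  MulOpposite.unop_injective <| Equiv.ext fun X => act_ι i j k X

end Amalgam

end

section

/-! ### Reflecting special transformations along an inclusion of generators -/

section

variable {S' : Type*} {f : S' → S} {A' : ArtinData S'} {A : ArtinData S}

theorem mapW_injective (hf : Function.Injective f) : Function.Injective (mapW f) :=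
  List.map_injective_iff.2 fun l l' h => by
    simp only [Prod.mk.injEq] at h
    exact Prod.ext (hf h.1) h.2

theorem exists_mapW {w : Word S} (h : WordOver (Set.range f) w) : ∃ w', mapW f w' = w := by
  induction w with
  | nil => exact ⟨[], rfl⟩
  | cons l w ih =>
    obtain ⟨w', rfl⟩ := ih fun x hx => h x (by simp [hx])
    obtain ⟨s, hs⟩ := h l (by simp)
    exact ⟨(s, l.2) :: w', by rw [mapW_cons, hs]⟩

theorem wordOver_range_mapW (w : Word S') : WordOver (Set.range f) (mapW f w) := by
  simpa using (wordOver_univ w).mapW (f := f)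

theorem WordOver.of_wordInv {T : Set S} {w : Word S} (h : WordOver T (wordInv w)) : WordOver T w := by
  simpa using h.inv

theorem IsRel.of_mapW (hf : Function.Injective f) (hm : ∀ a b, A.m (f a) (f b) = A'.m a b)
    {u v : Word S'} (h : IsRel A (ArtinTits.mapW f u) (ArtinTits.mapW f v)) : IsRel A' u v := by
  have h2 := h.two_le
  obtain ⟨s, t, k, hst, hk, hu, hv⟩ := h
  rw [hu, length_altWord] at h2
  obtain ⟨k, rfl⟩ := Nat.exists_eq_add_of_le' h2
  have hu' := wordOver_range_mapW (f := f) u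
  rw [hu] at hu'
  obtain ⟨a, rfl⟩ := hu' (s, true) (by simp [altWord])
  obtain ⟨b, rfl⟩ := hu' (t, true) (by simp [altWord])
  rw [← mapW_altWord] at hu hv
  exact ⟨a, b, k + 2, fun e => hst (congrArg f e), by rw [← hm, hk], mapW_injective hf hu,
    mapW_injective hf hv⟩

theorem OneStep.of_mapW (hf : Function.Injective f) (hm : ∀ a b, A.m (f a) (f b) = A'.m a b)
    {w : Word S'} {y : Word S} (h : OneStep A (mapW f w) y) :
    ∃ w', mapW f w' = y ∧ OneStep A' w w' := by
  have hw := wordOver_range_mapW (f := f) w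
  have hy := h.wordOver hw
  have inj := mapW_injective hf
  rcases h with ⟨w₁, w₂, s, b, e, rfl⟩ | ⟨w₁, w₂, u, v, h, ⟨e, rfl⟩ | ⟨e, rfl⟩⟩ |
    ⟨w₁, w₂, u₁, u₂, v₁, v₂, h, h1, h2, e, rfl⟩ | ⟨w₁, w₂, u₁, u₂, v₁, v₂, h, h1, h2, e, rfl⟩ <;>
  rw [e] at hw <;> simp only [wordOver_append] at hw hy
  · obtain ⟨w₁, rfl⟩ := exists_mapW hw.1.1
    obtain ⟨w₂, rfl⟩ := exists_mapW hw.2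
    obtain ⟨s, rfl⟩ := hw.1.2 (s, b) (by simp)
    exact ⟨w₁ ++ w₂, by simp, Or.inl ⟨w₁, w₂, s, b, inj (by simpa using e), rfl⟩⟩
  · obtain ⟨w₁, rfl⟩ := exists_mapW hw.1.1
    obtain ⟨w₂, rfl⟩ := exists_mapW hw.2
    obtain ⟨v, rfl⟩ := exists_mapW hw.1.2
    obtain ⟨u, rfl⟩ := exists_mapW hy.1.2
    exact ⟨w₁ ++ u ++ w₂, by simp, Or.inr (Or.inl ⟨w₁, w₂, u, v, h.of_mapW hf hm,
      Or.inl ⟨inj (by simpa using e), rfl⟩⟩)⟩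
  · obtain ⟨w₁, rfl⟩ := exists_mapW hw.1.1
    obtain ⟨w₂, rfl⟩ := exists_mapW hw.2
    obtain ⟨v, rfl⟩ := exists_mapW hw.1.2.of_wordInv
    obtain ⟨u, rfl⟩ := exists_mapW hy.1.2.of_wordInv
    exact ⟨w₁ ++ wordInv u ++ w₂, by simp, Or.inr (Or.inl ⟨w₁, w₂, u, v, h.of_mapW hf hm,
      Or.inr ⟨inj (by simpa using e), rfl⟩⟩)⟩
  · obtain ⟨w₁, rfl⟩ := exists_mapW hw.1.1.1
    obtain ⟨w₂, rfl⟩ := exists_mapW hw.2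
    obtain ⟨v₁, rfl⟩ := exists_mapW hw.1.1.2.of_wordInv
    obtain ⟨u₁, rfl⟩ := exists_mapW hw.1.2
    obtain ⟨v₂, rfl⟩ := exists_mapW hy.1.1.2
    obtain ⟨u₂, rfl⟩ := exists_mapW hy.1.2.of_wordInv
    rw [← mapW_append, ← mapW_append] at h
    exact ⟨w₁ ++ v₂ ++ wordInv u₂ ++ w₂, by simp, Or.inr (Or.inr (Or.inl ⟨w₁, w₂, u₁, u₂, v₁, v₂,
      h.of_mapW hf hm, by simpa using h1, by simpa using h2, inj (by simpa using e), rfl⟩))⟩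
  · obtain ⟨w₁, rfl⟩ := exists_mapW hw.1.1.1
    obtain ⟨w₂, rfl⟩ := exists_mapW hw.2
    obtain ⟨v₂, rfl⟩ := exists_mapW hw.1.1.2
    obtain ⟨u₂, rfl⟩ := exists_mapW hw.1.2.of_wordInv
    obtain ⟨v₁, rfl⟩ := exists_mapW hy.1.1.2.of_wordInv
    obtain ⟨u₁, rfl⟩ := exists_mapW hy.1.2
    rw [← mapW_append, ← mapW_append] at h
    exact ⟨w₁ ++ wordInv v₁ ++ u₁ ++ w₂, by simp, Or.inr (Or.inr (Or.inr ⟨w₁, w₂, u₁, u₂, v₁, v₂,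
      h.of_mapW hf hm, by simpa using h1, by simpa using h2, inj (by simpa using e), rfl⟩))⟩

theorem Steps012.of_mapW (hf : Function.Injective f) (hm : ∀ a b, A.m (f a) (f b) = A'.m a b)
    {w : Word S'} {y : Word S} (h : Steps012 A (ArtinTits.mapW f w) y) :
    ∃ w', ArtinTits.mapW f w' = y ∧ Steps012 A' w w' := by
  refine h.induct (p := fun x y => ∀ w, ArtinTits.mapW f w = x → ∃ w', ArtinTits.mapW f w' = y ∧ Steps012 A' w w')
    ?_ ?_ ?_ w rfl
  · exact fun x w h => ⟨w, h, Steps012.refl _ _⟩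
  · intro x y z h1 h2 w hw
    obtain ⟨w', hw', h3⟩ := h1 w hw
    obtain ⟨w'', hw'', h4⟩ := h2 w' hw'
    exact ⟨w'', hw'', h3.trans h4⟩
  · rintro x y h w rfl
    obtain ⟨w', e, h'⟩ := h.of_mapW hf hm
    exact ⟨w', e, h'.steps⟩

theorem Reducible.wbar_eq_of_mapW (hA : Reducible A) (hf : Function.Injective f)
    (hm : ∀ a b, A.m (f a) (f b) = A'.m a b) {w w' : Word S'}
    (h : wbar A (mapW f w) = wbar A (mapW f w')) : wbar A' w = wbar A' w' := by
  have h1 : Steps012 A (mapW f (w ++ wordInv w')) [] := hA.steps_nil (by simp [h, wbar_wordInv])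
  obtain ⟨v, hv, h2⟩ := h1.of_mapW (A' := A') hf hm
  rw [mapW_eq_nil] at hv
  subst hv
  have := h2.wbar_eq
  rwa [wbar_append, wbar_wordInv, wbar_nil, mul_inv_eq_one] at this

end

/-! ### Canonical representatives of cosets -/

/-- A choice of words representing the left cosets of a parabolic subgroup, which can be reached
from every word of the coset by special transformations. -/
structure Rep (A : ArtinData S) (T : Set S) (r : ArtinGroup A → Word S) : Prop where
  mul : ∀ g, ∀ a ∈ parab A T, r (g * a) = r g
  steps : ∀ w, ∃ u, WordOver T u ∧ Steps012 A w (r (wbar A w) ++ u)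

theorem Reducible.exists_rep {A : ArtinData S} (h : Reducible A) (T : Set S) : ∃ r, Rep A T r := by
  obtain ⟨nf, hnf⟩ := h.nf
  obtain ⟨X, hX, hr⟩ := h.tr T
  have key (g) : ∃ x ∈ X, g⁻¹ * x ∈ parab A T := by
    obtain ⟨w, rfl⟩ := wbar_surjective A g
    obtain ⟨v, u, hu, h1, h2⟩ := hr w
    refine ⟨_, h2, ?_⟩
    rw [h1.wbar_eq, wbar_append]
    simpa using inv_mem (wbar_mem_parab hu)
  choose ρ hρ hρ' using key
  have uniq {g x} (hx : x ∈ X) (hg : g⁻¹ * x ∈ parab A T) : ρ g = x := by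
    refine hX _ (hρ g) _ hx ?_
    have := mul_mem (inv_mem (hρ' g)) hg
    simpa [mul_assoc] using this
  refine ⟨fun g => nf (ρ g), fun g a ha => ?_, fun w => ?_⟩
  · rw [uniq (hρ g)]
    have := mul_mem (inv_mem ha) (hρ' g)
    simpa [mul_assoc] using this
  · obtain ⟨v, u, hu, h1, h2⟩ := hr w
    refine ⟨u, hu, h1.trans ?_⟩
    rw [uniq h2 (by rw [h1.wbar_eq, wbar_append]; simpa using inv_mem (wbar_mem_parab hu))]
    exact (hnf v).append (Steps012.refl A u)

namespace Rep

variable {A : ArtinData S} {T : Set S} {r : ArtinGroup A → Word S} (h : Rep A T r)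
include h

theorem wordOver {w : Word S} {V : Set S} (hw : WordOver V w) :
    ∃ u, WordOver T u ∧ WordOver V u ∧ WordOver V (r (wbar A w)) ∧
      Steps012 A w (r (wbar A w) ++ u) := by
  obtain ⟨u, hu, h1⟩ := h.steps w
  have := wordOver_append.1 (h1.wordOver hw)
  exact ⟨u, hu, this.2, this.1, h1⟩

theorem map_one : r 1 = [] := by
  obtain ⟨u, -, h1⟩ := h.steps []
  have := h1.eq_nil
  rw [wbar_nil, append_eq_nil_iff] at this
  exact this.1

theorem inv_mul_mem (g : ArtinGroup A) : (wbar A (r g))⁻¹ * g ∈ parab A T := by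
  obtain ⟨w, rfl⟩ := wbar_surjective A g
  obtain ⟨u, hu, h1⟩ := h.steps w
  have := h1.wbar_eq
  rw [wbar_append] at this
  rw [inv_mul_eq_iff_eq_mul.2 this]
  exact wbar_mem_parab hu

theorem map_wbar (g : ArtinGroup A) : r (wbar A (r g)) = r g := by
  have := h.mul (wbar A (r g)) _ (h.inv_mul_mem g)
  rwa [mul_inv_cancel_left, eq_comm] at this

end Rep

theorem reducible_of_rep {A : ArtinData S} (h : ∀ T, ∃ r, Rep A T r) : Reducible A := by
  constructor
  · obtain ⟨r, hr⟩ := h ∅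
    refine ⟨r, fun w => ?_⟩
    obtain ⟨u, hu, h1⟩ := hr.steps w
    have : u = [] := eq_nil_iff_forall_not_mem.2 fun l hl => hu l hl
    rwa [this, append_nil] at h1
  · intro T
    obtain ⟨r, hr⟩ := h T
    refine ⟨Set.range fun g => wbar A (r g), ?_, fun w => ?_⟩
    · rintro _ ⟨g, rfl⟩ _ ⟨g', rfl⟩ hgg
      have := hr.mul (wbar A (r g)) _ hgg
      rw [mul_inv_cancel_left, hr.map_wbar, hr.map_wbar] at this
      simp only [this]
    · obtain ⟨u, hu, h1⟩ := hr.steps w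
      exact ⟨_, u, hu, h1, _, rfl⟩

end

section

/-! ### Amalgamated products of Artin-Tits groups -/

/-- A decomposition of the set of generators into subsets `U i` whose pairwise intersections are
contained in `W`, such that every relation involves generators of some `U i`. -/
structure Splitting (A : ArtinData S) (I : Type*) where
  U : I → Set S
  W : Set S
  subset : ∀ i, W ⊆ U i
  inter : ∀ i j, i ≠ j → U i ∩ U j ⊆ W
  cover : ∀ s, ∃ i, s ∈ U i
  rel : ∀ s t, s ≠ t → A.m s t ≠ ⊤ → ∃ i, s ∈ U i ∧ t ∈ U i

namespace Splitting

variable {A : ArtinData S} {I : Type*}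

/-- The inclusion of `W` in `U i`. -/
def incl (P : Splitting A I) (i : I) : P.W → P.U i := Set.inclusion (P.subset i)

@[simp] theorem mapW_val_incl (P : Splitting A I) (i : I) (w : Word P.W) :
    mapW Subtype.val (mapW (P.incl i) w) = mapW Subtype.val w := by
  simp only [mapW, map_map]
  rfl

theorem incl_injective (P : Splitting A I) (i : I) : Function.Injective (P.incl i) :=
  Set.inclusion_injective (P.subset i)

theorem exists_mapW_incl (P : Splitting A I) {i : I} {w : Word (P.U i)}
    (hw : WordOver (Subtype.val ⁻¹' P.W) w) : ∃ w', mapW (P.incl i) w' = w := by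
  refine exists_mapW fun l hl => ?_
  exact ⟨⟨l.1.1, hw l hl⟩, rfl⟩

theorem wordOver_mapW_incl (P : Splitting A I) (i : I) (w : Word P.W) :
    WordOver (Subtype.val ⁻¹' P.W) (mapW (P.incl i) w) := by
  intro l hl
  simp only [mapW, mem_map] at hl
  obtain ⟨l', -, rfl⟩ := hl
  exact l'.1.2

end Splitting

/-- Choices of representatives and of embeddings for the parts of a splitting. -/
structure Gluing (A : ArtinData S) (I : Type*) extends Splitting A I where
  c : ∀ i, ArtinGroup (A.restrict (U i)) → Word (U i)
  rep : ∀ i, Rep (A.restrict (U i)) (Subtype.val ⁻¹' W) (c i)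
  nf : ArtinGroup (A.restrict W) → Word W
  steps_nf : ∀ w, Steps012 (A.restrict W) w (nf (wbar _ w))
  ι : ∀ i, ArtinGroup (A.restrict W) →* ArtinGroup (A.restrict (U i))
  ι_wbar : ∀ i w, ι i (wbar _ w) = wbar _ (mapW (Set.inclusion (subset i)) w)
  ι_inj : ∀ i, Function.Injective (ι i)

theorem Splitting.exists_gluing {A : ArtinData S} {I : Type*} (P : Splitting A I)
    (hU : ∀ i, Reducible (A.restrict (P.U i))) (hW : Reducible (A.restrict P.W)) :
    ∃ Q : Gluing A I, Q.toSplitting = P := by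
  choose c hc using fun i => (hU i).exists_rep (Subtype.val ⁻¹' P.W)
  obtain ⟨nf, hnf⟩ := hW.nf
  choose ι hι using fun i => exists_mapHom (A' := A.restrict P.W) (A := A.restrict (P.U i))
    (P.incl_injective i) (fun _ _ => rfl)
  refine ⟨⟨P, c, hc, nf, hnf, ι, hι, fun i x y hxy => ?_⟩, rfl⟩
  obtain ⟨w, rfl⟩ := wbar_surjective _ x
  obtain ⟨w', rfl⟩ := wbar_surjective _ y
  rw [hι, hι] at hxy
  exact (hU i).wbar_eq_of_mapW (P.incl_injective i) (fun _ _ => rfl) hxy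

namespace Gluing

variable {A : ArtinData S} {I : Type*} (Q : Gluing A I)

theorem ι_wbar' (i : I) (w : Word Q.W) :
    Q.ι i (wbar _ w) = wbar (A.restrict (Q.U i)) (mapW (Q.incl i) w) := Q.ι_wbar i w

theorem wbar_nf (k : ArtinGroup (A.restrict Q.W)) : wbar _ (Q.nf k) = k := by
  obtain ⟨w, rfl⟩ := wbar_surjective _ k
  exact (Q.steps_nf w).wbar_eq.symm

theorem exists_ι {i : I} {w : Word (Q.U i)} (hw : WordOver (Subtype.val ⁻¹' Q.W) w) :
    ∃ w' : Word Q.W, mapW (Q.incl i) w' = w ∧ Q.ι i (wbar _ w') = wbar _ w := by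
  obtain ⟨w', rfl⟩ := Q.exists_mapW_incl hw
  exact ⟨w', rfl, Q.ι_wbar i w'⟩

theorem ι_mem (i : I) {T : Set S} {k : ArtinGroup (A.restrict Q.W)}
    (hk : k ∈ parab (A.restrict Q.W) (Subtype.val ⁻¹' T)) :
    Q.ι i k ∈ parab (A.restrict (Q.U i)) (Subtype.val ⁻¹' T) := by
  obtain ⟨w, hw, rfl⟩ := mem_parab_iff.1 hk
  rw [Q.ι_wbar']
  refine wbar_mem_parab fun l hl => ?_
  simp only [mapW, mem_map] at hl
  obtain ⟨l', hl', rfl⟩ := hl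
  exact hw l' hl'

theorem ι_mem_W (i : I) (k : ArtinGroup (A.restrict Q.W)) :
    Q.ι i k ∈ parab (A.restrict (Q.U i)) (Subtype.val ⁻¹' Q.W) := by
  obtain ⟨w, rfl⟩ := wbar_surjective _ k
  rw [Q.ι_wbar']
  exact wbar_mem_parab (Q.wordOver_mapW_incl i w)

theorem exists_η (i : I) (g : ArtinGroup (A.restrict (Q.U i))) :
    ∃ k, wbar _ (Q.c i g) * Q.ι i k = g := by
  obtain ⟨u, hu, h⟩ := mem_parab_iff.1 ((Q.rep i).inv_mul_mem g)
  obtain ⟨w, -, h2⟩ := Q.exists_ι hu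
  exact ⟨wbar _ w, by rw [h2, h, mul_inv_cancel_left]⟩

/-- The component in `W` of an element of `G i`. -/
noncomputable def η (i : I) (g : ArtinGroup (A.restrict (Q.U i))) : ArtinGroup (A.restrict Q.W) :=
  (Q.exists_η i g).choose

theorem dec (i : I) (g : ArtinGroup (A.restrict (Q.U i))) :
    wbar _ (Q.c i g) * Q.ι i (Q.η i g) = g := (Q.exists_η i g).choose_spec

/-- The amalgamated product of the parts of a splitting. -/
noncomputable def amalgam :
    Amalgam I (ArtinGroup (A.restrict Q.W)) fun i => ArtinGroup (A.restrict (Q.U i)) where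
  ι := Q.ι
  τ i g := wbar _ (Q.c i g)
  η := Q.η
  dec := Q.dec
  τ_mul i g k := by rw [(Q.rep i).mul g _ (Q.ι_mem_W i k)]
  η_mul i g k := by
    apply Q.ι_inj i
    have h := Q.dec i (g * Q.ι i k)
    rw [(Q.rep i).mul g _ (Q.ι_mem_W i k)] at h
    rw [map_mul, eq_inv_mul_of_mul_eq h, eq_inv_mul_of_mul_eq (Q.dec i g), mul_assoc]
  τ_one i := by rw [(Q.rep i).map_one, wbar_nil]
  η_one i := by
    apply Q.ι_inj i
    have h := Q.dec i 1
    rw [(Q.rep i).map_one, wbar_nil, one_mul] at h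
    rw [h, map_one]

theorem exists_hom {P : Type*} [Group P] (H : ∀ i, ArtinGroup (A.restrict (Q.U i)) →* P)
    (hH : ∀ i j k, H i (Q.ι i k) = H j (Q.ι j k)) :
    ∃ φ : ArtinGroup A →* P, ∀ i (w : Word (Q.U i)),
      φ (wbar A (mapW Subtype.val w)) = H i (wbar _ w) := by
  choose p hp using Q.cover
  let f : S → P := fun s => H (p s) (wbar _ [(⟨s, hp s⟩, true)])
  have hf (i) (s) (hs : s ∈ Q.U i) : f s = H i (wbar _ [(⟨s, hs⟩, true)]) := by
    by_cases h : p s = i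
    · subst h
      rfl
    · have hW : s ∈ Q.W := Q.inter _ _ h ⟨hp s, hs⟩
      have := hH (p s) i (wbar _ [((⟨s, hW⟩ : Q.W), true)])
      rwa [Q.ι_wbar', Q.ι_wbar'] at this
  let F : Word S → P := fun w => FreeGroup.lift f (FreeGroup.mk w)
  have happ (u v) : F (u ++ v) = F u * F v := by
    simp only [F, ← FreeGroup.mul_mk, map_mul]
  have h1 (s) : F [(s, true)] = f s := by simp [F]
  have hinv (s) : F [(s, false)] = (F [(s, true)])⁻¹ := by simp [F]
  have hnil : F [] = 1 := by simp [F]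
  have hF (i) (w : Word (Q.U i)) : F (mapW Subtype.val w) = H i (wbar _ w) := by
    induction w with
    | nil => simp [hnil]
    | cons l w ih =>
      have e : wbar (A.restrict (Q.U i)) (l :: w) = wbar _ [l] * wbar _ w := wbar_append _ [l] w
      rw [e, map_mul, ← ih, mapW_cons, ← singleton_append, happ]
      congr 1
      obtain ⟨⟨s, hs⟩, b⟩ := l
      cases b
      · have e2 : wbar (A.restrict (Q.U i)) [((⟨s, hs⟩ : Q.U i), false)] =
            (wbar _ [((⟨s, hs⟩ : Q.U i), true)])⁻¹ := wbar_wordInv _ [((⟨s, hs⟩ : Q.U i), true)]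
        rw [e2, map_inv, ← hf, ← h1]
        exact hinv s
      · rw [← hf]
        exact h1 s
  obtain ⟨φ, hφ⟩ := exists_artinLift A F hnil happ hinv fun u v h => by
    obtain ⟨s, t, k, hst, hk, rfl, rfl⟩ := h
    obtain ⟨i, hs, ht⟩ := Q.rel s t hst (by simp [hk])
    have e1 : altWord s t k = mapW Subtype.val (altWord (⟨s, hs⟩ : Q.U i) ⟨t, ht⟩ k) := by simp
    have e2 : altWord t s k = mapW Subtype.val (altWord (⟨t, ht⟩ : Q.U i) ⟨s, hs⟩ k) := by simp
    rw [e1, e2, hF, hF]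
    congr 1
    refine IsRel.wbar_eq ?_
    exact ⟨⟨s, hs⟩, ⟨t, ht⟩, k, by simpa using hst, hk, rfl, rfl⟩
  exact ⟨φ, fun i w => by rw [hφ, hF]⟩

/-- The word represented by a list of syllables. -/
noncomputable def wd : List (Σ i, ArtinGroup (A.restrict (Q.U i))) → Word S
  | [] => []
  | x :: L => wd L ++ mapW Subtype.val (Q.c x.1 x.2)

theorem steps_push (L : List (Σ i, ArtinGroup (A.restrict (Q.U i)))) {i : I} (w : Word (Q.U i)) :
    Steps012 A (Q.wd L ++ mapW Subtype.val w) (Q.wd (Q.amalgam.push L i (wbar _ w)).1 ++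
      mapW Subtype.val (Q.nf (Q.amalgam.push L i (wbar _ w)).2)) := by
  obtain ⟨u, hu, h⟩ := (Q.rep i).steps w
  obtain ⟨u', rfl, h'⟩ := Q.exists_ι hu
  have e : Q.amalgam.η i (wbar _ w) = wbar _ u' := by
    apply Q.ι_inj i
    have h1 := Q.amalgam.dec i (wbar _ w)
    have h2 := h.wbar_eq
    rw [wbar_append, ← h'] at h2
    exact mul_left_cancel (h1.trans h2)
  have h3 : Steps012 A (Q.wd L ++ mapW Subtype.val w) (Q.wd L ++
      mapW Subtype.val (Q.c i (wbar _ w)) ++ mapW Subtype.val (Q.nf (wbar _ u'))) := by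
    have h4 := steps_mapW_restrict h
    have h5 := steps_mapW_restrict (Q.steps_nf u')
    rw [mapW_append, Q.mapW_val_incl] at h4
    have h6 := h4.trans ((Steps012.refl A _).append h5)
    rw [append_assoc]
    exact (Steps012.refl A _).append h6
  refine h3.trans ?_
  rw [Amalgam.push, e]
  split_ifs with hx
  · have : Q.c i (wbar _ w) = [] := by
      rw [← (Q.rep i).map_wbar, ← (Q.rep i).map_one]
      exact congrArg _ hx
    rw [this]
    simpa using Steps012.refl A _
  · have : Q.c i (Q.amalgam.τ i (wbar _ w)) = Q.c i (wbar _ w) := (Q.rep i).map_wbar _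
    simp only [wd, this]
    exact Steps012.refl A _

theorem exists_pop {L : List (Σ i, ArtinGroup (A.restrict (Q.U i)))} (hL : Q.amalgam.Good L)
    (i : I) (k : ArtinGroup (A.restrict Q.W)) :
    ∃ w : Word (Q.U i), wbar _ w = (Q.amalgam.pop i L k).2 ∧
      Q.wd L ++ mapW Subtype.val (Q.nf k) =
        Q.wd (Q.amalgam.pop i L k).1 ++ mapW Subtype.val w := by
  rcases hL.cases i with h | ⟨t, L, rfl, ht, -⟩
  · refine ⟨mapW (Q.incl i) (Q.nf k), ?_, ?_⟩
    · rw [Amalgam.pop_away _ h, ← Q.ι_wbar', Q.wbar_nf]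
      rfl
    · rw [Amalgam.pop_away _ h, Q.mapW_val_incl]
  · refine ⟨Q.c i t ++ mapW (Q.incl i) (Q.nf k), ?_, ?_⟩
    · rw [Amalgam.pop_cons_self, wbar_append, ← Q.ι_wbar', Q.wbar_nf]
      exact congrArg (· * _) ht
    · rw [Amalgam.pop_cons_self, mapW_append, Q.mapW_val_incl, wd, append_assoc]

theorem steps_act (X : Q.amalgam.NF) {i : I} (w : Word (Q.U i)) :
    Steps012 A (Q.wd X.1.1 ++ mapW Subtype.val (Q.nf X.2) ++ mapW Subtype.val w)
      (Q.wd (Q.amalgam.act i (wbar _ w) X).1.1 ++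
        mapW Subtype.val (Q.nf (Q.amalgam.act i (wbar _ w) X).2)) := by
  obtain ⟨x, hx, e⟩ := Q.exists_pop X.1.2 i X.2
  rw [e, append_assoc, ← mapW_append]
  have := Q.steps_push (Q.amalgam.pop i X.1.1 X.2).1 (x ++ w)
  rw [wbar_append, hx] at this
  exact this

theorem exists_run : ∃ run : ArtinGroup A → Q.amalgam.NF,
    (∀ g i (w : Word (Q.U i)), run (g * wbar A (mapW Subtype.val w)) =
      Q.amalgam.act i (wbar _ w) (run g)) ∧
    ∀ w, Steps012 A w (Q.wd (run (wbar A w)).1.1 ++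
      mapW Subtype.val (Q.nf (run (wbar A w)).2)) := by
  obtain ⟨φ, hφ⟩ := Q.exists_hom Q.amalgam.actHom Q.amalgam.actHom_ι
  let X₀ : Q.amalgam.NF := (⟨[], trivial⟩, 1)
  have key : ∀ g i (w : Word (Q.U i)), (φ (g * wbar A (mapW Subtype.val w))).unop X₀ =
      Q.amalgam.act i (wbar _ w) ((φ g).unop X₀) := by
    intro g i w
    rw [map_mul, hφ]
    rfl
  refine ⟨fun g => (φ g).unop X₀, key, fun w => ?_⟩
  induction w using List.reverseRecOn with
  | nil =>
    have h1 : Q.nf 1 = [] := by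
      have := (Q.steps_nf []).eq_nil
      rwa [wbar_nil] at this
    have h2 : (φ (wbar A [])).unop X₀ = X₀ := by
      rw [wbar_nil, map_one]
      rfl
    simp only [h2]
    change Steps012 A [] (Q.wd [] ++ mapW Subtype.val (Q.nf 1))
    rw [h1]
    exact Steps012.refl A _
  | append_singleton w l ih =>
    obtain ⟨i, hi⟩ := Q.cover l.1
    have e : [l] = mapW Subtype.val [((⟨l.1, hi⟩ : Q.U i), l.2)] := rfl
    have h1 := ih.append (Steps012.refl A [l])
    refine h1.trans ?_
    have h2 := Q.steps_act ((φ (wbar A w)).unop X₀) [((⟨l.1, hi⟩ : Q.U i), l.2)]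
    simp only [wbar_append]
    rw [e, key]
    exact h2

section

variable {T : Set S} {r : ∀ i, ArtinGroup (A.restrict (Q.U i)) → Word (Q.U i)}
  {rW : ArtinGroup (A.restrict Q.W) → Word Q.W}

/-- The representative of the coset of a normal form, relative to a parabolic subgroup. -/
noncomputable def coset (r : ∀ i, ArtinGroup (A.restrict (Q.U i)) → Word (Q.U i))
    (rW : ArtinGroup (A.restrict Q.W) → Word Q.W) :
    List (Σ i, ArtinGroup (A.restrict (Q.U i))) → ArtinGroup (A.restrict Q.W) → Word S
  | [], k => mapW Subtype.val (rW k)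
  | ⟨i, t⟩ :: L, k =>
    if h : ∃ w : Word Q.W, mapW (Q.incl i) w = r i (t * Q.ι i k) then coset r rW L (wbar _ h.choose)
    else Q.wd L ++ mapW Subtype.val (r i (t * Q.ι i k))

/-- The representative of the coset of the product of a normal form by an element of `G i`. -/
noncomputable def cosetPop (r : ∀ i, ArtinGroup (A.restrict (Q.U i)) → Word (Q.U i))
    (rW : ArtinGroup (A.restrict Q.W) → Word Q.W) (i : I)
    (p : List (Σ i, ArtinGroup (A.restrict (Q.U i))) × ArtinGroup (A.restrict (Q.U i))) : Word S :=
  if h : ∃ w : Word Q.W, mapW (Q.incl i) w = r i p.2 then Q.coset r rW p.1 (wbar _ h.choose)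
    else Q.wd p.1 ++ mapW Subtype.val (r i p.2)

theorem coset_cons (i : I) (t : ArtinGroup (A.restrict (Q.U i)))
    (L : List (Σ i, ArtinGroup (A.restrict (Q.U i)))) (k : ArtinGroup (A.restrict Q.W)) :
    Q.coset r rW (⟨i, t⟩ :: L) k = Q.cosetPop r rW i (L, t * Q.ι i k) := by
  rw [coset, cosetPop]

theorem cosetPop_of_eq {i : I} {L : List (Σ i, ArtinGroup (A.restrict (Q.U i)))}
    {g : ArtinGroup (A.restrict (Q.U i))} {w : Word Q.W} (h : mapW (Q.incl i) w = r i g) :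
    Q.cosetPop r rW i (L, g) = Q.coset r rW L (wbar _ w) := by
  have h' : ∃ w : Word Q.W, mapW (Q.incl i) w = r i g := ⟨w, h⟩
  rw [cosetPop, dif_pos h', mapW_injective (Q.incl_injective i) (h'.choose_spec.trans h.symm)]

theorem cosetPop_congr {i : I} {L : List (Σ i, ArtinGroup (A.restrict (Q.U i)))}
    {g g' : ArtinGroup (A.restrict (Q.U i))} (h : r i g = r i g') :
    Q.cosetPop r rW i (L, g) = Q.cosetPop r rW i (L, g') := by
  simp only [cosetPop, h]

variable (hr : ∀ i, Rep (A.restrict (Q.U i)) (Subtype.val ⁻¹' T) (r i))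
  (hW : Rep (A.restrict Q.W) (Subtype.val ⁻¹' T) rW)

include hr hW

theorem coset_mul (L : List (Σ i, ArtinGroup (A.restrict (Q.U i))))
    (k : ArtinGroup (A.restrict Q.W)) {a : ArtinGroup (A.restrict Q.W)}
    (ha : a ∈ parab (A.restrict Q.W) (Subtype.val ⁻¹' T)) :
    Q.coset r rW L (k * a) = Q.coset r rW L k := by
  rcases L with _ | ⟨⟨i, t⟩, L⟩
  · rw [coset, coset, hW.mul k a ha]
  · rw [coset_cons, coset_cons]
    apply cosetPop_congr
    rw [map_mul, ← mul_assoc]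
    exact (hr i).mul _ _ (Q.ι_mem i ha)

theorem coset_eq {L : List (Σ i, ArtinGroup (A.restrict (Q.U i)))} (hL : Q.amalgam.Good L) (i : I)
    (k : ArtinGroup (A.restrict Q.W)) :
    Q.coset r rW L k = Q.cosetPop r rW i (Q.amalgam.pop i L k) := by
  rcases hL.cases i with h | ⟨t, L, rfl, -⟩
  · rw [Amalgam.pop_away _ h]
    obtain ⟨w, rfl⟩ := wbar_surjective _ k
    obtain ⟨u, hu, hu', h1, h2⟩ := (hr i).wordOver (Q.wordOver_mapW_incl i w)
    obtain ⟨u', rfl, h3⟩ := Q.exists_ι hu'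
    obtain ⟨v, hv, h4⟩ := Q.exists_ι h1
    have h5 : Q.amalgam.ι i (wbar _ w) = wbar _ (mapW (Q.incl i) w) := Q.ι_wbar i w
    rw [h5, Q.cosetPop_of_eq hv]
    have h6 := h2.wbar_eq
    rw [wbar_append, ← h3, ← h4, ← Q.ι_wbar', ← map_mul] at h6
    rw [Q.ι_inj i h6]
    refine Q.coset_mul hr hW L _ (wbar_mem_parab fun l hl => ?_)
    exact hu (Q.incl i l.1, l.2) (mem_map_of_mem hl)
  · rw [Amalgam.pop_cons_self, coset_cons]
    rfl

theorem coset_act (X : Q.amalgam.NF) {i : I} {a : ArtinGroup (A.restrict (Q.U i))}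
    (ha : a ∈ parab (A.restrict (Q.U i)) (Subtype.val ⁻¹' T)) :
    Q.coset r rW (Q.amalgam.act i a X).1.1 (Q.amalgam.act i a X).2 =
      Q.coset r rW X.1.1 X.2 := by
  rw [Q.coset_eq hr hW (Q.amalgam.act i a X).1.2 i, Q.coset_eq hr hW X.1.2 i, Amalgam.pop_act]
  exact Q.cosetPop_congr ((hr i).mul _ _ ha)

theorem steps_coset {L : List (Σ i, ArtinGroup (A.restrict (Q.U i)))} (hL : Q.amalgam.Good L)
    (k : ArtinGroup (A.restrict Q.W)) : ∃ u, WordOver T u ∧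
      Steps012 A (Q.wd L ++ mapW Subtype.val (Q.nf k)) (Q.coset r rW L k ++ u) := by
  have himg {V : Set S} {u : Word V} (hu : WordOver (Subtype.val ⁻¹' T) u) :
      WordOver T (mapW Subtype.val u) := by
    intro l hl
    simp only [mapW, mem_map] at hl
    obtain ⟨l', hl', rfl⟩ := hl
    exact hu l' hl'
  induction L generalizing k with
  | nil =>
    obtain ⟨u, hu, h⟩ := hW.steps (Q.nf k)
    rw [Q.wbar_nf] at h
    refine ⟨_, himg hu, ?_⟩
    rw [coset, ← mapW_append]
    exact steps_mapW_restrict h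
  | cons x L ih =>
    obtain ⟨i, t⟩ := x
    obtain ⟨ht, -, -, hL⟩ := hL
    obtain ⟨u, hu, h⟩ := (hr i).steps (Q.c i t ++ mapW (Q.incl i) (Q.nf k))
    have e : wbar (A.restrict (Q.U i)) (Q.c i t ++ mapW (Q.incl i) (Q.nf k)) = t * Q.ι i k := by
      rw [wbar_append, ← Q.ι_wbar', Q.wbar_nf]
      exact congrArg (· * _) ht
    rw [e] at h
    have h1 := steps_mapW_restrict h
    rw [mapW_append, mapW_append, Q.mapW_val_incl] at h1
    have h2 := (Steps012.refl A (Q.wd L)).append h1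
    rw [← append_assoc, ← append_assoc] at h2
    rw [wd, coset_cons]
    by_cases h3 : ∃ w : Word Q.W, mapW (Q.incl i) w = r i (t * Q.ι i k)
    · obtain ⟨w, hw⟩ := h3
      obtain ⟨u', hu', h4⟩ := ih hL (wbar _ w)
      refine ⟨u' ++ mapW Subtype.val u, hu'.append (himg hu), h2.trans ?_⟩
      rw [Q.cosetPop_of_eq hw, ← hw, Q.mapW_val_incl, ← append_assoc]
      have h5 := (Steps012.refl A (Q.wd L)).append (steps_mapW_restrict (Q.steps_nf w))
      exact (h5.trans h4).append (Steps012.refl A _)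
    · refine ⟨_, himg hu, ?_⟩
      rw [cosetPop, dif_neg h3]
      exact h2

theorem exists_rep : ∃ ρ, Rep A T ρ := by
  obtain ⟨run, h1, h2⟩ := Q.exists_run
  refine ⟨fun g => Q.coset r rW (run g).1.1 (run g).2, ?_, fun w => ?_⟩
  · intro g a ha
    induction ha using Subgroup.closure_induction generalizing g with
    | mem x hx =>
      obtain ⟨s, hs, rfl⟩ := hx
      obtain ⟨i, hi⟩ := Q.cover s
      have e := h1 g i [(⟨s, hi⟩, true)]
      simp only [mapW_cons, mapW_nil] at e
      rw [e]
      exact Q.coset_act hr hW (run g) (wbar_mem_parab (by simpa [WordOver] using hs))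
    | one => rw [mul_one]
    | mul x y _ _ hx hy => rw [← mul_assoc, hy, hx]
    | inv x _ hx =>
      have := hx (g * x⁻¹)
      rw [inv_mul_cancel_right] at this
      exact this.symm
  · obtain ⟨u, hu, h3⟩ := Q.steps_coset hr hW (run (wbar A w)).1.2 (run (wbar A w)).2
    exact ⟨u, hu, (h2 w).trans h3⟩

end

end Gluing

/-- Properties of the parts of a splitting extend to the whole group. -/
theorem Splitting.reducible {A : ArtinData S} {I : Type*} (P : Splitting A I)
    (hU : ∀ i, Reducible (A.restrict (P.U i))) (hW : Reducible (A.restrict P.W)) :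
    Reducible A := by
  obtain ⟨Q, rfl⟩ := P.exists_gluing hU hW
  refine reducible_of_rep fun T => ?_
  choose r hr using fun i => (hU i).exists_rep (Subtype.val ⁻¹' T)
  obtain ⟨rW, hrW⟩ := hW.exists_rep (Subtype.val ⁻¹' T)
  exact Q.exists_rep hr hrW

end

section

universe u

variable {S : Type u}

/-! ### Decomposition into pieces of spherical or large type -/

theorem finite_cox_of_equiv {S' : Type*} {A : ArtinData S} {A' : ArtinData S'} (e : S ≃ S')
    (hm : ∀ a b, A'.m (e a) (e b) = A.m a b) (h : Finite A.cox.Group) : Finite A'.cox.Group := by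
  have h1 : A.cox.reindex e = A'.cox := by
    ext i j
    obtain ⟨a, rfl⟩ := e.surjective i
    obtain ⟨b, rfl⟩ := e.surjective j
    change A.cox (e.symm (e a)) (e.symm (e b)) = A'.cox (e a) (e b)
    rw [e.symm_apply_apply, e.symm_apply_apply]
    by_cases hab : a = b
    · rw [hab, CoxeterMatrix.diagonal, CoxeterMatrix.diagonal]
    · rw [ArtinData.cox_apply _ hab, ArtinData.cox_apply _ (e.injective.ne hab), hm]
  rw [← h1]
  exact Finite.of_equiv _ (A.cox.reindexGroupEquiv e).symm.toEquiv

/-- Every connected full subgraph without `∞` is of spherical type or of large type. -/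
def SphericalOrLarge (A : ArtinData S) : Prop :=
  ∀ T : Set S, CoxConnected A T → (∀ x ∈ T, ∀ y ∈ T, x ≠ y → A.m x y ≠ ⊤) →
    Finite (A.restrict T).cox.Group ∨ LargeTypeOn A T

theorem SphericalOrLarge.restrict {A : ArtinData S} (h : SphericalOrLarge A) (U : Set S) :
    SphericalOrLarge (A.restrict U) := by
  intro T hT hm
  have h1 : CoxConnected A (Subtype.val '' T) := by
    rintro _ ⟨x, hx, rfl⟩ _ ⟨y, hy, rfl⟩
    refine (hT x hx y hy).lift Subtype.val fun a b hab => ?_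
    exact ⟨⟨a, hab.1, rfl⟩, ⟨b, hab.2.1, rfl⟩, Subtype.val_injective.ne hab.2.2.1, hab.2.2.2⟩
  have h2 : ∀ x ∈ Subtype.val '' T, ∀ y ∈ Subtype.val '' T, x ≠ y → A.m x y ≠ ⊤ := by
    rintro _ ⟨x, hx, rfl⟩ _ ⟨y, hy, rfl⟩ hxy
    exact hm x hx y hy fun e => hxy (congrArg _ e)
  rcases h _ h1 h2 with h | h
  · refine Or.inl (finite_cox_of_equiv (Equiv.Set.image _ T Subtype.val_injective).symm ?_ h)
    intro a b
    obtain ⟨a, rfl⟩ := (Equiv.Set.image Subtype.val T Subtype.val_injective).surjective a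
    obtain ⟨b, rfl⟩ := (Equiv.Set.image Subtype.val T Subtype.val_injective).surjective b
    rw [Equiv.symm_apply_apply, Equiv.symm_apply_apply]
    rfl
  · exact Or.inr fun x hx y hy hxy =>
      h _ ⟨x, hx, rfl⟩ _ ⟨y, hy, rfl⟩ (Subtype.val_injective.ne hxy)

/-- The decomposition given by two generators with label `∞`. -/
def splittingOfTop (A : ArtinData S) {s t : S} (hst : s ≠ t) (h : A.m s t = ⊤) :
    Splitting A Bool where
  U b := {bif b then s else t}ᶜ
  W := {s, t}ᶜ
  subset b x hx := by
    cases b <;> simp_all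
  inter i j hij x hx := by
    cases i <;> cases j <;> simp_all
  cover x := by
    by_cases hx : x = s
    · exact ⟨false, by simpa [hx] using hst⟩
    · exact ⟨true, by simpa using hx⟩
  rel x y hxy hm := by
    by_contra! h'
    have h1 := h' true
    have h2 := h' false
    simp only [cond_true, cond_false, Set.mem_compl_iff, Set.mem_singleton_iff,
      not_not] at h1 h2
    by_cases hx : x = s
    · subst hx
      exact hm (h2 hst ▸ h)
    · have hy := h1 hx
      subst hy
      by_cases hx' : x = t
      · subst hx'
        exact hm ((A.symm _ _).trans h)
      · exact hst (h2 hx')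

theorem SphericalOrLarge.reducible [Finite S] {A : ArtinData S} (h : SphericalOrLarge A) :
    Reducible A := by
  induction hn : Nat.card S using Nat.strong_induction_on generalizing S with
  | _ n ih =>
  subst hn
  have sub (U : Set S) (x : S) (hx : x ∉ U) : Reducible (A.restrict U) :=
    ih _ (Finite.card_subtype_lt hx) (h.restrict U) rfl
  by_cases h1 : ∃ s t, s ≠ t ∧ A.m s t = ⊤
  · obtain ⟨s, t, hst, hm⟩ := h1
    refine (splittingOfTop A hst hm).reducible (fun b => ?_) ?_
    · exact sub _ (bif b then s else t) (by simp [splittingOfTop])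
    · exact sub _ s (by simp [splittingOfTop])
  push Not at h1
  by_cases h2 : CoxConnected A Set.univ
  · rcases h Set.univ h2 fun x _ y _ hxy => h1 x y hxy with h3 | h3
    · have := finite_cox_of_equiv (A' := A) (Equiv.Set.univ S) (fun _ _ => rfl) h3
      exact reducible_of_finite A
    · refine reducible_of_large A fun a b hab => ?_
      obtain ⟨k, hk⟩ := ENat.ne_top_iff_exists.1 (h1 a b hab)
      refine ⟨k, ?_, hk.symm⟩
      have := h3 a trivial b trivial hab
      rw [← hk] at this
      exact_mod_cast this
  · simp only [CoxConnected, not_forall] at h2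
    obtain ⟨x, -, y, -, hxy⟩ := h2
    let U : Set S := {z | Relation.ReflTransGen (coxAdj A Set.univ) x z}
    refine Commuting.reducible (U := U) (fun s hs t ht => ?_) (sub _ y hxy)
      (sub _ x fun hx => hx (Relation.ReflTransGen.refl : x ∈ U))
    have hst : s ≠ t := fun e => ht (e ▸ hs)
    refine ⟨hst, ?_⟩
    by_contra hm
    exact ht (Relation.ReflTransGen.tail hs ⟨trivial, trivial, hst, hm⟩)

end

/-- Theorem 2: if every connected full subgraph of the Coxeter graph with no
`∞`-labelled edge is of spherical or large type, then the presentation satisfies Property `H#`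
(with respect to some `S`-sequence of transversals), hence Property `H`; in particular
`w →_{0,1,2} ε ↔ w̄ = 1` for every word `w`. -/
theorem stmt1 {S : Type*} [Finite S] (A : ArtinData S)
    (hT : ∀ T : Set S, CoxConnected A T → (∀ x ∈ T, ∀ y ∈ T, x ≠ y → A.m x y ≠ ⊤) →
      SphericalType A T ∨ LargeTypeOn A T) :
    PropertyHSharp A ∧ PropertyH A ∧ ∀ w : Word S, Steps012 A w [] ↔ wbar A w = 1 := by
  have h : Reducible A := SphericalOrLarge.reducible fun T h1 h2 =>
    (hT T h1 h2).imp finite_cox_of_sphericalType id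
  exact ⟨h.propertyHSharp, h.propertyH, h.propertyH⟩

end ArtinTits
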